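/- Let c(2n) denote the number of diagonal-lattice walks of length 2n that start at (0,0), end at (0,0), and are confined to the three-quadrant cone C. Then c(2n) is asymptotically equivalent, as n → ∞, to (2^5 / 3^2) · (Γ(2/3) / π) · 4^{2n} / (2n)^{5/3}, where Γ is the Gamma function. -/

import Mathlib

/-- Square-lattice steps. -/
def squareSteps : Set (ℤ × ℤ) := {(1,0), (-1,0), (0,1), (0,-1)}

/-- Diagonal-lattice steps. -/
def diagSteps : Set (ℤ × ℤ) := {(1,1), (1,-1), (-1,1), (-1,-1)}

/-- The three-quadrant cone `C = {(i,j) : i ≥ 0 or j ≥ 0}`. -/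
def coneC : Set (ℤ × ℤ) := {p | 0 ≤ p.1 ∨ 0 ≤ p.2}

/-- The quadrant `Q = {(i,j) : i ≥ 0 and j ≥ 0}`. -/
def quadQ : Set (ℤ × ℤ) := {p | 0 ≤ p.1 ∧ 0 ≤ p.2}

/-- Number of walks of length `n` with steps in `steps`, from `a` to `b`,
confined to `region`. -/
noncomputable def walkCount (steps region : Set (ℤ × ℤ)) (a b : ℤ × ℤ) (n : ℕ) : ℕ :=
  Nat.card {w : Fin (n+1) → ℤ × ℤ //
    w 0 = a ∧ w (Fin.last n) = b ∧
    (∀ k : Fin n, w k.succ - w k.castSucc ∈ steps) ∧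
    (∀ k, w k ∈ region)}

def walkSet (steps region : Set (ℤ × ℤ)) (a b : ℤ × ℤ) (n : ℕ) : Type :=
  {w : Fin (n+1) → ℤ × ℤ //
    w 0 = a ∧ w (Fin.last n) = b ∧
    (∀ k : Fin n, w k.succ - w k.castSucc ∈ steps) ∧
    (∀ k, w k ∈ region)}

/-- Splitting off the first step of a walk. -/
def walkSetSuccEquiv (steps region : Set (ℤ × ℤ)) (a b : ℤ × ℤ) (n : ℕ) (ha : a ∈ region) :
    walkSet steps region a b (n+1) ≃ Σ s : steps, walkSet steps region (a + s) b n where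
  toFun w := ⟨⟨w.1 1 - w.1 0, by simpa using w.2.2.2.1 0⟩,
    ⟨fun k => w.1 k.succ, by
      obtain ⟨w, h0, h1, h2, h3⟩ := w
      refine ⟨?_, ?_, fun k => ?_, fun k => h3 _⟩
      · simp [← h0]
      · simpa using h1
      · simpa using h2 k.succ⟩⟩
  invFun x := ⟨Fin.cons a x.2.1, by
    obtain ⟨s, w, h0, h1, h2, h3⟩ := x
    refine ⟨rfl, ?_, fun k => ?_, fun k => ?_⟩
    · rw [← Fin.succ_last]; simpa using h1
    · refine Fin.cases ?_ (fun j => ?_) k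
      · simp [h0]
      · simpa using h2 j
    · refine Fin.cases ?_ (fun j => ?_) k
      · simpa using ha
      · simpa using h3 j⟩
  left_inv w := by
    obtain ⟨w, h0, h1, h2, h3⟩ := w
    apply Subtype.ext
    funext k
    refine Fin.cases ?_ (fun j => ?_) k
    · simp [h0]
    · simp
  right_inv x := by
    obtain ⟨⟨s, hs⟩, w, h0, h1, h2, h3⟩ := x
    have hh : w 0 - a = s := by rw [h0]; simp
    subst hh
    rfl

theorem walkSet_finite {steps : Set (ℤ × ℤ)} (region : Set (ℤ × ℤ)) (hs : steps.Finite)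
    (b : ℤ × ℤ) (n : ℕ) : ∀ a, Finite (walkSet steps region a b n) := by
  induction n with
  | zero =>
    intro a
    have : Subsingleton (walkSet steps region a b 0) := ⟨fun x y => by
      apply Subtype.ext
      funext k
      rw [Fin.fin_one_eq_zero k, x.2.1, y.2.1]⟩
    infer_instance
  | succ n ih =>
    intro a
    by_cases ha : a ∈ region
    · have := hs.to_subtype
      have := fun s : steps => ih (a + s)
      exact Finite.of_equiv _ (walkSetSuccEquiv steps region a b n ha).symm
    · have : IsEmpty (walkSet steps region a b (n+1)) := ⟨fun x => ha (by
        have := x.2.2.2.2 0; rwa [x.2.1] at this)⟩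
      infer_instance

theorem walkCount_succ_of_mem (region : Set (ℤ × ℤ)) (a b : ℤ × ℤ) (n : ℕ)
    (ha : a ∈ region) :
    walkCount diagSteps region a b (n+1) =
      walkCount diagSteps region (a + (1,1)) b n + walkCount diagSteps region (a + (1,-1)) b n +
      walkCount diagSteps region (a + (-1,1)) b n +
      walkCount diagSteps region (a + (-1,-1)) b n := by
  have hfin : diagSteps.Finite := by unfold diagSteps; exact Set.toFinite _
  have := hfin.fintype
  have := fun s : diagSteps => walkSet_finite region hfin b n (a + s)
  have h1 : walkCount diagSteps region a b (n+1) =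
      ∑ s : diagSteps, walkCount diagSteps region (a + s) b n := by
    change Nat.card (walkSet diagSteps region a b (n+1)) = _
    rw [Nat.card_congr (walkSetSuccEquiv diagSteps region a b n ha), Nat.card_sigma]
    rfl
  rw [h1]
  rw [← Finset.sum_subtype (({(1,1), (1,-1), (-1,1), (-1,-1)} : Finset (ℤ × ℤ)))
    (p := (· ∈ diagSteps)) (fun x => by simp [diagSteps])
    (fun s => walkCount diagSteps region (a + s) b n)]
  rw [Finset.sum_insert (by decide), Finset.sum_insert (by decide),
    Finset.sum_insert (by decide), Finset.sum_singleton]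
  ring

theorem walkCount_of_notMem (steps region : Set (ℤ × ℤ)) (a b : ℤ × ℤ) (n : ℕ)
    (ha : a ∉ region) : walkCount steps region a b n = 0 := by
  have : IsEmpty (walkSet steps region a b n) := ⟨fun x => ha (by
    have := x.2.2.2.2 0; rwa [x.2.1] at this)⟩
  change Nat.card (walkSet steps region a b n) = 0
  exact Nat.card_of_isEmpty

/-- Number of simple-lattice walks of length `n` from `(a, b)` to `(1, 0)` confined to
`{(a, b) : 1 ≤ a + |b|}`, the image of the three-quadrant cone in the coordinates
`a = (i + j) / 2 + 1`, `b = (i - j) / 2`. -/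
def coneWalks : ℕ → ℤ → ℤ → ℝ
  | 0, a, b => if a = 1 ∧ b = 0 then 1 else 0
  | n+1, a, b => if 1 ≤ a + |b| then
      coneWalks n (a+1) b + coneWalks n (a-1) b + coneWalks n a (b+1) + coneWalks n a (b-1) else 0

theorem walkCount_eq_coneWalks (n : ℕ) : ∀ a b : ℤ,
    (walkCount diagSteps coneC (a+b-1, a-b-1) (0,0) n : ℝ) = coneWalks n a b := by
  have hC : ∀ a b : ℤ, (a+b-1, a-b-1) ∈ coneC ↔ 1 ≤ a + |b| := by
    intro a b
    simp only [coneC, Set.mem_ofPred_eq]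
    rcases abs_cases b with h | h <;> omega
  induction n with
  | zero =>
    intro a b
    simp only [coneWalks]
    split_ifs with h
    · obtain ⟨rfl, rfl⟩ := h
      have : Unique (walkSet diagSteps coneC (0,0) (0,0) 0) :=
        { default := ⟨fun _ => (0,0), rfl, rfl, fun k => k.elim0, fun _ => by simp [coneC]⟩
          uniq := fun x => by
            apply Subtype.ext
            funext k
            rw [Fin.fin_one_eq_zero k]
            exact x.2.1 }
      have h2 : walkCount diagSteps coneC (0,0) (0,0) 0 = 1 := Nat.card_unique (α := walkSet diagSteps coneC (0,0) (0,0) 0)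
      simpa using h2
    · have : IsEmpty (walkSet diagSteps coneC (a+b-1, a-b-1) (0,0) 0) := ⟨fun x => by
        have h1 := x.2.1
        have h2 : x.1 0 = (0,0) := x.2.2.1
        rw [h1] at h2
        simp only [Prod.mk.injEq] at h2
        omega⟩
      have h2 : walkCount diagSteps coneC (a+b-1, a-b-1) (0,0) 0 = 0 :=
        Nat.card_of_isEmpty (α := walkSet diagSteps coneC (a+b-1, a-b-1) (0,0) 0)
      rw [h2]; simp
  | succ n ih =>
    intro a b
    simp only [coneWalks]
    split_ifs with h
    · rw [walkCount_succ_of_mem _ _ _ _ ((hC a b).2 h), ← ih, ← ih, ← ih, ← ih]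
      push_cast
      simp only [Prod.mk_add_mk]
      ring_nf
    · rw [walkCount_of_notMem _ _ _ _ _ (fun h' => h ((hC a b).1 h'))]
      simp

theorem coneWalks_nonneg (n : ℕ) (a b : ℤ) : 0 ≤ coneWalks n a b := by
  rw [← walkCount_eq_coneWalks]; positivity

theorem coneWalks_eq_zero (n : ℕ) : ∀ a b : ℤ, ¬ 1 ≤ a + |b| → coneWalks n a b = 0 := by
  cases n with
  | zero => intro a b h; simp only [coneWalks]; rw [if_neg]; rintro ⟨rfl, rfl⟩; simp at h
  | succ n => intro a b h; simp only [coneWalks]; rw [if_neg h]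

theorem coneWalks_parity (n : ℕ) : ∀ a b : ℤ, (n + a + b) % 2 = 0 → coneWalks n a b = 0 := by
  induction n with
  | zero =>
    intro a b h
    simp only [coneWalks]
    rw [if_neg]
    rintro ⟨rfl, rfl⟩
    simp at h
  | succ n ih =>
    intro a b h
    simp only [coneWalks]
    push_cast at h
    rw [ih, ih, ih, ih]
    · simp
    all_goals omega

theorem coneWalks_eq_zero_of_far (n : ℕ) :
    ∀ a b : ℤ, (n + 1 : ℤ) < |a| + |b| → coneWalks n a b = 0 := by
  induction n with
  | zero =>
    intro a b h
    simp only [coneWalks]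
    rw [if_neg]
    rintro ⟨rfl, rfl⟩
    simp at h
  | succ n ih =>
    intro a b h
    simp only [coneWalks]
    push_cast at h
    rw [ih, ih, ih, ih]
    · simp
    all_goals grind

/-- The functions `coneWalks n` on the plane `ℤ × ℤ`. -/
def coneFun (n : ℕ) (p : ℤ × ℤ) : ℝ := coneWalks n p.1 p.2

theorem coneFun_support_finite (n : ℕ) : (Function.support (coneFun n)).Finite := by
  apply (Finset.finite_toSet (Finset.Icc (-(n+1) : ℤ) (n+1) ×ˢ Finset.Icc (-(n+1) : ℤ) (n+1))).subset
  intro p hp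
  by_contra h
  apply hp
  apply coneWalks_eq_zero_of_far
  by_contra h'
  apply h
  simp only [Finset.coe_product, Finset.coe_Icc, Set.mem_prod, Set.mem_Icc]
  grind

theorem summable_coneFun_mul (n : ℕ) (g : ℤ × ℤ → ℝ) (e : ℤ × ℤ) :
    Summable fun p => coneFun n (p + e) * g p := by
  apply summable_of_hasFiniteSupport
  apply Set.Finite.subset ((coneFun_support_finite n).preimage
    (f := fun p => p + e) (add_left_injective e).injOn)
  intro p hp h
  apply hp
  simp only [h, zero_mul]

theorem tsum_coneFun_translate (m n : ℕ) (e : ℤ × ℤ) :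
    ∑' p, coneFun m (p + e) * coneFun n p = ∑' p, coneFun n (p + -e) * coneFun m p := by
  rw [← (Equiv.addRight e).tsum_eq (fun p => coneFun n (p + -e) * coneFun m p)]
  simp [mul_comm]

theorem coneFun_succ_mul (m n : ℕ) (p : ℤ × ℤ) :
    coneFun (m+1) p * coneFun n p =
      coneFun m (p + (1,0)) * coneFun n p + coneFun m (p + -(1,0)) * coneFun n p +
      coneFun m (p + (0,1)) * coneFun n p + coneFun m (p + -(0,1)) * coneFun n p := by
  by_cases h : 1 ≤ p.1 + |p.2|
  · simp only [coneFun, coneWalks, if_pos h]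
    simp [sub_eq_add_neg]
    ring
  · simp [coneFun, coneWalks_eq_zero n _ _ h]

theorem tsum_coneFun_succ (m n : ℕ) :
    ∑' p, coneFun (m+1) p * coneFun n p = ∑' p, coneFun m p * coneFun (n+1) p := by
  have h : ∀ m n, ∑' p, coneFun (m+1) p * coneFun n p =
      ∑' p, coneFun m (p + (1,0)) * coneFun n p + ∑' p, coneFun m (p + -(1,0)) * coneFun n p +
      ∑' p, coneFun m (p + (0,1)) * coneFun n p + ∑' p, coneFun m (p + -(0,1)) * coneFun n p := by
    intro m n
    simp_rw [coneFun_succ_mul]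
    have s := fun e => summable_coneFun_mul m (coneFun n) e
    rw [(((s _).add (s _)).add (s _)).tsum_add (s _), ((s _).add (s _)).tsum_add (s _),
      (s _).tsum_add (s _)]
  have h2 : ∑' p, coneFun m p * coneFun (n+1) p = ∑' p, coneFun (n+1) p * coneFun m p := by
    simp_rw [mul_comm]
  rw [h2, h, h, tsum_coneFun_translate m n, tsum_coneFun_translate m n,
    tsum_coneFun_translate m n, tsum_coneFun_translate m n]
  simp only [neg_neg]
  ring

theorem tsum_coneFun (m : ℕ) : ∀ n, ∑' p, coneFun m p * coneFun n p = coneWalks (m + n) 1 0 := by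
  induction m with
  | zero =>
    intro n
    rw [tsum_eq_single (1,0)]
    · simp [coneFun, coneWalks]
    · intro p hp
      have : ¬ (p.1 = 1 ∧ p.2 = 0) := fun h => hp (Prod.ext h.1 h.2)
      simp [coneFun, coneWalks, this]
  | succ m ih => intro n; rw [tsum_coneFun_succ, ih]; congr 1; omega

theorem coneWalks_le (n : ℕ) : coneWalks (2*(n+1)) 1 0 ≤ 16 * coneWalks (2*n) 1 0 := by
  have s := fun e => summable_coneFun_mul n (fun p => coneFun n (p + e)) e
  have t : ∀ e, ∑' p, coneFun n (p + e) * coneFun n (p + e) = coneWalks (2*n) 1 0 := by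
    intro e
    rw [two_mul, ← tsum_coneFun, ← (Equiv.addRight e).tsum_eq (fun p => coneFun n p * coneFun n p)]
    simp
  have h0 : coneWalks (2*(n+1)) 1 0 = ∑' p, coneFun (n+1) p * coneFun (n+1) p := by
    rw [tsum_coneFun]; congr 1; omega
  have hs := (((s (1,0)).add (s (-(1,0)))).add (s (0,1))).add (s (-(0,1)))
  have h1 : ∑' p, coneFun (n+1) p * coneFun (n+1) p ≤
      ∑' p, 4 * (coneFun n (p + (1,0)) * coneFun n (p + (1,0)) +
        coneFun n (p + -(1,0)) * coneFun n (p + -(1,0)) +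
        coneFun n (p + (0,1)) * coneFun n (p + (0,1)) +
        coneFun n (p + -(0,1)) * coneFun n (p + -(0,1))) := by
    apply Summable.tsum_le_tsum _ _ (hs.mul_left 4)
    · intro p
      by_cases h : 1 ≤ p.1 + |p.2|
      · simp only [coneFun, coneWalks, if_pos h]
        simp only [Prod.fst_add, Prod.snd_add, ← sub_eq_add_neg, Prod.fst_sub,
          Prod.snd_sub, sub_zero, add_zero]
        generalize coneWalks n (p.1 + 1) p.2 = x
        generalize coneWalks n (p.1 - 1) p.2 = y
        generalize coneWalks n p.1 (p.2 + 1) = z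
        generalize coneWalks n p.1 (p.2 - 1) = u
        nlinarith [sq_nonneg (x-y), sq_nonneg (x-z), sq_nonneg (x-u), sq_nonneg (y-z),
          sq_nonneg (y-u), sq_nonneg (z-u)]
      · have : coneFun (n+1) p = 0 := coneWalks_eq_zero (n+1) _ _ h
        rw [this]
        nlinarith [mul_self_nonneg (coneFun n (p + (1,0))), mul_self_nonneg (coneFun n (p + -(1,0))),
          mul_self_nonneg (coneFun n (p + (0,1))), mul_self_nonneg (coneFun n (p + -(0,1)))]
    · simpa using summable_coneFun_mul (n+1) (coneFun (n+1)) 0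
  rw [h0]
  refine h1.trans (le_of_eq ?_)
  rw [tsum_mul_left, (((s _).add (s _)).add (s _)).tsum_add (s _), ((s _).add (s _)).tsum_add (s _),
      (s _).tsum_add (s _), t, t, t, t]
  ring

/-- The extension of two families `I`, `J` to a function on the plane vanishing outside the
cone. -/
def glueFun (I J : ℤ → ℤ → ℝ) (a b : ℤ) : ℝ :=
  if 1 ≤ a + |b| then (if |b| ≤ a then I a |b| else J a |b|) else 0

theorem glueFun_harmonic {I J : ℤ → ℤ → ℝ} {t : ℝ}
    (hI : ∀ a b, I a b = t * (I (a+1) b + I (a-1) b + I a (b+1) + I a (b-1)))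
    (hJ : ∀ a b, J a b = t * (J (a+1) b + J (a-1) b + J a (b+1) + J a (b-1)))
    (hev : ∀ a b, I a (-b) = I a b) (hI0 : I 0 0 = 1) (hJ0 : J 0 0 = 0)
    (hglue : ∀ a b, 0 ≤ a → 0 ≤ b → 0 < a + b → I a b = J a b)
    (hbd : ∀ b, 1 ≤ b → J (-b) b = 0) (a b : ℤ) (hab : 1 ≤ a + |b|) :
    glueFun I J a b = t * (glueFun I J (a+1) b + glueFun I J (a-1) b + glueFun I J a (b+1) +
      glueFun I J a (b-1) + coneWalks 0 a b) := by
  wlog hb : 0 ≤ b generalizing b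
  · have := this (-b) (by rwa [abs_neg]) (by omega)
    have hs : ∀ a b, glueFun I J a (-b) = glueFun I J a b := fun a b => by
      simp [glueFun]
    have e1 : -b + 1 = -(b-1) := by ring
    have e2 : -b - 1 = -(b+1) := by ring
    rw [e1, e2] at this
    simp only [hs] at this
    rw [this]
    simp only [coneWalks, neg_eq_zero]
    ring
  rw [abs_of_nonneg hb] at hab
  have key1 : ∀ a b, 0 ≤ b → b ≤ a → 1 ≤ a + b → glueFun I J a b = I a b := by
    intro a b h1 h2 h3
    simp only [glueFun, abs_of_nonneg h1]
    rw [if_pos h3, if_pos h2]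
  have key2 : ∀ a b, 0 ≤ b → a ≤ b → 0 ≤ a + b → glueFun I J a b = J a b := by
    intro a b h1 h2 h3
    simp only [glueFun, abs_of_nonneg h1]
    by_cases h4 : 1 ≤ a + b
    · rw [if_pos h4]
      split_ifs with h5
      · exact hglue a b (by omega) h1 (by omega)
      · rfl
    · rw [if_neg h4]
      obtain rfl : a = -b := by omega
      rcases h1.eq_or_lt with rfl | h1
      · simpa using hJ0.symm
      · exact (hbd b (by omega)).symm
  rcases lt_or_ge b a with h | h
  · rw [key1 a b hb h.le hab, hI a b, key1 (a+1) b hb (by omega) (by omega),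
      key1 a (b+1) (by omega) (by omega) (by omega)]
    have h3 : glueFun I J (a-1) b + coneWalks 0 a b = I (a-1) b := by
      by_cases h0 : a = 1 ∧ b = 0
      · obtain ⟨rfl, rfl⟩ := h0
        simp [glueFun, coneWalks, hI0]
      · simp only [coneWalks, if_neg h0, add_zero]
        exact key1 _ _ hb (by omega) (by omega)
    have h4 : glueFun I J a (b-1) = I a (b-1) := by
      rcases hb.eq_or_lt with rfl | hb
      · have := key1 a 1 (by omega) (by omega) (by omega)
        simp only [zero_sub]
        rw [hev, ← this]
        simp [glueFun]
      · exact key1 _ _ (by omega) (by omega) (by omega)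
    rw [h4, ← h3]
    ring
  · have hd : coneWalks 0 a b = 0 := by
      simp only [coneWalks]; rw [if_neg]; omega
    rw [key2 a b hb h (by omega), hJ a b, key2 (a-1) b hb (by omega) (by omega),
      key2 a (b+1) (by omega) (by omega) (by omega), hd, add_zero]
    have h3 : glueFun I J (a+1) b = J (a+1) b := by
      rcases h.eq_or_lt with rfl | h
      · rw [key1 _ _ hb (by omega) (by omega)]
        exact hglue _ _ (by omega) (by omega) (by omega)
      · exact key2 _ _ hb (by omega) (by omega)
    have h4 : glueFun I J a (b-1) = J a (b-1) := by
      rcases h.eq_or_lt with rfl | h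
      · rw [key1 _ _ (by omega) (by omega) (by omega)]
        exact hglue _ _ (by omega) (by omega) (by omega)
      · exact key2 _ _ (by omega) (by omega) (by omega)
    rw [h3, h4]

theorem hasSum_of_bounded_harmonic {h : ℤ → ℤ → ℝ} {t B : ℝ} (ht : 0 < t) (ht4 : t < 1/4)
    (hB : ∀ a b, |h a b| ≤ B) (h0 : ∀ a b, ¬ 1 ≤ a + |b| → h a b = 0)
    (hh : ∀ a b, 1 ≤ a + |b| →
      h a b = t * (h (a+1) b + h (a-1) b + h a (b+1) + h a (b-1) + coneWalks 0 a b)) (a b : ℤ) :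
    HasSum (fun n => t^(n+1) * coneWalks n a b) (h a b) := by
  have key : ∀ n a b, |h a b - ∑ k ∈ Finset.range n, t^(k+1) * coneWalks k a b| ≤ (4*t)^n * B := by
    intro n
    induction n with
    | zero => intro a b; simpa using hB a b
    | succ n ih =>
      intro a b
      by_cases hc : 1 ≤ a + |b|
      · have e : h a b - ∑ k ∈ Finset.range (n+1), t^(k+1) * coneWalks k a b =
          t * ((h (a+1) b - ∑ k ∈ Finset.range n, t^(k+1) * coneWalks k (a+1) b) +
            (h (a-1) b - ∑ k ∈ Finset.range n, t^(k+1) * coneWalks k (a-1) b) +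
            (h a (b+1) - ∑ k ∈ Finset.range n, t^(k+1) * coneWalks k a (b+1)) +
            (h a (b-1) - ∑ k ∈ Finset.range n, t^(k+1) * coneWalks k a (b-1))) := by
          rw [hh a b hc, Finset.sum_range_succ']
          have : ∀ k, t^(k+1+1) * coneWalks (k+1) a b =
              t * (t^(k+1) * coneWalks k (a+1) b + t^(k+1) * coneWalks k (a-1) b +
               t^(k+1) * coneWalks k a (b+1) + t^(k+1) * coneWalks k a (b-1)) := by
            intro k
            simp only [coneWalks, if_pos hc]
            ring
          simp_rw [this]
          rw [← Finset.mul_sum, Finset.sum_add_distrib, Finset.sum_add_distrib,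
            Finset.sum_add_distrib]
          ring
        rw [e, abs_mul, abs_of_pos ht, pow_succ]
        calc _ ≤ t * ((4*t)^n*B + (4*t)^n*B + (4*t)^n*B + (4*t)^n*B) := by
              gcongr
              refine (abs_add_le _ _).trans (add_le_add ((abs_add_le _ _).trans
                (add_le_add ((abs_add_le _ _).trans (add_le_add ?_ ?_)) ?_)) ?_) <;> apply ih
          _ = _ := by ring
      · have : ∀ k, coneWalks k a b = 0 := fun k => coneWalks_eq_zero k a b hc
        simp only [h0 a b hc, this, mul_zero, Finset.sum_const_zero, sub_zero, abs_zero]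
        have : 0 ≤ B := (abs_nonneg _).trans (hB 0 0)
        positivity
  rw [hasSum_iff_tendsto_nat_of_nonneg (fun n => mul_nonneg (by positivity) (coneWalks_nonneg n a b))]
  rw [tendsto_iff_dist_tendsto_zero]
  have h1 : Filter.Tendsto (fun n => (4*t)^n * B) Filter.atTop (nhds 0) := by
    simpa using (tendsto_pow_atTop_nhds_zero_of_lt_one (by positivity)
      (by linarith : 4*t < 1)).mul_const B
  refine squeeze_zero (fun _ => dist_nonneg) (fun n => ?_) h1
  rw [dist_comm, Real.dist_eq]
  exact key n a b

theorem hasSum_coneWalks {I J : ℤ → ℤ → ℝ} {t B : ℝ} (ht : 0 < t) (ht4 : t < 1/4)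
    (hI : ∀ a b, I a b = t * (I (a+1) b + I (a-1) b + I a (b+1) + I a (b-1)))
    (hJ : ∀ a b, J a b = t * (J (a+1) b + J (a-1) b + J a (b+1) + J a (b-1)))
    (hev : ∀ a b, I a (-b) = I a b) (hI0 : I 0 0 = 1) (hJ0 : J 0 0 = 0)
    (hglue : ∀ a b, 0 ≤ a → 0 ≤ b → 0 < a + b → I a b = J a b)
    (hbd : ∀ b, 1 ≤ b → J (-b) b = 0)
    (hIB : ∀ a b, 0 ≤ a → |I a b| ≤ B) (hJB : ∀ a b, 0 ≤ b → |J a b| ≤ B) :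
    HasSum (fun n => t^(n+1) * coneWalks n 1 0) (I 1 0) := by
  have h1 : I 1 0 = glueFun I J 1 0 := by simp [glueFun]
  rw [h1]
  apply hasSum_of_bounded_harmonic (B := B) ht ht4
  · intro a b
    have hB : 0 ≤ B := (abs_nonneg _).trans (hJB 0 0 le_rfl)
    simp only [glueFun]
    split_ifs with h1 h2
    · exact hIB _ _ ((abs_nonneg b).trans h2)
    · exact hJB _ _ (abs_nonneg b)
    · simpa using hB
  · intro a b h; simp only [glueFun, if_neg h]
  · exact glueFun_harmonic hI hJ hev hI0 hJ0 hglue hbd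

/-- The `n`-th Fourier coefficient of `F` along the vertical line of abscissa `r`. -/
noncomputable def vcoef (F : ℂ → ℂ) (r : ℝ) (n : ℤ) : ℂ :=
  (2 * Real.pi : ℂ)⁻¹ * ∫ θ in (0:ℝ)..2 * Real.pi,
    F (r + θ * Complex.I) * Complex.exp (-(n * (θ * Complex.I)))

theorem vcoef_congr {F G : ℂ → ℂ} {r : ℝ} (h : ∀ z : ℂ, z.re = r → F z = G z) (n : ℤ) :
    vcoef F r n = vcoef G r n := by
  unfold vcoef
  congr 2
  ext θ
  rw [h]
  simp

theorem vcoef_const_mul (c : ℂ) (F : ℂ → ℂ) (r : ℝ) (n : ℤ) :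
    vcoef (fun z => c * F z) r n = c * vcoef F r n := by
  unfold vcoef
  simp_rw [mul_assoc c]
  rw [intervalIntegral.integral_const_mul]
  ring

theorem continuous_line {F : ℂ → ℂ} {r : ℝ} (hF : ∀ z : ℂ, z.re = r → ContinuousAt F z) :
    Continuous fun θ : ℝ => F (r + θ * Complex.I) := by
  rw [continuous_iff_continuousAt]
  intro θ
  exact ContinuousAt.comp (f := fun θ : ℝ => (r + θ * Complex.I : ℂ)) (hF _ (by simp))
    (by fun_prop)

theorem vcoef_integrable {F : ℂ → ℂ} {r : ℝ} (hF : ∀ z : ℂ, z.re = r → ContinuousAt F z) (n : ℤ)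
    (a b : ℝ) : IntervalIntegrable
      (fun θ : ℝ => F (r + θ * Complex.I) * Complex.exp (-(n * (θ * Complex.I))))
      MeasureTheory.volume a b := by
  apply Continuous.intervalIntegrable
  exact (continuous_line hF).mul (by fun_prop)

theorem vcoef_add {F G : ℂ → ℂ} {r : ℝ} (hF : ∀ z : ℂ, z.re = r → ContinuousAt F z)
    (hG : ∀ z : ℂ, z.re = r → ContinuousAt G z) (n : ℤ) :
    vcoef (fun z => F z + G z) r n = vcoef F r n + vcoef G r n := by
  unfold vcoef
  rw [← mul_add, ← intervalIntegral.integral_add (vcoef_integrable hF n _ _)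
    (vcoef_integrable hG n _ _)]
  simp_rw [add_mul]

theorem vcoef_one (r : ℝ) (n : ℤ) : vcoef (fun _ => 1) r n = if n = 0 then 1 else 0 := by
  unfold vcoef
  have hpi : (2 * Real.pi : ℂ) ≠ 0 := by
    simp [Real.pi_ne_zero]
  split_ifs with h
  · subst h
    simp only [Int.cast_zero, zero_mul, neg_zero, Complex.exp_zero, mul_one,
      intervalIntegral.integral_const]
    simp
    field_simp
  · have : ∀ θ : ℝ, (1:ℂ) * Complex.exp (-(n * (θ * Complex.I))) =
        Complex.exp ((-(n * Complex.I)) * θ) := by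
      intro θ; rw [one_mul]; congr 1; ring
    simp_rw [this]
    rw [integral_exp_mul_complex (by simpa using h)]
    have : -(↑n * Complex.I) * ((2 * Real.pi : ℝ) : ℂ) = ((-n : ℤ) : ℂ) * (2 * Real.pi * Complex.I) := by
      push_cast; ring
    rw [this, Complex.exp_int_mul_two_pi_mul_I]
    simp

theorem norm_vcoef_le {F : ℂ → ℂ} {r B : ℝ} (hF : ∀ z : ℂ, z.re = r → ‖F z‖ ≤ B) (n : ℤ) :
    ‖vcoef F r n‖ ≤ B := by
  unfold vcoef
  have hpi := Real.pi_pos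
  rw [norm_mul]
  have h1 : ‖∫ θ in (0:ℝ)..2 * Real.pi,
      F (r + θ * Complex.I) * Complex.exp (-(n * (θ * Complex.I)))‖ ≤ B * |2 * Real.pi - 0| := by
    apply intervalIntegral.norm_integral_le_of_norm_le_const
    intro θ _
    rw [norm_mul]
    have : ‖Complex.exp (-(n * (θ * Complex.I)))‖ = 1 := by
      rw [Complex.norm_exp]; simp
    rw [this, mul_one]
    exact hF _ (by simp)
  have h2 : ‖(2 * Real.pi : ℂ)⁻¹‖ = (2 * Real.pi)⁻¹ := by
    rw [norm_inv, norm_mul, Complex.norm_real]; simp [abs_of_pos hpi]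
  rw [h2]
  rw [sub_zero, abs_of_pos (by positivity)] at h1
  calc _ ≤ (2 * Real.pi)⁻¹ * (B * (2 * Real.pi)) := by gcongr
    _ = B := by field_simp

theorem periodic_line {F : ℂ → ℂ} (hp : ∀ z, F (z + 2 * Real.pi * Complex.I) = F z) (r : ℝ) (n : ℤ) :
    Function.Periodic (fun θ : ℝ => F (r + θ * Complex.I) * Complex.exp (-(n * (θ * Complex.I))))
      (2 * Real.pi) := by
  intro θ
  have e1 : (r + ((θ + 2 * Real.pi : ℝ) : ℂ) * Complex.I : ℂ) =
    (r + θ * Complex.I) + 2 * Real.pi * Complex.I := by push_cast; ring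
  have e2 : (-(n * (((θ + 2 * Real.pi : ℝ) : ℂ) * Complex.I)) : ℂ) =
    -(n * (θ * Complex.I)) + ((-n : ℤ) : ℂ) * (2 * Real.pi * Complex.I) := by push_cast; ring
  simp only [e1, e2, hp, Complex.exp_add, Complex.exp_int_mul_two_pi_mul_I, mul_one]

theorem vcoef_reflect {F : ℂ → ℂ} (hp : ∀ z, F (z + 2 * Real.pi * Complex.I) = F z) (s r : ℝ)
    (n : ℤ) : vcoef (fun z => F (s - z)) r n = vcoef F (s - r) (-n) := by
  unfold vcoef
  congr 1
  have h := (periodic_line hp (s - r) (-n)).intervalIntegral_add_eq (-(2 * Real.pi)) 0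
  simp only [neg_add_cancel, zero_add] at h
  rw [← h]
  have h2 := intervalIntegral.integral_comp_neg (a := 0) (b := 2 * Real.pi)
    (fun θ : ℝ => F ((s - r : ℝ) + θ * Complex.I) * Complex.exp (-((-n : ℤ) * (θ * Complex.I))))
  rw [neg_zero] at h2
  rw [← h2]
  congr 1
  ext θ
  push_cast
  congr 2
  · ring_nf
  · ring

theorem vcoef_translate (F : ℂ → ℂ) (s r : ℝ) (n : ℤ) :
    vcoef (fun z => F (z + s)) r n = vcoef F (r + s) n := by
  unfold vcoef
  congr 2
  ext θ
  congr 2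
  push_cast; ring_nf

theorem vcoef_exp_mul {F : ℂ → ℂ} (r : ℝ) (n : ℤ) :
    vcoef (fun z => Complex.exp z * F z) r n = Complex.exp r * vcoef F r (n - 1) := by
  unfold vcoef
  rw [mul_left_comm, ← intervalIntegral.integral_const_mul (Complex.exp r)]
  congr 2
  ext θ
  have e : Complex.exp r * Complex.exp (-((n - 1 : ℤ) * (θ * Complex.I))) =
      Complex.exp (r + θ * Complex.I) * Complex.exp (-(n * (θ * Complex.I))) := by
    rw [← Complex.exp_add, ← Complex.exp_add]
    congr 1
    push_cast; ring
  beta_reduce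
  linear_combination (-F (r + θ * Complex.I)) * e

theorem vcoef_shift {F : ℂ → ℂ} (hp : ∀ z, F (z + 2 * Real.pi * Complex.I) = F z) {r₁ r₂ : ℝ}
    (h : r₁ ≤ r₂) (hF : ∀ z : ℂ, r₁ ≤ z.re → z.re ≤ r₂ → DifferentiableAt ℂ F z) (n : ℤ) :
    vcoef F r₂ n = Complex.exp (n * (r₂ - r₁)) * vcoef F r₁ n := by
  have hpi := Real.pi_pos
  have key := Complex.integral_boundary_rect_eq_zero_of_differentiableOn
    (fun z => F z * Complex.exp (-(n * z))) (r₁ : ℂ) (r₂ + 2 * Real.pi * Complex.I) (by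
      intro z hz
      simp only [Complex.mem_reProdIm, Complex.ofReal_re, Complex.ofReal_im, Complex.add_re] at hz
      have h1 := hz.1
      simp at h1
      rw [Set.uIcc_of_le h] at h1
      exact ((hF z h1.1 h1.2).mul (by fun_prop)).differentiableWithinAt)
  simp only [Complex.ofReal_re, Complex.ofReal_im, Complex.add_re, Complex.add_im, Complex.mul_re,
    Complex.mul_im, Complex.I_re, Complex.I_im, mul_zero, mul_one, zero_add, sub_zero, add_zero,
    Complex.re_ofNat, Complex.im_ofNat, zero_mul, sub_self, Complex.ofReal_zero] at key
  have e1 : ∀ x : ℝ, F (x + ((2 * Real.pi : ℝ) : ℂ) * Complex.I) *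
      Complex.exp (-(n * (x + ((2 * Real.pi : ℝ) : ℂ) * Complex.I))) =
      F x * Complex.exp (-(n * x)) := by
    intro x
    have e2 : (-(n * (x + ((2 * Real.pi : ℝ) : ℂ) * Complex.I)) : ℂ) =
      -(n * x) + ((-n : ℤ) : ℂ) * (2 * Real.pi * Complex.I) := by push_cast; ring
    rw [e2, Complex.exp_add, Complex.exp_int_mul_two_pi_mul_I, mul_one]
    push_cast
    rw [hp]
  simp_rw [e1] at key
  rw [sub_self, zero_add] at key
  have e3 : ∀ r : ℝ, ∫ y in (0:ℝ)..2 * Real.pi,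
      F (r + y * Complex.I) * Complex.exp (-(n * (r + y * Complex.I))) =
      Complex.exp (-(n * r)) * ∫ y in (0:ℝ)..2 * Real.pi,
        F (r + y * Complex.I) * Complex.exp (-(n * (y * Complex.I))) := by
    intro r
    rw [← intervalIntegral.integral_const_mul]
    congr 1
    ext y
    rw [mul_add, neg_add, Complex.exp_add]
    ring
  rw [e3, e3] at key
  unfold vcoef
  rw [← smul_sub, smul_eq_mul, mul_eq_zero, or_iff_right Complex.I_ne_zero, sub_eq_zero] at key
  rw [mul_left_comm]
  congr 1
  have e4 : Complex.exp (n * (r₂ - r₁)) = Complex.exp (n * r₂) * Complex.exp (-(n * r₁)) := by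
    rw [← Complex.exp_add]; congr 1; ring
  rw [e4, mul_assoc, ← key, ← mul_assoc, ← Complex.exp_add]
  simp

theorem summable_exp_neg_abs {δ : ℝ} (hδ : 0 < δ) :
    Summable fun n : ℤ => Real.exp (-(δ * |(n:ℝ)|)) := by
  have h : Summable fun n : ℕ => Real.exp (-(δ * n)) := by
    have := Real.summable_exp_nat_mul_iff.2 (neg_lt_zero.2 hδ)
    refine this.congr fun n => ?_
    congr 1; ring
  apply Summable.of_nat_of_neg <;> simpa using h

theorem bounded_on_line {F : ℂ → ℂ} (hp : ∀ z, F (z + 2 * Real.pi * Complex.I) = F z) {r : ℝ}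
    (hF : ∀ z : ℂ, z.re = r → ContinuousAt F z) : ∃ B, ∀ z : ℂ, z.re = r → ‖F z‖ ≤ B := by
  have hper : Function.Periodic (fun θ : ℝ => F (r + θ * Complex.I)) (2 * Real.pi) := by
    simpa using periodic_line hp r 0
  have hc := continuous_line hF
  have hb := hper.isBounded_of_continuous (by positivity) hc
  obtain ⟨B, hB⟩ := hb.exists_norm_le
  refine ⟨B, fun z hz => ?_⟩
  have : z = (r + z.im * Complex.I) := by rw [← hz]; simp
  rw [this]
  exact hB _ ⟨z.im, rfl⟩

theorem norm_vcoef_le_exp {F : ℂ → ℂ} (hp : ∀ z, F (z + 2 * Real.pi * Complex.I) = F z) {r δ : ℝ}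
    (hδ : 0 < δ)
    (hF : ∀ z : ℂ, r - δ ≤ z.re → z.re ≤ r + δ → DifferentiableAt ℂ F z) :
    ∃ B, ∀ n : ℤ, ‖vcoef F r n‖ ≤ B * Real.exp (-(δ * |(n:ℝ)|)) := by
  obtain ⟨B₁, hB₁⟩ := bounded_on_line hp (r := r - δ)
    (fun z hz => (hF z hz.ge (by linarith)).continuousAt)
  obtain ⟨B₂, hB₂⟩ := bounded_on_line hp (r := r + δ)
    (fun z hz => (hF z (by linarith) hz.le).continuousAt)
  refine ⟨max B₁ B₂, fun n => ?_⟩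
  have e : ∀ x : ℝ, ‖Complex.exp (n * x)‖ = Real.exp (n * x) := by
    intro x; rw [Complex.norm_exp]; simp
  rcases le_total 0 n with hn | hn
  · have h := vcoef_shift hp (by linarith : r ≤ r + δ)
      (fun z h1 h2 => hF z (by linarith) h2) n
    have h2 := norm_vcoef_le hB₂ n
    have e5 : ((r + δ : ℝ) : ℂ) - r = (δ : ℝ) := by push_cast; ring
    rw [h, norm_mul, e5, e] at h2
    have hn' : |(n:ℝ)| = n := abs_of_nonneg (by exact_mod_cast hn)
    rw [hn', Real.exp_neg, ← div_eq_mul_inv, le_div_iff₀ (Real.exp_pos _)]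
    rw [mul_comm, mul_comm δ]
    exact h2.trans (le_max_right _ _)
  · have h := vcoef_shift hp (by linarith : r - δ ≤ r)
      (fun z h1 h2 => hF z h1 (by linarith)) n
    have h2 := norm_vcoef_le hB₁ n
    have e5 : (r : ℂ) - ((r - δ : ℝ) : ℂ) = (δ : ℝ) := by push_cast; ring
    have hn' : |(n:ℝ)| = -n := abs_of_nonpos (by exact_mod_cast hn)
    rw [h, norm_mul, e5, e, hn', mul_comm δ, neg_mul, neg_neg, mul_comm]
    gcongr
    exact h2.trans (le_max_left _ _)

theorem hasSum_vcoef {F : ℂ → ℂ} (hp : ∀ z, F (z + 2 * Real.pi * Complex.I) = F z) {r δ : ℝ}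
    (hδ : 0 < δ)
    (hF : ∀ z : ℂ, r - δ ≤ z.re → z.re ≤ r + δ → DifferentiableAt ℂ F z) :
    HasSum (fun n => vcoef F r n) (F r) := by
  have hpi := Real.pi_pos
  have : Fact (0 < 2 * Real.pi) := ⟨by positivity⟩
  have hper : Function.Periodic (fun θ : ℝ => F (r + θ * Complex.I)) (2 * Real.pi) := by
    simpa using periodic_line hp r 0
  have hc : Continuous fun θ : ℝ => F (r + θ * Complex.I) :=
    continuous_line (fun z hz => (hF z (by linarith) (by linarith)).continuousAt)
  let f : C(AddCircle (2 * Real.pi), ℂ) := ⟨hper.lift, by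
    exact continuous_coinduced_dom.2 hc⟩
  have hcoef : ∀ n, fourierCoeff f n = vcoef F r n := by
    intro n
    rw [fourierCoeff_eq_intervalIntegral f n 0, zero_add]
    unfold vcoef
    rw [Complex.real_smul]
    push_cast
    rw [one_div]
    congr 2
    ext θ
    rw [smul_eq_mul, mul_comm]
    have e1 : f (θ : AddCircle (2 * Real.pi)) = F (r + θ * Complex.I) := hper.lift_coe θ
    rw [e1, fourier_coe_apply]
    congr 2
    push_cast
    field_simp
  have hs : Summable (fourierCoeff f) := by
    obtain ⟨B, hB⟩ := norm_vcoef_le_exp hp hδ hF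
    apply Summable.of_norm_bounded ((summable_exp_neg_abs hδ).mul_left B)
    intro n
    rw [hcoef]
    exact hB n
  have := has_pointwise_sum_fourier_series_of_summable hs 0
  have e2 : f 0 = F r := by
    have h0 := hper.lift_coe 0
    simp only [Complex.ofReal_zero, zero_mul, add_zero] at h0
    exact h0
  rw [e2] at this
  simpa [hcoef] using this

/-- A uniformization `z ↦ (w z, w (-z))` of the kernel curve of the simple walk. -/
structure KernelParam (ε t : ℝ) (w J : ℂ → ℂ) : Prop where
  pos : 0 < ε
  t_pos : 0 < t
  t_lt : t < 1/4
  diff : ∀ z : ℂ, -2*ε < z.re → z.re < 4*ε → DifferentiableAt ℂ w z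
  per : ∀ z, w (z + 2 * Real.pi * Complex.I) = w z
  refl : ∀ z, w (2*ε - z) = w z
  quasi : ∀ z : ℂ, -2*ε < z.re → z.re < 0 → w z * w (z + 4*ε) = 1
  ne_zero : ∀ z : ℂ, 0 < z.re → z.re < 2*ε → w z ≠ 0
  kernel : ∀ z : ℂ, 0 < z.re → z.re < 2*ε →
    t * (w z + (w z)⁻¹ + w (-z) + (w (-z))⁻¹) = 1
  conj : ∀ z : ℂ, w (starRingEnd ℂ z) = starRingEnd ℂ (w z)
  zero : w 0 = 0
  pos_mid : 0 < (w ε).re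
  sign : ∀ x : ℝ, 0 < x → x ≤ ε → (w x).re * (w (-x)).re < 0
  diffJ : ∀ z : ℂ, -2*ε < z.re → z.re < 2*ε → DifferentiableAt ℂ J z
  perJ : ∀ z, J (z + 2 * Real.pi * Complex.I) = J z
  mulJ : ∀ z : ℂ, -2*ε < z.re → z.re < 2*ε → J z * w z = 1 - Complex.exp z

namespace KernelParam

variable {ε t : ℝ} {w J : ℂ → ℂ}

theorem ofReal_re (h : KernelParam ε t w J) (x : ℝ) : ((w x).re : ℂ) = w x := by
  have := h.conj x
  rw [Complex.conj_ofReal] at this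
  exact Complex.conj_eq_iff_re.1 this.symm

theorem per_neg (h : KernelParam ε t w J) (z : ℂ) : w (z - 2 * Real.pi * Complex.I) = w z := by
  rw [← h.per]; congr 1; ring

theorem neg_ne_zero (h : KernelParam ε t w J) {z : ℂ} (h1 : 0 < z.re) (h2 : z.re < 2*ε) :
    w (-z) ≠ 0 := by
  intro h0
  have := h.quasi (-z) (by simp; linarith) (by simp; linarith)
  rw [h0, zero_mul] at this
  exact zero_ne_one this

theorem neg_inv (h : KernelParam ε t w J) {z : ℂ} (h1 : 0 < z.re) (h2 : z.re < 2*ε) :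
    (w (-z))⁻¹ = w (z - 2*ε) := by
  have h3 := h.quasi (-z) (by simp; linarith) (by simp; linarith)
  have h4 := h.refl (-z + 4*ε)
  rw [← h4] at h3
  rw [inv_eq_of_mul_eq_one_right h3]
  congr 1; ring

theorem conj_line {z : ℂ} (hz : z.re = ε) : 2*ε - z = starRingEnd ℂ z := by
  apply Complex.ext
  · simp [hz]; ring
  · simp

theorem norm_neg (h : KernelParam ε t w J) {z : ℂ} (hz : z.re = ε) : ‖w (-z)‖ = 1 := by
  have hε := h.pos
  have h1 := h.neg_inv (z := z) (by linarith) (by linarith)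
  have h2 : z - 2*ε = starRingEnd ℂ (-z) := by
    rw [map_neg, ← conj_line hz]; ring
  rw [h2, h.conj] at h1
  have h3 := congrArg norm h1
  rw [norm_inv, RCLike.norm_conj] at h3
  have h4 : 0 < ‖w (-z)‖ := norm_pos_iff.2 (h.neg_ne_zero (by linarith) (by linarith))
  field_simp at h3
  nlinarith

theorem line_real (h : KernelParam ε t w J) {z : ℂ} (hz : z.re = ε) : ((w z).re : ℂ) = w z := by
  have := h.conj z
  rw [← conj_line hz, h.refl] at this
  exact Complex.conj_eq_iff_re.1 this.symm

theorem line_kernel (h : KernelParam ε t w J) {z : ℂ} (hz : z.re = ε) :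
    t * ((w z).re + ((w z).re)⁻¹ + 2 * (w (-z)).re) = 1 := by
  have hε := h.pos
  have h1 := h.kernel z (by linarith) (by linarith)
  have h2 : (w (-z))⁻¹ = starRingEnd ℂ (w (-z)) := by
    rw [Complex.inv_def, Complex.normSq_eq_norm_sq, h.norm_neg hz]; simp
  rw [h2, ← h.line_real hz, add_assoc _ (w (-z)), Complex.add_conj] at h1
  rw [← Complex.ofReal_inv, ← Complex.ofReal_add, ← Complex.ofReal_add, ← Complex.ofReal_mul] at h1
  exact_mod_cast h1

theorem line_pos (h : KernelParam ε t w J) {z : ℂ} (hz : z.re = ε) :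
    0 < (w z).re ∧ (w z).re ≠ 1 := by
  have h1 := h.line_kernel hz
  have ht := h.t_pos
  have ht4 := h.t_lt
  have h2 : (w (-z)).re ≤ 1 := (Complex.re_le_norm _).trans (h.norm_neg hz).le
  have h3 : 2 < (w z).re + ((w z).re)⁻¹ := by nlinarith
  constructor
  · by_contra hn
    push Not at hn
    have : ((w z).re)⁻¹ ≤ 0 := inv_nonpos.2 hn
    linarith
  · intro h4; rw [h4] at h3; norm_num at h3

theorem real_continuousOn (h : KernelParam ε t w J) :
    ContinuousOn (fun x : ℝ => (w x).re) (Set.Icc 0 ε) := by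
  have hε := h.pos
  intro x hx
  apply ContinuousAt.continuousWithinAt
  apply Complex.continuous_re.continuousAt.comp
  exact ContinuousAt.comp (f := fun x : ℝ => (x : ℂ))
    (h.diff x (by simp; linarith [hx.1]) (by simp; linarith [hx.2])).continuousAt (by fun_prop)

theorem mid_lt_one (h : KernelParam ε t w J) : (w ε).re < 1 := by
  have hε := h.pos
  by_contra hn
  push Not at hn
  obtain ⟨x, hx, hx1⟩ := intermediate_value_Icc hε.le h.real_continuousOn
    (show (1:ℝ) ∈ Set.Icc _ _ from ⟨by simp [h.zero], hn⟩)
  have hx0 : 0 < x := by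
    rcases hx.1.eq_or_lt with h0 | h0
    · rw [← h0] at hx1; simp [h.zero] at hx1
    · exact h0
  have h1 := h.kernel x (by simpa using hx0) (by simp; linarith [hx.2])
  have h2 := h.sign x hx0 hx.2
  have e1 := h.ofReal_re x
  have e2 := h.ofReal_re (-x)
  push_cast at e2
  simp only at hx1
  rw [← e1, ← e2, hx1] at h1
  rw [hx1] at h2
  have h3 : t * (1 + 1⁻¹ + (w (-x)).re + ((w (-x)).re)⁻¹) = 1 := by exact_mod_cast h1
  have h4 : ((w (-x)).re)⁻¹ < 0 := inv_lt_zero.2 (by linarith)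
  have ht := h.t_pos
  have ht4 := h.t_lt
  nlinarith

theorem mid_kernel (h : KernelParam ε t w J) : (w ε).re + ((w ε).re)⁻¹ = 1/t + 2 := by
  have ht := h.t_pos
  have h1 := h.line_kernel (z := ε) (by simp)
  have h2 := h.sign ε h.pos le_rfl
  have h3 := h.norm_neg (z := ε) (by simp)
  have e2 := h.ofReal_re (-ε)
  push_cast at e2
  rw [← e2, Complex.norm_real, Real.norm_eq_abs] at h3
  have h4 : (w (-ε)).re < 0 := by
    have := h.pos_mid
    by_contra hn
    push Not at hn
    nlinarith
  rw [abs_of_neg h4] at h3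
  have h5 : (w (-ε)).re = -1 := by linarith
  rw [h5] at h1
  have h6 : (w ε).re + ((w ε).re)⁻¹ + 2 * -1 = 1/t := eq_div_of_mul_eq ht.ne' (by linarith)
  linarith

theorem line_lt_one (h : KernelParam ε t w J) {z : ℂ} (hz : z.re = ε) : (w z).re < 1 := by
  have hε := h.pos
  have hc : Continuous fun θ : ℝ => (w (ε + θ * Complex.I)).re :=
    Complex.continuous_re.comp (continuous_line fun z hz =>
      (h.diff z (by linarith) (by linarith)).continuousAt)
  by_contra hn
  push Not at hn
  have ez : (ε + z.im * Complex.I : ℂ) = z := by rw [← hz]; simp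
  obtain ⟨θ, hθ⟩ := mem_range_of_exists_le_of_exists_ge hc (c := 1)
    ⟨0, by simpa using h.mid_lt_one.le⟩ ⟨z.im, by simpa [ez] using hn⟩
  exact (h.line_pos (z := ε + θ * Complex.I) (by simp)).2 hθ

theorem norm_line (h : KernelParam ε t w J) {z : ℂ} (hz : z.re = ε) : ‖w z‖ ≤ 1 := by
  rw [← h.line_real hz, Complex.norm_real, Real.norm_eq_abs, abs_of_pos (h.line_pos hz).1]
  exact (h.line_lt_one hz).le

end KernelParam

/-- Linear functional built from the Fourier coefficients on a vertical line. -/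
noncomputable def lineSum (φ : ℤ → ℝ) (F : ℂ → ℂ) (r : ℝ) : ℝ :=
  (∑' n, (φ n : ℂ) * vcoef F r n).re

theorem summable_lineSum {φ : ℤ → ℝ} (hφ : Summable φ) {F : ℂ → ℂ} {r B : ℝ}
    (hF : ∀ z : ℂ, z.re = r → ‖F z‖ ≤ B) : Summable fun n => (φ n : ℂ) * vcoef F r n := by
  apply Summable.of_norm_bounded (hφ.abs.mul_right B)
  intro n
  rw [norm_mul, Complex.norm_real, Real.norm_eq_abs]
  exact mul_le_mul_of_nonneg_left (norm_vcoef_le hF n) (abs_nonneg _)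

theorem abs_lineSum_le {φ : ℤ → ℝ} (hφ : Summable φ) {F : ℂ → ℂ} {r B : ℝ}
    (hF : ∀ z : ℂ, z.re = r → ‖F z‖ ≤ B) : |lineSum φ F r| ≤ (∑' n, |φ n|) * B := by
  refine (Complex.abs_re_le_norm _).trans ?_
  rw [← tsum_mul_right]
  apply tsum_of_norm_bounded (hφ.abs.mul_right B).hasSum
  intro n
  rw [norm_mul, Complex.norm_real, Real.norm_eq_abs]
  exact mul_le_mul_of_nonneg_left (norm_vcoef_le hF n) (abs_nonneg _)

theorem lineSum_congr (φ : ℤ → ℝ) {F G : ℂ → ℂ} {r : ℝ} (h : ∀ z : ℂ, z.re = r → F z = G z) :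
    lineSum φ F r = lineSum φ G r := by
  simp only [lineSum, vcoef_congr h]

theorem lineSum_const_mul (φ : ℤ → ℝ) (c : ℝ) (F : ℂ → ℂ) (r : ℝ) :
    lineSum φ (fun z => c * F z) r = c * lineSum φ F r := by
  simp only [lineSum, vcoef_const_mul, mul_left_comm _ (c : ℂ), tsum_mul_left, Complex.re_ofReal_mul]

theorem lineSum_add {φ : ℤ → ℝ} (hφ : Summable φ) {F G : ℂ → ℂ} {r B C : ℝ}
    (hF : ∀ z : ℂ, z.re = r → ‖F z‖ ≤ B) (hG : ∀ z : ℂ, z.re = r → ‖G z‖ ≤ C)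
    (hFc : ∀ z : ℂ, z.re = r → ContinuousAt F z) (hGc : ∀ z : ℂ, z.re = r → ContinuousAt G z) :
    lineSum φ (fun z => F z + G z) r = lineSum φ F r + lineSum φ G r := by
  simp only [lineSum, vcoef_add hFc hGc, mul_add]
  rw [(summable_lineSum hφ hF).tsum_add (summable_lineSum hφ hG), Complex.add_re]

theorem Real.cosh_le_exp_abs (x : ℝ) : Real.cosh x ≤ Real.exp |x| := by
  rw [← Real.cosh_abs, Real.cosh_eq]
  have : Real.exp (-|x|) ≤ Real.exp |x| := Real.exp_le_exp.2 (by linarith [abs_nonneg x])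
  linarith

theorem Real.exp_abs_le_two_mul_cosh (x : ℝ) : Real.exp |x| ≤ 2 * Real.cosh x := by
  rw [← Real.cosh_abs, Real.cosh_eq]
  have : 0 < Real.exp (-|x|) := Real.exp_pos _
  linarith

noncomputable def innerWeight (ε : ℝ) (n : ℤ) : ℝ := Real.cosh (2 * (n * ε)) / Real.cosh (3 * (n * ε))

noncomputable def outerWeight (ε : ℝ) (n : ℤ) : ℝ :=
  Real.exp (-(n * ε)) * Real.sinh (n * ε) / Real.cosh (3 * (n * ε))

theorem summable_of_le_exp_div_cosh {ε : ℝ} (hε : 0 < ε) {f : ℤ → ℝ}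
    (h : ∀ n : ℤ, |f n| ≤ Real.exp (2 * |n * ε|) / Real.cosh (3 * (n * ε))) : Summable f := by
  apply Summable.of_norm_bounded ((summable_exp_neg_abs hε).mul_left 2)
  intro n
  rw [Real.norm_eq_abs]
  refine (h n).trans ?_
  rw [div_le_iff₀ (Real.cosh_pos _)]
  have h1 := Real.exp_abs_le_two_mul_cosh (3 * (n * ε))
  have h2 : Real.exp (2 * |n * ε|) = Real.exp (-(ε * |(n:ℝ)|)) * Real.exp |3 * (n * ε)| := by
    rw [← Real.exp_add]
    congr 1
    simp only [abs_mul, abs_of_pos hε, abs_of_pos (show (0:ℝ) < 3 by norm_num)]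
    ring
  rw [h2]
  nlinarith [Real.exp_pos (-(ε * |(n:ℝ)|))]

theorem summable_innerWeight {ε : ℝ} (hε : 0 < ε) : Summable (innerWeight ε) := by
  apply summable_of_le_exp_div_cosh hε
  intro n
  rw [innerWeight, abs_of_pos (div_pos (Real.cosh_pos _) (Real.cosh_pos _))]
  gcongr
  · have := Real.cosh_le_exp_abs (2 * (n * ε))
    rwa [abs_mul, abs_of_pos (show (0:ℝ) < 2 by norm_num)] at this

theorem summable_outerWeight {ε : ℝ} (hε : 0 < ε) : Summable (outerWeight ε) := by
  apply summable_of_le_exp_div_cosh hε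
  intro n
  rw [outerWeight, abs_div, abs_mul, abs_of_pos (Real.exp_pos _), abs_of_pos (Real.cosh_pos _)]
  gcongr
  · rw [two_mul, Real.exp_add]
    have h1 : |Real.sinh (n * ε)| ≤ Real.exp |n * ε| := by
      refine le_trans ?_ (Real.cosh_le_exp_abs _)
      rw [abs_le]
      constructor
      · rw [Real.sinh_eq, Real.cosh_eq]; linarith [Real.exp_pos (n * ε)]
      · exact (Real.sinh_lt_cosh _).le
    have h2 : Real.exp (-(n * ε)) ≤ Real.exp |n * ε| := Real.exp_le_exp.2 (neg_le_abs _)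
    gcongr

theorem innerWeight_neg (ε : ℝ) (n : ℤ) : innerWeight ε (-n) = innerWeight ε n := by
  simp only [innerWeight]
  push_cast
  simp [neg_mul, mul_neg, Real.cosh_neg]

theorem lineSum_even {φ : ℤ → ℝ} (hφ : ∀ n, φ (-n) = φ n) {F G : ℂ → ℂ} {r : ℝ}
    (h : ∀ n, vcoef G r n = vcoef F r (-n)) : lineSum φ G r = lineSum φ F r := by
  simp only [lineSum, h]
  rw [← (Equiv.neg ℤ).tsum_eq (fun n => (φ n : ℂ) * vcoef F r n)]
  simp [hφ]

namespace KernelParam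

variable {ε t : ℝ} {w J : ℂ → ℂ}

/-- The Laurent monomials in the two coordinate functions. -/
noncomputable def mono (w : ℂ → ℂ) (a b : ℤ) (z : ℂ) : ℂ := w z ^ a * w (-z) ^ b

theorem mono_per (h : KernelParam ε t w J) (a b : ℤ) (z : ℂ) :
    mono w a b (z + 2 * Real.pi * Complex.I) = mono w a b z := by
  simp only [mono, h.per, neg_add', h.per_neg]

theorem mono_neg (a b : ℤ) (z : ℂ) : mono w a b (-z) = mono w b a z := by
  simp [mono, mul_comm]

theorem diff_comp_neg (h : KernelParam ε t w J) (z : ℂ) (h1 : -4*ε < z.re) (h2 : z.re < 2*ε) :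
    DifferentiableAt ℂ (fun z => w (-z)) z :=
  DifferentiableAt.comp z (h.diff (-z) (by simp; linarith) (by simp; linarith)) (by fun_prop)

theorem mono_cont (h : KernelParam ε t w J) (a b : ℤ) {z : ℂ} (hz : z.re = ε) :
    ContinuousAt (mono w a b) z := by
  have hε := h.pos
  apply ContinuousAt.mul
  · exact (h.diff z (by linarith) (by linarith)).continuousAt.zpow₀ _
      (Or.inl (h.ne_zero z (by linarith) (by linarith)))
  · exact (h.diff_comp_neg z (by linarith) (by linarith)).continuousAt.zpow₀ _
      (Or.inl (h.neg_ne_zero (by linarith) (by linarith)))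

theorem mono_cont_neg (h : KernelParam ε t w J) (a b : ℤ) {z : ℂ} (hz : z.re = -ε) :
    ContinuousAt (mono w a b) z := by
  have : mono w a b = fun z => mono w b a (-z) := by ext z; rw [mono_neg]
  rw [this]
  exact ContinuousAt.comp (f := fun z : ℂ => -z) (h.mono_cont b a (by simp [hz])) (by fun_prop)

theorem mono_kernel (h : KernelParam ε t w J) (a b : ℤ) {z : ℂ} (h0 : 0 < z.re)
    (h2 : z.re < 2*ε) :
    mono w a b z = t * (((mono w (a+1) b z + mono w (a-1) b z) + mono w a (b+1) z) +
      mono w a (b-1) z) := by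
  have h3 := h.ne_zero z h0 h2
  have h4 := h.neg_ne_zero h0 h2
  have h1 := h.kernel z h0 h2
  simp only [mono, zpow_add_one₀ h3, zpow_sub_one₀ h3, zpow_add_one₀ h4, zpow_sub_one₀ h4]
  linear_combination (-(w z ^ a * w (-z) ^ b)) * h1

theorem mono_kernel_neg (h : KernelParam ε t w J) (a b : ℤ) {z : ℂ} (h0 : z.re < 0)
    (h2 : -2*ε < z.re) :
    mono w a b z = t * (((mono w (a+1) b z + mono w (a-1) b z) + mono w a (b+1) z) +
      mono w a (b-1) z) := by
  have := h.mono_kernel b a (z := -z) (by simpa) (by simp; linarith)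
  simp only [mono_neg] at this
  rw [this]
  ring

theorem lineSum_mono_harmonic (h : KernelParam ε t w J) {φ : ℤ → ℝ} (hφ : Summable φ) {r : ℝ}
    (hr : r = ε ∨ r = -ε) (a b : ℤ) : lineSum φ (mono w a b) r =
      t * (lineSum φ (mono w (a+1) b) r + lineSum φ (mono w (a-1) b) r +
        lineSum φ (mono w a (b+1)) r + lineSum φ (mono w a (b-1)) r) := by
  have hε := h.pos
  have hk : ∀ z : ℂ, z.re = r → mono w a b z =
      t * (((mono w (a+1) b z + mono w (a-1) b z) + mono w a (b+1) z) + mono w a (b-1) z) := by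
    intro z hz
    rcases hr with rfl | rfl
    · exact h.mono_kernel a b (by linarith) (by linarith)
    · exact h.mono_kernel_neg a b (by linarith) (by linarith)
  have hc : ∀ a b, ∀ z : ℂ, z.re = r → ContinuousAt (mono w a b) z := by
    intro a b z hz
    rcases hr with rfl | rfl
    · exact h.mono_cont a b hz
    · exact h.mono_cont_neg a b hz
  obtain ⟨B₁, h1⟩ := bounded_on_line (h.mono_per (a+1) b) (hc (a+1) b)
  obtain ⟨B₂, h2⟩ := bounded_on_line (h.mono_per (a-1) b) (hc (a-1) b)
  obtain ⟨B₃, h3⟩ := bounded_on_line (h.mono_per a (b+1)) (hc a (b+1))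
  obtain ⟨B₄, h4⟩ := bounded_on_line (h.mono_per a (b-1)) (hc a (b-1))
  have h12 : ∀ z : ℂ, z.re = r → ‖mono w (a+1) b z + mono w (a-1) b z‖ ≤ B₁ + B₂ :=
    fun z hz => norm_add_le_of_le (h1 z hz) (h2 z hz)
  have h123 : ∀ z : ℂ, z.re = r →
      ‖(mono w (a+1) b z + mono w (a-1) b z) + mono w a (b+1) z‖ ≤ (B₁ + B₂) + B₃ :=
    fun z hz => norm_add_le_of_le (h12 z hz) (h3 z hz)
  have c12 := fun z (hz : z.re = r) => (hc (a+1) b z hz).add (hc (a-1) b z hz)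
  rw [lineSum_congr φ hk, lineSum_const_mul,
    lineSum_add hφ h123 h4 (fun z hz => (c12 z hz).add (hc a (b+1) z hz)) (hc a (b-1)),
    lineSum_add hφ h12 h3 c12 (hc a (b+1)), lineSum_add hφ h1 h2 (hc _ _) (hc _ _)]

theorem lineSum_inner_even (h : KernelParam ε t w J) (a b : ℤ) :
    lineSum (innerWeight ε) (mono w a (-b)) ε = lineSum (innerWeight ε) (mono w a b) ε := by
  have hε := h.pos
  apply lineSum_even (innerWeight_neg ε)
  intro n
  have h1 := vcoef_reflect (h.mono_per a b) (2*ε) ε n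
  have h2 : (2 * ε - ε : ℝ) = ε := by ring
  rw [h2] at h1
  rw [← h1]
  apply vcoef_congr
  intro z hz
  simp only [mono]
  push_cast
  have h3 : -(2*ε - z) = z - 2*ε := by ring
  rw [h.refl, h3, ← h.neg_inv (by linarith) (by linarith), inv_zpow']

theorem lineSum_inner_zero : lineSum (innerWeight ε) (mono w 0 0) ε = 1 := by
  have : mono w 0 0 = fun _ => 1 := by ext; simp [mono]
  rw [lineSum, this, tsum_eq_single 0]
  · simp [vcoef_one, innerWeight]
  · intro n hn
    simp [vcoef_one, hn]

theorem lineSum_outer_zero : lineSum (outerWeight ε) (mono w 0 0) (-ε) = 0 := by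
  have : mono w 0 0 = fun _ => 1 := by ext; simp [mono]
  rw [lineSum, this, tsum_eq_single 0]
  · simp [outerWeight]
  · intro n hn
    simp [vcoef_one, hn]

theorem lineSum_glue (h : KernelParam ε t w J) (a b : ℤ) (ha : 0 ≤ a) (hb : 0 ≤ b)
    (hab : 0 < a + b) :
    lineSum (innerWeight ε) (mono w a b) ε = lineSum (outerWeight ε) (mono w a b) (-ε) := by
  have hε := h.pos
  have hd : ∀ z : ℂ, -2*ε < z.re → z.re < 2*ε → DifferentiableAt ℂ (mono w a b) z := by
    intro z h1 h2
    exact ((h.diff z h1 (by linarith)).zpow (Or.inr ha)).mul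
      ((h.diff_comp_neg z (by linarith) h2).zpow (Or.inr hb))
  have h0 : mono w a b 0 = 0 := by
    simp only [mono, neg_zero, h.zero]
    rcases ha.eq_or_lt with rfl | ha
    · rw [zero_zpow b (by omega), mul_zero]
    · rw [zero_zpow a (by omega), zero_mul]
  have hs := hasSum_vcoef (h.mono_per a b) (r := 0) (δ := ε) hε
    (fun z h1 h2 => hd z (by linarith) (by linarith))
  rw [Complex.ofReal_zero, h0] at hs
  have h1 := fun n => vcoef_shift (h.mono_per a b) hε.le
    (fun z h1 h2 => hd z (by linarith) (by linarith)) n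
  have h2 := fun n => vcoef_shift (h.mono_per a b) (r₁ := -ε) (r₂ := 0) (by linarith)
    (fun z h1 h2 => hd z (by linarith) (by linarith)) n
  obtain ⟨B₁, hB₁⟩ := bounded_on_line (h.mono_per a b)
    (fun z (hz : z.re = ε) => h.mono_cont a b hz)
  obtain ⟨B₂, hB₂⟩ := bounded_on_line (h.mono_per a b)
    (fun z (hz : z.re = -ε) => h.mono_cont_neg a b hz)
  have s1 := summable_lineSum (summable_innerWeight hε) hB₁
  have s2 := summable_lineSum (summable_outerWeight hε) hB₂
  rw [← sub_eq_zero, lineSum, lineSum, ← Complex.sub_re, ← s1.tsum_sub s2]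
  have key : ∀ n : ℤ, (innerWeight ε n : ℂ) * vcoef (mono w a b) ε n -
      (outerWeight ε n : ℂ) * vcoef (mono w a b) (-ε) n = vcoef (mono w a b) 0 n := by
    intro n
    rw [h1 n, h2 n]
    generalize vcoef (mono w a b) (-ε) n = A
    have hc := (Real.cosh_pos (3 * (n * ε))).ne'
    have e1 : Complex.exp (n * ((ε:ℂ) - (0:ℝ))) = (Real.exp (n * ε) : ℝ) := by push_cast; simp
    have e2 : Complex.exp (n * ((0:ℝ) - ((-ε:ℝ):ℂ))) = (Real.exp (n * ε) : ℝ) := by push_cast; simp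
    rw [e1, e2]
    have e3 : innerWeight ε n * (Real.exp (n*ε) * Real.exp (n*ε)) - outerWeight ε n =
        Real.exp (n*ε) := by
      have hx := Real.exp_pos (n * ε)
      rw [innerWeight, outerWeight]
      rw [Real.cosh_eq, Real.cosh_eq, Real.sinh_eq]
      have e2 : Real.exp (2 * (n*ε)) = Real.exp (n*ε) ^ 2 := by rw [← Real.exp_nat_mul]; simp
      have e3 : Real.exp (3 * (n*ε)) = Real.exp (n*ε) ^ 3 := by rw [← Real.exp_nat_mul]; simp
      simp only [Real.exp_neg, e2, e3]
      field_simp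
      ring
    have e4 : (innerWeight ε n : ℂ) * ((Real.exp (n*ε) : ℝ) * (Real.exp (n*ε) : ℝ)) -
      outerWeight ε n = (Real.exp (n*ε) : ℝ) := by exact_mod_cast e3
    linear_combination A * e4
  simp_rw [key]
  rw [hs.tsum_eq, Complex.zero_re]

theorem lineSum_bdry (h : KernelParam ε t w J) (b : ℤ) (hb : 1 ≤ b) :
    lineSum (outerWeight ε) (mono w (-b) b) (-ε) = 0 := by
  have hε := h.pos
  let V : ℂ → ℂ := fun z => (w (-z) * w (z + 4*ε)) ^ b
  have hV : ∀ z : ℂ, z.re = -ε → mono w (-b) b z = V z := by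
    intro z hz
    have := h.quasi z (by linarith) (by linarith)
    simp only [mono, V, mul_zpow]
    rw [← inv_eq_of_mul_eq_one_right this, inv_zpow', mul_comm]
  have hVp : ∀ z, V (z + 2 * Real.pi * Complex.I) = V z := by
    intro z
    simp only [V, neg_add', h.per_neg]
    rw [add_right_comm z, h.per]
  have hVr : ∀ z, V (((-4*ε : ℝ) : ℂ) - z) = V z := by
    intro z
    simp only [V]
    push_cast
    rw [mul_comm]
    congr 3 <;> ring
  have hVd : ∀ z : ℂ, -4*ε < z.re → z.re < 0 → DifferentiableAt ℂ V z := by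
    intro z h1 h2
    apply DifferentiableAt.zpow _ (Or.inr (by omega))
    apply (h.diff_comp_neg z h1 (by linarith)).mul
    exact DifferentiableAt.comp (f := fun z : ℂ => z + 4*ε) z
      (h.diff (z + 4*ε) (by simp; linarith) (by simp; linarith)) (by fun_prop)
  have hsym : ∀ n, vcoef V (-2*ε) (-n) = vcoef V (-2*ε) n := by
    intro n
    have h1 := vcoef_reflect hVp (-4*ε) (-2*ε) n
    have e : -4*ε - -2*ε = -2*ε := by ring
    rw [e] at h1
    rw [← h1]
    exact vcoef_congr (fun z _ => hVr z) n
  have hsh := fun n => vcoef_shift hVp (r₁ := -2*ε) (r₂ := -ε) (by linarith)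
    (fun z h1 h2 => hVd z (by linarith) (by linarith)) n
  have hodd : ∀ n : ℤ, (outerWeight ε (-n) : ℂ) * vcoef V (-ε) (-n) =
      -((outerWeight ε n : ℂ) * vcoef V (-ε) n) := by
    intro n
    rw [hsh, hsh, hsym]
    have e1 : ∀ n : ℤ, (outerWeight ε n : ℂ) * Complex.exp (n * (((-ε:ℝ):ℂ) - ((-2*ε:ℝ):ℂ))) =
        ((Real.sinh (n * ε) / Real.cosh (3 * (n * ε)) : ℝ) : ℂ) := by
      intro n
      have : (n * (((-ε:ℝ):ℂ) - ((-2*ε:ℝ):ℂ)) : ℂ) = ((n * ε : ℝ) : ℂ) := by push_cast; ring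
      rw [this, ← Complex.ofReal_exp, ← Complex.ofReal_mul, outerWeight]
      congr 1
      have := Real.exp_pos (n * ε)
      rw [Real.exp_neg]
      field_simp
    rw [← mul_assoc, ← mul_assoc, e1, e1]
    have e2 : Real.sinh ((-n : ℤ) * ε) / Real.cosh (3 * ((-n : ℤ) * ε)) =
        -(Real.sinh (n * ε) / Real.cosh (3 * (n * ε))) := by
      push_cast
      simp [neg_mul, mul_neg, Real.cosh_neg, Real.sinh_neg, neg_div]
    rw [e2]
    push_cast; ring
  rw [lineSum_congr _ hV, lineSum]
  have h1 := (Equiv.neg ℤ).tsum_eq (fun n => (outerWeight ε n : ℂ) * vcoef V (-ε) n)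
  simp only [Equiv.neg_apply, hodd, tsum_neg] at h1
  have h2 : ∑' n, (outerWeight ε n : ℂ) * vcoef V (-ε) n = 0 := by
    linear_combination (-1/2 : ℂ) * h1
  rw [h2, Complex.zero_re]

theorem hasSum_lineSum (h : KernelParam ε t w J) :
    HasSum (fun n => t^(n+1) * coneWalks n 1 0) (lineSum (innerWeight ε) w ε) := by
  have hε := h.pos
  have e : w = mono w 1 0 := by ext; simp [mono]
  have hin : ∀ z : ℂ, z.re = -ε → ‖w z‖ = 1 := by
    intro z hz
    have := h.norm_neg (z := -z) (by simp [hz])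
    rwa [neg_neg] at this
  have key := hasSum_coneWalks (I := fun a b => lineSum (innerWeight ε) (mono w a b) ε)
    (J := fun a b => lineSum (outerWeight ε) (mono w a b) (-ε))
    (B := max (∑' n, |innerWeight ε n|) (∑' n, |outerWeight ε n|)) h.t_pos h.t_lt
    (h.lineSum_mono_harmonic (summable_innerWeight hε) (Or.inl rfl))
    (h.lineSum_mono_harmonic (summable_outerWeight hε) (Or.inr rfl))
    h.lineSum_inner_even lineSum_inner_zero lineSum_outer_zero h.lineSum_glue h.lineSum_bdry
    (by
      intro a b ha
      refine le_trans ?_ (le_max_left _ _)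
      rw [← mul_one (∑' n, |innerWeight ε n|)]
      apply abs_lineSum_le (summable_innerWeight hε)
      intro z hz
      rw [mono, norm_mul, norm_zpow, norm_zpow, h.norm_neg hz, one_zpow, mul_one]
      lift a to ℕ using ha
      rw [zpow_natCast]
      exact pow_le_one₀ (norm_nonneg _) (h.norm_line hz))
    (by
      intro a b hb
      refine le_trans ?_ (le_max_right _ _)
      rw [← mul_one (∑' n, |outerWeight ε n|)]
      apply abs_lineSum_le (summable_outerWeight hε)
      intro z hz
      rw [mono, norm_mul, norm_zpow, norm_zpow, hin z hz, one_zpow, one_mul]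
      lift b to ℕ using hb
      rw [zpow_natCast]
      exact pow_le_one₀ (norm_nonneg _) (h.norm_line (by simp [hz])))
  simp only [← e] at key
  exact key

end KernelParam

theorem summable_inv_cosh {c : ℝ} (hc : 0 < c) : Summable fun n : ℤ => (Real.cosh (n * c))⁻¹ := by
  apply Summable.of_norm_bounded ((summable_exp_neg_abs hc).mul_left 2)
  intro n
  rw [norm_inv, Real.norm_eq_abs, abs_of_pos (Real.cosh_pos _)]
  rw [inv_le_iff_one_le_mul₀ (Real.cosh_pos _)]
  have h := Real.exp_abs_le_two_mul_cosh (n * c)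
  rw [abs_mul, abs_of_pos hc, mul_comm] at h
  rw [Real.exp_neg]
  have := Real.exp_pos (c * |(n:ℝ)|)
  rw [mul_assoc, inv_mul_eq_div, mul_div_assoc', le_div_iff₀ this, one_mul]
  exact h

theorem summable_inv_cosh_mul {c d : ℝ} (hc : 0 < c) :
    Summable fun n : ℤ => (Real.cosh (n * c))⁻¹ * (Real.cosh (n * d))⁻¹ := by
  apply Summable.of_norm_bounded (summable_inv_cosh hc)
  intro n
  rw [norm_mul, norm_inv, norm_inv, Real.norm_eq_abs, Real.norm_eq_abs,
    abs_of_pos (Real.cosh_pos _), abs_of_pos (Real.cosh_pos _)]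
  exact mul_le_of_le_one_right (inv_nonneg.2 (Real.cosh_pos _).le)
    (inv_le_one_of_one_le₀ (Real.one_le_cosh _))

namespace KernelParam

variable {ε t : ℝ} {w J : ℂ → ℂ}

theorem vcoef_eq (h : KernelParam ε t w J) {r : ℝ} (h1 : -2*ε < r) (h2 : r < 4*ε) (n : ℤ) :
    vcoef w r n = Complex.exp (n * (r - ε)) * vcoef w ε n := by
  have hε := h.pos
  rcases le_total r ε with hr | hr
  · have := vcoef_shift h.per hr (fun z h3 h4 => h.diff z (by linarith) (by linarith)) n
    rw [this, ← mul_assoc, ← Complex.exp_add]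
    ring_nf
    simp
  · exact vcoef_shift h.per hr (fun z h3 h4 => h.diff z (by linarith) (by linarith)) n

theorem vcoef_even (h : KernelParam ε t w J) (n : ℤ) : vcoef w ε (-n) = vcoef w ε n := by
  have h1 := vcoef_reflect h.per (2*ε) ε n
  have h2 : (2 * ε - ε : ℝ) = ε := by ring
  rw [h2] at h1
  rw [← h1]
  apply vcoef_congr
  intro z hz
  push_cast
  exact h.refl z

theorem vcoef_neg (h : KernelParam ε t w J) (n : ℤ) :
    vcoef (fun z => w (-z)) ε n = Complex.exp (2 * (n * ε)) * vcoef w ε n := by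
  have hε := h.pos
  have h1 := vcoef_reflect h.per 0 ε n
  simp only [Complex.ofReal_zero, zero_sub] at h1
  rw [h1, h.vcoef_eq (by linarith) (by linarith), h.vcoef_even]
  congr 2
  push_cast; ring

theorem vcoef_inv (h : KernelParam ε t w J) (n : ℤ) (hn : n ≠ 0) :
    vcoef (fun z => (w z)⁻¹) ε n = -((1 + Complex.exp (2 * (n * ε)) + Complex.exp (-(2 * (n * ε)))) *
      vcoef w ε n) := by
  have hε := h.pos
  have ht : (t:ℂ) ≠ 0 := by exact_mod_cast h.t_pos.ne'
  have c0 : ∀ z : ℂ, z.re = ε → ContinuousAt w z := fun z hz =>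
    (h.diff z (by linarith) (by linarith)).continuousAt
  have c1 : ∀ z : ℂ, z.re = ε → ContinuousAt (fun z => (w z)⁻¹) z := fun z hz =>
    (c0 z hz).inv₀ (h.ne_zero z (by linarith) (by linarith))
  have c2 : ∀ z : ℂ, z.re = ε → ContinuousAt (fun z => w (-z)) z := fun z hz =>
    (h.diff_comp_neg z (by linarith) (by linarith)).continuousAt
  have c3 : ∀ z : ℂ, z.re = ε → ContinuousAt (fun z => (w (-z))⁻¹) z := fun z hz =>
    (c2 z hz).inv₀ (h.neg_ne_zero (by linarith) (by linarith))
  have e1 : vcoef (fun z => (w (-z))⁻¹) ε n = Complex.exp (-(2 * (n * ε))) * vcoef w ε n := by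
    have e2 : vcoef (fun z => (w (-z))⁻¹) ε n = vcoef (fun z => w (z + ((-2*ε : ℝ) : ℂ))) ε n := by
      apply vcoef_congr
      intro z hz
      rw [h.neg_inv (by linarith) (by linarith)]
      congr 1; push_cast; ring
    rw [e2, vcoef_translate, h.vcoef_eq (by linarith) (by linarith)]
    congr 2
    push_cast; ring
  have e3 : vcoef (fun z => t * (((w z + (w z)⁻¹) + w (-z)) + (w (-z))⁻¹)) ε n = 0 := by
    have : vcoef (fun z => t * (((w z + (w z)⁻¹) + w (-z)) + (w (-z))⁻¹)) ε n =
        vcoef (fun _ => 1) ε n :=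
      vcoef_congr (fun z hz => h.kernel z (by linarith) (by linarith)) n
    rw [this, vcoef_one, if_neg hn]
  have e4 := vcoef_add (F := fun z => w z + (w z)⁻¹ + w (-z))
    (fun z hz => ((c0 z hz).add (c1 z hz)).add (c2 z hz)) c3 n
  have e5 := vcoef_add (F := fun z => w z + (w z)⁻¹) (fun z hz => (c0 z hz).add (c1 z hz)) c2 n
  have e6 := vcoef_add c0 c1 n
  rw [vcoef_const_mul, e4, e5, e6, mul_eq_zero, or_iff_right ht, h.vcoef_neg, e1] at e3
  linear_combination e3

theorem vcoef_inv_neg (h : KernelParam ε t w J) (n : ℤ) :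
    vcoef (fun z => (w z)⁻¹) (-ε) n = Complex.exp (2 * (n * ε)) * vcoef w ε n := by
  have hε := h.pos
  have : vcoef (fun z => (w z)⁻¹) (-ε) n = vcoef (fun z => w (z + ((4*ε : ℝ) : ℂ))) (-ε) n := by
    apply vcoef_congr
    intro z hz
    have := h.quasi z (by linarith) (by linarith)
    rw [inv_eq_of_mul_eq_one_right this]
    push_cast; rfl
  rw [this, vcoef_translate, h.vcoef_eq (by linarith) (by linarith)]
  congr 2
  push_cast; ring

theorem vcoef_J {r : ℝ} {w J : ℂ → ℂ}
    (hJ : ∀ z : ℂ, z.re = r → J z * w z = 1 - Complex.exp z)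
    (hw : ∀ z : ℂ, z.re = r → w z ≠ 0)
    (hc : ∀ z : ℂ, z.re = r → ContinuousAt w z) (n : ℤ) :
    vcoef J r n = vcoef (fun z => (w z)⁻¹) r n -
      Complex.exp r * vcoef (fun z => (w z)⁻¹) r (n-1) := by
  have h1 : vcoef J r n = vcoef (fun z => (w z)⁻¹ + (-1) * (Complex.exp z * (w z)⁻¹)) r n := by
    apply vcoef_congr
    intro z hz
    have := hJ z hz
    have := hw z hz
    field_simp
    linear_combination hJ z hz
  have c1 : ∀ z : ℂ, z.re = r → ContinuousAt (fun z => (w z)⁻¹) z := fun z hz =>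
    (hc z hz).inv₀ (hw z hz)
  rw [h1, vcoef_add (G := fun z => -1 * (Complex.exp z * (w z)⁻¹)) c1 (fun z hz => continuousAt_const.mul
    (Complex.continuous_exp.continuousAt.mul (c1 z hz))), vcoef_const_mul, vcoef_exp_mul]
  ring

theorem exists_vcoef_eq (h : KernelParam ε t w J) : ∃ d : ℂ, ∀ n : ℤ, n ≠ 0 →
    vcoef w ε n = d * (((Real.cosh (n * ε))⁻¹ * (Real.cosh (n * (2*ε)))⁻¹ : ℝ) : ℂ) := by
  have hε := h.pos
  have ha := vcoef_J (r := ε) (fun z hz => h.mulJ z (by linarith) (by linarith))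
    (fun z hz => h.ne_zero z (by linarith) (by linarith))
    (fun z hz => (h.diff z (by linarith) (by linarith)).continuousAt)
  have hb := vcoef_J (r := -ε) (fun z hz => h.mulJ z (by linarith) (by linarith))
    (fun z hz => by
      have := h.neg_ne_zero (z := -z) (by simp [hz, hε]) (by simp [hz]; linarith)
      rwa [neg_neg] at this)
    (fun z hz => (h.diff z (by linarith) (by linarith)).continuousAt)
  have hsh := fun n => vcoef_shift h.perJ (r₁ := -ε) (r₂ := ε) (by linarith)
    (fun z h1 h2 => h.diffJ z (by linarith) (by linarith)) n
  let D : ℤ → ℂ := fun n => Complex.exp (-(n * ε)) * vcoef (fun z => (w z)⁻¹) ε n -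
    Complex.exp (n * ε) * vcoef (fun z => (w z)⁻¹) (-ε) n
  have hD : ∀ n, D n = D (n-1) := by
    intro n
    have h1 := hsh n
    rw [ha, hb] at h1
    simp only [D]
    have e1 : Complex.exp (-((n-1 : ℤ) * ε)) = Complex.exp (-(n * ε)) * Complex.exp ε := by
      rw [← Complex.exp_add]; congr 1; push_cast; ring
    have e2 : Complex.exp ((n-1 : ℤ) * ε) = Complex.exp (n * ε) * Complex.exp ((-ε : ℝ):ℂ) := by
      rw [← Complex.exp_add]; congr 1; push_cast; ring
    have e3 : Complex.exp (n * (ε - ((-ε:ℝ):ℂ))) = Complex.exp (n*ε) * Complex.exp (n*ε) := by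
      rw [← Complex.exp_add]; congr 1; push_cast; ring
    have e4 : Complex.exp (-(n*ε)) * Complex.exp (n*ε) = 1 := by
      rw [← Complex.exp_add]; simp
    rw [e3] at h1
    rw [e1, e2]
    linear_combination Complex.exp (-(n * ε)) * h1 + Complex.exp (n*ε) *
      (vcoef (fun z => (w z)⁻¹) (-ε) n - Complex.exp ((-ε:ℝ):ℂ) *
        vcoef (fun z => (w z)⁻¹) (-ε) (n-1)) * e4
  have hD0 : ∀ n, D n = D 0 := by
    intro n
    induction n using Int.induction_on with
    | zero => rfl
    | succ n ih => rw [hD]; simpa using ih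
    | pred n ih => rw [← hD]; exact ih
  refine ⟨-D 0 / 4, fun n hn => ?_⟩
  rw [← hD0 n]
  simp only [D]
  rw [h.vcoef_inv n hn, h.vcoef_inv_neg]
  have hc1 := Real.cosh_pos (n * ε)
  have hc2 := Real.cosh_pos (n * (2 * ε))
  generalize vcoef w ε n = A
  have e1 : Complex.exp (-(n * ε)) * (1 + Complex.exp (2 * (n * ε)) + Complex.exp (-(2 * (n * ε)))) +
      Complex.exp (n * ε) * Complex.exp (2 * (n * ε)) =
      ((4 * (Real.cosh (n*ε) * Real.cosh (n*(2*ε))) : ℝ) : ℂ) := by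
    have e2 : Real.exp (-(n * ε)) * (1 + Real.exp (2 * (n * ε)) + Real.exp (-(2 * (n * ε)))) +
      Real.exp (n * ε) * Real.exp (2 * (n * ε)) = 4 * (Real.cosh (n*ε) * Real.cosh (n*(2*ε))) := by
      have hx := Real.exp_pos (n * ε)
      have e3 : n * (2 * ε) = 2 * (n * ε) := by ring
      rw [Real.cosh_eq, Real.cosh_eq, e3]
      have e2 : Real.exp (2 * (n*ε)) = Real.exp (n*ε) ^ 2 := by rw [← Real.exp_nat_mul]; simp
      simp only [Real.exp_neg, e2]
      field_simp
      ring
    rw [← e2]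
    push_cast
    rfl
  have e5 : ((4 * (Real.cosh (n*ε) * Real.cosh (n*(2*ε))) : ℝ) : ℂ) *
      (((Real.cosh (n * ε))⁻¹ * (Real.cosh (n * (2*ε)))⁻¹ : ℝ) : ℂ) = 4 := by
    rw [← Complex.ofReal_mul]
    field_simp
    simp
  linear_combination (-A/4) * e5 + (((Real.cosh (n * ε))⁻¹ * (Real.cosh (n * (2*ε)))⁻¹ : ℝ) : ℂ) *
    (-A/4) * e1

theorem lineSum_mul_eq (h : KernelParam ε t w J) :
    lineSum (innerWeight ε) w ε *
      (∑' n : ℤ, (Real.cosh (n * (2*ε)))⁻¹ -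
        ∑' n : ℤ, (Real.cosh (n * ε))⁻¹ * (Real.cosh (n * (2*ε)))⁻¹) =
    (w ε).re * (∑' n : ℤ, (Real.cosh (n * (2*ε)))⁻¹ -
        ∑' n : ℤ, (Real.cosh (n * ε))⁻¹ * (Real.cosh (n * (3*ε)))⁻¹) := by
  have hε := h.pos
  obtain ⟨d, hd⟩ := h.exists_vcoef_eq
  set y := vcoef w ε 0 - d with hy
  have hd' : ∀ n : ℤ, vcoef w ε n =
      d * (((Real.cosh (n * ε))⁻¹ * (Real.cosh (n * (2*ε)))⁻¹ : ℝ) : ℂ) + if n = 0 then y else 0 := by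
    intro n
    by_cases hn : n = 0
    · simp [hn, hy]
    · simp [hn, hd n hn]
  have s2 := Complex.hasSum_ofReal.2 (summable_inv_cosh (c := 2*ε) (by linarith)).hasSum
  have s12 := Complex.hasSum_ofReal.2 (summable_inv_cosh_mul (d := 2*ε) hε).hasSum
  have s13 := Complex.hasSum_ofReal.2 (summable_inv_cosh_mul (d := 3*ε) hε).hasSum
  set S2 := ∑' n : ℤ, (Real.cosh (n * (2*ε)))⁻¹
  set S12 := ∑' n : ℤ, (Real.cosh (n * ε))⁻¹ * (Real.cosh (n * (2*ε)))⁻¹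
  set S13 := ∑' n : ℤ, (Real.cosh (n * ε))⁻¹ * (Real.cosh (n * (3*ε)))⁻¹
  have hy0 := hasSum_ite_eq (0:ℤ) y
  have t1 : w ε = d * S12 + y := by
    have h1 := hasSum_vcoef h.per (r := ε) (δ := ε) hε
      (fun z h1 h2 => h.diff z (by linarith) (by linarith))
    simp_rw [hd'] at h1
    exact h1.unique ((s12.mul_left d).add hy0)
  have t2 : (0:ℂ) = d * S2 + y := by
    have h1 := hasSum_vcoef h.per (r := 0) (δ := ε) hε
      (fun z h1 h2 => h.diff z (by linarith) (by linarith))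
    rw [Complex.ofReal_zero, h.zero] at h1
    have h2 := (Equiv.neg ℤ).hasSum_iff.2 h1
    have h3 := (h1.add h2).mul_left (1/2)
    rw [add_zero, mul_zero] at h3
    refine h3.unique (((s2.mul_left d).add hy0).congr_fun ?_)
    intro n
    simp only [Function.comp, Equiv.neg_apply]
    rw [h.vcoef_eq (by linarith) (by linarith), h.vcoef_eq (by linarith) (by linarith) (-n),
      h.vcoef_even]
    by_cases hn : n = 0
    · subst hn
      rw [hd']
      simp
      ring
    · have e : Complex.exp (n * ((0:ℝ) - ε)) + Complex.exp ((-n : ℤ) * ((0:ℝ) - ε)) =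
        ((2 * Real.cosh (n * ε) : ℝ) : ℂ) := by
        push_cast
        rw [Complex.cosh]
        ring_nf
      rw [← add_mul, e, hd n hn, if_neg hn, add_zero]
      have := Real.cosh_pos (n * ε)
      have e6 : ((2 * Real.cosh (n * ε) : ℝ) : ℂ) *
        (((Real.cosh (n * ε))⁻¹ * (Real.cosh (n * (2*ε)))⁻¹ : ℝ) : ℂ) =
        2 * (((Real.cosh (n * (2*ε)))⁻¹ : ℝ) : ℂ) := by
        have : (2 * Real.cosh (n * ε)) * ((Real.cosh (n * ε))⁻¹ * (Real.cosh (n * (2*ε)))⁻¹) =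
          2 * (Real.cosh (n * (2*ε)))⁻¹ := by field_simp
        exact_mod_cast this
      linear_combination (d/2) * e6
  have t3 : ∑' n, (innerWeight ε n : ℂ) * vcoef w ε n = d * S13 + y := by
    refine HasSum.tsum_eq (((s13.mul_left d).add hy0).congr_fun ?_)
    intro n
    by_cases hn : n = 0
    · subst hn
      rw [hd']
      simp [innerWeight]
    · rw [if_neg hn, hd n hn, add_zero, mul_left_comm]
      congr 1
      rw [← Complex.ofReal_mul]
      congr 1
      have h1 := Real.cosh_pos (n * ε)
      have h2 := Real.cosh_pos (n * (2*ε))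
      have h3 := Real.cosh_pos (n * (3*ε))
      rw [innerWeight]
      have e2 : 2 * (n * ε) = n * (2*ε) := by ring
      have e3 : 3 * (n * ε) = n * (3*ε) := by ring
      rw [e2, e3]
      field_simp
  rw [lineSum, t3]
  have key : (d * S13 + y) * ((S2 - S12 : ℝ) : ℂ) = w ε * ((S2 - S13 : ℝ) : ℂ) := by
    rw [t1]
    push_cast
    linear_combination ((S12 : ℂ) - S13) * t2
  have := congrArg Complex.re key
  rwa [Complex.re_mul_ofReal, Complex.re_mul_ofReal] at this

end KernelParam

/-- The theta function `∑ exp (n v - c n²)`. -/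
noncomputable def thetaFun (c : ℝ) (v : ℂ) : ℂ := ∑' n : ℤ, Complex.exp (n * v - c * n^2)

theorem thetaFun_term (c : ℝ) (v : ℂ) (n : ℤ) : Complex.exp (n * v - c * n^2) =
    jacobiTheta₂_term n (v / (2 * Real.pi * Complex.I)) (Complex.I * (c / Real.pi : ℝ)) := by
  have hpi : (Real.pi : ℂ) ≠ 0 := by exact_mod_cast Real.pi_ne_zero
  rw [jacobiTheta₂_term]
  congr 1
  push_cast
  field_simp
  linear_combination (-(n:ℂ)^2 * c : ℂ) * Complex.I_sq

theorem thetaFun_tau_pos {c : ℝ} (hc : 0 < c) : 0 < (Complex.I * (c / Real.pi : ℝ) : ℂ).im := by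
  simp only [Complex.I_mul_im, Complex.ofReal_re]
  exact div_pos hc Real.pi_pos

theorem summable_thetaFun {c : ℝ} (hc : 0 < c) (v : ℂ) :
    Summable fun n : ℤ => Complex.exp (n * v - c * n^2) := by
  simp_rw [thetaFun_term]
  exact (summable_jacobiTheta₂_term_iff _ _).2 (thetaFun_tau_pos hc)

theorem differentiable_thetaFun {c : ℝ} (hc : 0 < c) : Differentiable ℂ (thetaFun c) := by
  have h : thetaFun c = fun v => jacobiTheta₂ (v / (2 * Real.pi * Complex.I))
      (Complex.I * (c / Real.pi : ℝ)) := by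
    ext v
    simp_rw [thetaFun, thetaFun_term]
    rfl
  rw [h]
  intro v
  exact DifferentiableAt.comp (f := fun v : ℂ => v / (2 * Real.pi * Complex.I)) v
    (differentiableAt_jacobiTheta₂_fst _ (thetaFun_tau_pos hc)) (by fun_prop)

theorem thetaFun_neg (c : ℝ) (v : ℂ) : thetaFun c (-v) = thetaFun c v := by
  rw [thetaFun, thetaFun, ← (Equiv.neg ℤ).tsum_eq]
  simp

theorem thetaFun_add_two_pi (c : ℝ) (v : ℂ) :
    thetaFun c (v + 2 * Real.pi * Complex.I) = thetaFun c v := by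
  rw [thetaFun, thetaFun]
  congr 1
  ext n
  have : (n * (v + 2 * Real.pi * Complex.I) - c * n^2 : ℂ) =
    (n * v - c * n^2) + n * (2 * Real.pi * Complex.I) := by ring
  rw [this, Complex.exp_add, Complex.exp_int_mul_two_pi_mul_I, mul_one]

theorem thetaFun_add (c : ℝ) (v : ℂ) :
    thetaFun c (v + 2 * c) = Complex.exp (v + c) * thetaFun c v := by
  rw [thetaFun, thetaFun, ← tsum_mul_left, ← (Equiv.addRight (1:ℤ)).tsum_eq
    (fun n : ℤ => Complex.exp (v + c) * Complex.exp (n * v - c * n^2) : ℤ → ℂ),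
    ← (Equiv.addRight (1:ℤ)).tsum_eq]
  rw [← (Equiv.addRight (1:ℤ)).tsum_eq]
  congr 1
  ext n
  rw [← Complex.exp_add]
  congr 1
  simp
  ring

theorem thetaFun_conj (c : ℝ) (v : ℂ) :
    thetaFun c (starRingEnd ℂ v) = starRingEnd ℂ (thetaFun c v) := by
  rw [thetaFun, thetaFun, Complex.conj_tsum]
  congr 1
  ext n
  rw [← Complex.exp_conj]
  congr 1
  simp

theorem thetaFun_ofReal (c x : ℝ) :
    thetaFun c x = ((∑' n : ℤ, Real.exp (n * x - c * n^2) : ℝ) : ℂ) := by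
  rw [thetaFun, Complex.ofReal_tsum]
  push_cast
  rfl

theorem summable_thetaFun_real {c : ℝ} (hc : 0 < c) (x : ℝ) :
    Summable fun n : ℤ => Real.exp (n * x - c * n^2) := by
  have := summable_thetaFun hc x
  rw [← Complex.summable_ofReal]
  push_cast
  exact this

theorem thetaFun_real_pos {c : ℝ} (hc : 0 < c) (x : ℝ) :
    0 < ∑' n : ℤ, Real.exp (n * x - c * n^2) :=
  (summable_thetaFun_real hc x).tsum_pos (fun _ => (Real.exp_pos _).le) 0 (Real.exp_pos _)

theorem thetaFun_ofReal_ne_zero {c : ℝ} (hc : 0 < c) (x : ℝ) : thetaFun c x ≠ 0 := by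
  rw [thetaFun_ofReal]
  exact_mod_cast ne_of_gt (thetaFun_real_pos hc x)

/-- Pairs of integers, split according to the parity of their sum. -/
def pairParityEquiv : (ℤ × ℤ) ⊕ (ℤ × ℤ) ≃ ℤ × ℤ where
  toFun := Sum.elim (fun p => (p.1 + p.2, p.1 - p.2)) (fun p => (p.1 + p.2 + 1, p.1 - p.2))
  invFun p := if (p.1 + p.2) % 2 = 0 then Sum.inl ((p.1 + p.2) / 2, (p.1 - p.2) / 2)
    else Sum.inr ((p.1 + p.2 - 1) / 2, (p.1 - p.2 - 1) / 2)
  left_inv p := by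
    rcases p with ⟨p, q⟩ | ⟨p, q⟩
    · dsimp only [Sum.elim_inl]
      split_ifs with h
      · congr 2 <;> omega
      · omega
    · dsimp only [Sum.elim_inr]
      split_ifs with h
      · omega
      · congr 2 <;> omega
  right_inv p := by
    obtain ⟨p, q⟩ := p
    simp only
    split_ifs with h <;> simp only [Sum.elim_inl, Sum.elim_inr] <;> ext <;> simp only <;> omega

theorem thetaFun_mul {c : ℝ} (hc : 0 < c) (a b : ℂ) :
    thetaFun c a * thetaFun c b = thetaFun (2*c) (a+b) * thetaFun (2*c) (a-b) +
      Complex.exp (a - c) * (thetaFun (2*c) (a+b-2*c) * thetaFun (2*c) (a-b-2*c)) := by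
  have s := fun v => (summable_thetaFun hc v).norm
  have s2 := fun v => (summable_thetaFun (c := 2*c) (by linarith) v).norm
  simp only [thetaFun]
  rw [tsum_mul_tsum_of_summable_norm (s _) (s _), tsum_mul_tsum_of_summable_norm (s2 _) (s2 _),
    tsum_mul_tsum_of_summable_norm (s2 _) (s2 _), ← pairParityEquiv.tsum_eq]
  have hs := summable_mul_of_summable_norm (s a) (s b)
  rw [← pairParityEquiv.summable_iff] at hs
  have hl := hs.comp_injective Sum.inl_injective
  have hr := hs.comp_injective Sum.inr_injective
  have := (HasSum.sum (f := fun x => Complex.exp ((pairParityEquiv x).1 * a - c * (pairParityEquiv x).1^2) * Complex.exp ((pairParityEquiv x).2 * b - c * (pairParityEquiv x).2^2)) hl.hasSum hr.hasSum).tsum_eq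
  rw [this, ← tsum_mul_left]
  congr 1
  all_goals
    congr 1
    ext p
    simp only [pairParityEquiv, Function.comp, Equiv.coe_fn_mk, Sum.elim_inl, Sum.elim_inr,
      ← Complex.exp_add]
    congr 1
    push_cast
    ring

/-- The theta function `∑ (-1)ⁿ exp (n z - c n²)`. -/
noncomputable def thetaAlt (c : ℝ) (z : ℂ) : ℂ := thetaFun c (z + Real.pi * Complex.I)

theorem differentiable_thetaAlt {c : ℝ} (hc : 0 < c) : Differentiable ℂ (thetaAlt c) :=
  (differentiable_thetaFun hc).comp (by fun_prop)

theorem thetaAlt_add_two_pi (c : ℝ) (v : ℂ) :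
    thetaAlt c (v + 2 * Real.pi * Complex.I) = thetaAlt c v := by
  rw [thetaAlt, thetaAlt, ← thetaFun_add_two_pi c (v + _)]
  ring_nf

theorem thetaAlt_neg (c : ℝ) (v : ℂ) : thetaAlt c (-v) = thetaAlt c v := by
  rw [thetaAlt, thetaAlt, ← thetaFun_neg, ← thetaFun_add_two_pi c]
  ring_nf

theorem exp_add_pi (z : ℂ) : Complex.exp (z + Real.pi * Complex.I) = -Complex.exp z := by
  rw [Complex.exp_add, Complex.exp_pi_mul_I]
  ring

theorem thetaAlt_add (c : ℝ) (v : ℂ) :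
    thetaAlt c (v + 2 * c) = -Complex.exp (v + c) * thetaAlt c v := by
  rw [thetaAlt, thetaAlt, ← exp_add_pi, show v + c + Real.pi * Complex.I =
    v + Real.pi * Complex.I + c by ring, ← thetaFun_add]
  ring_nf

theorem thetaAlt_conj (c : ℝ) (v : ℂ) :
    thetaAlt c (starRingEnd ℂ v) = starRingEnd ℂ (thetaAlt c v) := by
  rw [thetaAlt, thetaAlt, ← thetaFun_conj, ← thetaFun_add_two_pi c ((starRingEnd ℂ) (v + _))]
  simp
  ring_nf

theorem thetaAlt_ofReal (c x : ℝ) : thetaAlt c x = ((thetaAlt c x).re : ℂ) := by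
  have := thetaAlt_conj c x
  rw [Complex.conj_ofReal] at this
  exact (Complex.conj_eq_iff_re.1 this.symm).symm

theorem thetaAlt_eq_tsum (c : ℝ) (z : ℂ) :
    thetaAlt c z = ∑' n : ℤ, (-1)^n * Complex.exp (n * z - c * n^2) := by
  rw [thetaAlt, thetaFun]
  congr 1
  ext n
  rw [show n * (z + Real.pi * Complex.I) - c * n^2 = n * (Real.pi * Complex.I) +
    (n * z - c * n^2) by ring, Complex.exp_add, Complex.exp_int_mul, Complex.exp_pi_mul_I]

theorem summable_thetaAlt {c : ℝ} (hc : 0 < c) (z : ℂ) :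
    Summable fun n : ℤ => (-1)^n * Complex.exp (n * z - c * n^2) := by
  refine (summable_thetaFun hc (z + Real.pi * Complex.I)).congr fun n => ?_
  rw [show n * (z + Real.pi * Complex.I) - c * n^2 = n * (Real.pi * Complex.I) +
    (n * z - c * n^2) by ring, Complex.exp_add, Complex.exp_int_mul, Complex.exp_pi_mul_I]

theorem HasSum.even_add_odd_int {f : ℤ → ℂ} {a b : ℂ} (he : HasSum (fun k => f (2 * k)) a)
    (ho : HasSum (fun k => f (2 * k + 1)) b) : HasSum f (a + b) := by
  have := mul_right_injective₀ (two_ne_zero' ℤ)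
  replace ho := ((add_left_injective 1).comp this).hasSum_range_iff.2 ho
  refine (this.hasSum_range_iff.2 he).add_isCompl ?_ ho
  simpa [Function.comp_def] using Int.isCompl_even_odd

theorem thetaFun_split {c : ℝ} (hc : 0 < c) (z : ℂ) :
    thetaFun c z = thetaFun (4*c) (2*z) + Complex.exp (z - c) * thetaFun (4*c) (2*z-4*c) := by
  have hs := summable_thetaFun hc z
  have h0 : Function.Injective fun n : ℤ => 2 * n := fun a b h => by simpa using h
  have h1 : Function.Injective fun n : ℤ => 2 * n + 1 := fun a b h => by simpa using h
  have := (HasSum.even_add_odd_int (f := fun n : ℤ => Complex.exp (n * z - c * n^2))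
    (hs.comp_injective h0).hasSum (hs.comp_injective h1).hasSum).tsum_eq
  rw [thetaFun, this, thetaFun, thetaFun, ← tsum_mul_left]
  congr 1
  · congr 1
    ext n
    simp only [Function.comp]
    congr 1
    push_cast
    ring
  · congr 1
    ext n
    simp only [Function.comp]
    rw [← Complex.exp_add]
    congr 1
    push_cast
    ring

theorem thetaAlt_duplication {c : ℝ} (hc : 0 < c) (z : ℂ) :
    thetaAlt (2*c) (z + 2*c) * thetaAlt (2*c) z = thetaFun (4*c) (2*c) * thetaAlt c (z + c) := by
  have h := thetaFun_mul (c := 2*c) (by linarith) (z + 2*c + Real.pi * Complex.I)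
    (z + Real.pi * Complex.I)
  have e := thetaFun_split hc (z + c + Real.pi * Complex.I)
  rw [show 2 * (2*c) = 4*c by ring] at h
  push_cast at h
  rw [show z + 2*c + Real.pi * Complex.I - (z + Real.pi * Complex.I) - 2 * (2 * c) =
      -(2*c : ℂ) by ring, thetaFun_neg,
    show z + 2*c + Real.pi * Complex.I - (z + Real.pi * Complex.I) = (2*c : ℂ) by ring,
    show z + 2*c + Real.pi * Complex.I + (z + Real.pi * Complex.I) =
      2 * z + 2 * c + 2 * Real.pi * Complex.I by ring,
    show 2 * z + 2 * c + 2 * Real.pi * Complex.I - 2 * (2*c) =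
      2 * z - 2 * c + 2 * Real.pi * Complex.I by ring,
    thetaFun_add_two_pi, thetaFun_add_two_pi,
    show z + 2*c + Real.pi * Complex.I - 2 * c = z + Real.pi * Complex.I by ring,
    exp_add_pi] at h
  rw [show 2 * (z + c + Real.pi * Complex.I) - 4 * c =
      2 * z - 2 * c + 2 * Real.pi * Complex.I by ring,
    show 2 * (z + c + Real.pi * Complex.I) =
      2 * z + 2 * c + 2 * Real.pi * Complex.I by ring,
    thetaFun_add_two_pi, thetaFun_add_two_pi,
    show z + c + Real.pi * Complex.I - c = z + Real.pi * Complex.I by ring,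
    exp_add_pi] at e
  rw [thetaAlt, thetaAlt, thetaAlt, h, e]
  ring

/-- The ratio of theta constants in the quadratic theta relation. -/
theorem thetaAlt_sq {ε : ℝ} (hε : 0 < ε) (z : ℂ) :
    thetaFun (8*ε) (4*ε) *
      (thetaAlt (4*ε) z ^ 2 - Complex.exp (-2*ε - z) * thetaAlt (4*ε) (z + 4*ε) ^ 2) =
    thetaFun (2*ε) 0 * (thetaAlt (4*ε) (z + 2*ε) * thetaAlt (4*ε) (z - 2*ε)) := by
  have h1 := thetaFun_mul (c := 4*ε) (by linarith) (z + Real.pi * Complex.I)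
    (z + Real.pi * Complex.I)
  have h2 := thetaFun_mul (c := 4*ε) (by linarith) (z + 4*ε + Real.pi * Complex.I)
    (z + 4*ε + Real.pi * Complex.I)
  have h3 := thetaFun_mul (c := 4*ε) (by linarith) (z + 2*ε + Real.pi * Complex.I)
    (z - 2*ε + Real.pi * Complex.I)
  have h4 := thetaFun_split (c := 2*ε) (by linarith) 0
  have h5 := thetaFun_add (8*ε) (2*z-8*ε)
  push_cast at h1 h2 h3 h4 h5
  rw [show 2 * (4*ε) = 8*ε by ring] at h1 h2 h3
  rw [show 4 * (2*ε) = 8*ε by ring] at h4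
  rw [show (2 * 0 - 4 * (2 * ε) : ℂ) = -(8*ε) by ring, thetaFun_neg,
    show (2*0:ℂ) = 0 by ring] at h4
  rw [show (2 * z - 8*ε + 2 * (8 * ε) : ℂ) = 2*z+8*ε by ring,
    show (2 * z - 8*ε + 8 * ε : ℂ) = z+z by ring, Complex.exp_add] at h5
  rw [sub_self, show (0 - 2 * (4 * ε) : ℂ) = -(8*ε) by ring, thetaFun_neg,
    show z + Real.pi * Complex.I + (z + Real.pi * Complex.I) = 2*z + 2*Real.pi * Complex.I by ring,
    show 2*z + 2*Real.pi * Complex.I - 2*(4*ε) = 2*z - 8*ε + 2*Real.pi * Complex.I by ring,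
    show z + Real.pi * Complex.I - 4*ε = z - 4*ε + Real.pi * Complex.I by ring, exp_add_pi,
    thetaFun_add_two_pi, thetaFun_add_two_pi] at h1
  rw [sub_self, show (0 - 2 * (4 * ε) : ℂ) = -(8*ε) by ring, thetaFun_neg,
    show z + 4*ε + Real.pi * Complex.I + (z + 4*ε + Real.pi * Complex.I) =
      2*z + 8*ε + 2*Real.pi * Complex.I by ring,
    show 2*z + 8*ε + 2*Real.pi * Complex.I - 2*(4*ε) = 2*z + 2*Real.pi * Complex.I by ring,
    show z + 4*ε + Real.pi * Complex.I - 4*ε = z + Real.pi * Complex.I by ring, exp_add_pi,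
    thetaFun_add_two_pi, thetaFun_add_two_pi, h5] at h2
  rw [show z + 2*ε + Real.pi * Complex.I + (z - 2*ε + Real.pi * Complex.I) =
      2*z + 2*Real.pi * Complex.I by ring,
    show z + 2*ε + Real.pi * Complex.I - (z - 2*ε + Real.pi * Complex.I) = 4*ε by ring,
    show 2*z + 2*Real.pi * Complex.I - 2*(4*ε) = 2*z - 8*ε + 2*Real.pi * Complex.I by ring,
    show (4*ε - 2*(4*ε) : ℂ) = -(4*ε) by ring, thetaFun_neg,
    show z + 2*ε + Real.pi * Complex.I - 4*ε = z - 2*ε + Real.pi * Complex.I by ring, exp_add_pi,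
    thetaFun_add_two_pi, thetaFun_add_two_pi] at h3
  simp only [thetaAlt, sq, h1, h2, h3, h4]
  have e1 : Complex.exp (-2*ε - z) * Complex.exp z = Complex.exp (0 - 2*ε) := by
    rw [← Complex.exp_add]; ring_nf
  have e2 : Complex.exp (z - 4*ε) = Complex.exp z * (Complex.exp (0-2*ε) * Complex.exp (0-2*ε)) := by
    rw [← Complex.exp_add, ← Complex.exp_add]; ring_nf
  have e3 : Complex.exp (z - 2*ε) = Complex.exp z * Complex.exp (0-2*ε) := by
    rw [← Complex.exp_add]; ring_nf
  rw [e2, e3]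
  linear_combination (-thetaFun (8*ε) (4*ε) * (Complex.exp z * thetaFun (8*ε) (2*z-8*ε) *
    thetaFun (8*ε) 0 - thetaFun (8*ε) (2*z) * thetaFun (8*ε) (8*ε))) * e1

open Filter Topology

/-- The general term of `thetaRho`. -/
noncomputable def thetaRhoTerm (c : ℝ) (m : ℕ) (z : ℂ) : ℂ :=
  (-1)^m * Complex.exp (-c * (m * (m+1))) *
    (Complex.exp (-m * z) * ∑ j ∈ Finset.range (2*m+1), Complex.exp z ^ j)

/-- The quotient of `thetaAlt c (z + c)` by `1 - exp z`. -/
noncomputable def thetaRho (c : ℝ) (z : ℂ) : ℂ := ∑' m : ℕ, thetaRhoTerm c m z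

theorem norm_thetaRhoTerm_le (c : ℝ) {K : ℝ} (m : ℕ) {z : ℂ} (hz : |z.re| ≤ K) :
    ‖thetaRhoTerm c m z‖ ≤ Real.exp (m * (K + 2) - c * (m * (m + 1))) := by
  have hm : (0:ℝ) ≤ m := m.cast_nonneg
  have h1 : ‖Complex.exp (-m * z) * ∑ j ∈ Finset.range (2*m+1), Complex.exp z ^ j‖ ≤
      (2 * m + 1) * Real.exp (m * K) := by
    rw [Finset.mul_sum]
    refine (norm_sum_le _ _).trans ((Finset.sum_le_card_nsmul _ _ (Real.exp (m*K)) ?_).trans ?_)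
    · intro j hj
      rw [Finset.mem_range] at hj
      rw [← Complex.exp_nat_mul, ← Complex.exp_add, Complex.norm_exp, Real.exp_le_exp]
      have : (-(m:ℂ) * z + j * z).re = (j - m) * z.re := by
        simp
        ring
      rw [this]
      calc ((j:ℝ) - m) * z.re ≤ |((j:ℝ) - m) * z.re| := le_abs_self _
        _ = |(j:ℝ) - m| * |z.re| := abs_mul _ _
        _ ≤ m * K := by
          refine mul_le_mul ?_ hz (abs_nonneg _) hm
          have : (j:ℝ) ≤ 2 * m := by exact_mod_cast Nat.lt_succ_iff.1 hj
          rw [abs_le]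
          constructor <;> linarith [(j.cast_nonneg : (0:ℝ) ≤ j)]
    · simp
  have h2 : (2 * m + 1 : ℝ) ≤ Real.exp (2 * m) := Real.add_one_le_exp _
  rw [thetaRhoTerm, norm_mul, norm_mul, norm_pow, norm_neg, norm_one, one_pow, one_mul,
    Complex.norm_exp]
  have h3 : (-(c:ℂ) * (m * (m+1))).re = -c * (m * (m+1)) := by
    have : (-(c:ℂ) * (m * (m+1))) = ((-c * (m * (m+1)) : ℝ) : ℂ) := by push_cast; ring
    rw [this, Complex.ofReal_re]
  rw [h3]
  calc _ ≤ Real.exp (-c * (m * (m+1))) * (Real.exp (2 * m) * Real.exp (m * K)) := by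
        refine mul_le_mul le_rfl (h1.trans ?_) (norm_nonneg _) (Real.exp_pos _).le
        exact mul_le_mul_of_nonneg_right h2 (Real.exp_pos _).le
    _ = _ := by
      rw [← Real.exp_add, ← Real.exp_add]
      ring_nf

theorem summable_thetaRho_bound {c : ℝ} (hc : 0 < c) (K : ℝ) :
    Summable fun m : ℕ => Real.exp (m * (K + 2) - c * (m * (m + 1))) :=
  ((summable_thetaFun_real hc (K+2-c)).comp_injective Nat.cast_injective).congr fun m => by
    simp only [Function.comp, Int.cast_natCast]
    ring_nf

theorem summable_thetaRho {c : ℝ} (hc : 0 < c) (z : ℂ) : Summable fun m => thetaRhoTerm c m z :=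
  Summable.of_norm_bounded (summable_thetaRho_bound hc _) fun m =>
    norm_thetaRhoTerm_le c m le_rfl

theorem differentiable_thetaRho {c : ℝ} (hc : 0 < c) : Differentiable ℂ (thetaRho c) := by
  intro z
  have ho : IsOpen {w : ℂ | |w.re| < |z.re| + 1} :=
    isOpen_lt (by fun_prop) continuous_const
  have := Complex.differentiableOn_tsum_of_summable_norm (F := thetaRhoTerm c)
    (summable_thetaRho_bound hc (|z.re| + 1))
    (fun m => by unfold thetaRhoTerm; fun_prop) ho
    (fun m w hw => norm_thetaRhoTerm_le c m (le_of_lt hw))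
  exact (this z (by simp)).differentiableAt (ho.mem_nhds (by simp))

theorem thetaRho_add_two_pi (c : ℝ) (v : ℂ) :
    thetaRho c (v + 2 * Real.pi * Complex.I) = thetaRho c v := by
  rw [thetaRho, thetaRho]
  congr 1
  ext m
  have h1 : Complex.exp (v + 2 * Real.pi * Complex.I) = Complex.exp v := Complex.exp_periodic v
  have h2 : Complex.exp (-m * (v + 2 * Real.pi * Complex.I)) = Complex.exp (-m * v) := by
    rw [show -(m:ℂ) * (v + 2 * Real.pi * Complex.I) = -m * v + ((-m:ℤ):ℂ) * (2 * Real.pi * Complex.I) by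
      push_cast; ring, Complex.exp_add, Complex.exp_int_mul_two_pi_mul_I, mul_one]
  rw [thetaRhoTerm, thetaRhoTerm, h1, h2]

theorem one_sub_exp_mul_thetaRho {c : ℝ} (hc : 0 < c) (z : ℂ) :
    (1 - Complex.exp z) * thetaRho c z = thetaAlt c (z + c) := by
  have hs := summable_thetaAlt hc (-(z + c))
  rw [← thetaAlt_neg, thetaAlt_eq_tsum, thetaRho, ← tsum_mul_left]
  have h1 := hs.comp_injective (Nat.cast_injective (R := ℤ))
  have h2 := hs.comp_injective (i := fun n : ℕ => (-(n + 1 : ℤ))) (fun a b h => by simpa using h)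
  have h3 := HasSum.of_nat_of_neg_add_one (f := fun n : ℤ => (-1)^n * Complex.exp (n * -(z + c) - c * n^2))
    h1.hasSum h2.hasSum
  rw [h3.tsum_eq, ← h1.tsum_add h2]
  congr 1
  ext m
  have := geom_sum_mul (Complex.exp z) (2*m+1)
  have e1 : Complex.exp ((m:ℂ) * -(z + c) - c * m^2) =
      Complex.exp (-c * (m * (m+1))) * Complex.exp (-m * z) := by
    rw [← Complex.exp_add]
    ring_nf
  have e2 : Complex.exp (-((m:ℂ)+1) * -(z + c) - c * (-(m+1))^2) =
      Complex.exp (-c * (m * (m+1))) * Complex.exp (-m * z) * Complex.exp z ^ (2*m+1) := by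
    rw [← Complex.exp_nat_mul, ← Complex.exp_add, ← Complex.exp_add]
    push_cast
    ring_nf
  have e3 : (-1 : ℂ) ^ (-((m:ℤ)+1)) = - (-1)^m := by
    rw [zpow_neg, ← inv_zpow, inv_neg, inv_one]
    rw [show ((m:ℤ)+1) = ((m+1:ℕ):ℤ) by push_cast; rfl, zpow_natCast, pow_succ]
    ring
  simp only [Function.comp, thetaRhoTerm]
  push_cast
  rw [e1, e2, e3, zpow_natCast]
  linear_combination (-(-1) ^ m * Complex.exp (-c * (m * (m+1))) * Complex.exp (-m * z)) * this


theorem eq_of_one_sub_exp_mul_eq {f g : ℂ → ℂ} (hf : Continuous f) (hg : Continuous g)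
    (h : ∀ z, (1 - Complex.exp z) * f z = (1 - Complex.exp z) * g z) (z : ℂ) : f z = g z := by
  by_cases hz : Complex.exp z = 1
  · have h1 : Tendsto (fun x : ℝ => f (z + x)) (𝓝[>] 0) (𝓝 (f z)) := by
      have : Continuous fun x : ℝ => f (z + x) := by fun_prop
      simpa using (this.tendsto 0).mono_left nhdsWithin_le_nhds
    have h2 : Tendsto (fun x : ℝ => g (z + x)) (𝓝[>] 0) (𝓝 (g z)) := by
      have : Continuous fun x : ℝ => g (z + x) := by fun_prop
      simpa using (this.tendsto 0).mono_left nhdsWithin_le_nhds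
    refine tendsto_nhds_unique (h1.congr' ?_) h2
    filter_upwards [self_mem_nhdsWithin] with x hx
    refine mul_left_cancel₀ ?_ (h (z + x))
    rw [Complex.exp_add, hz, one_mul, sub_ne_zero]
    intro h'
    have : Real.exp x = 1 := by exact_mod_cast h'.symm
    rw [Real.exp_eq_one_iff] at this
    exact (ne_of_gt hx) this
  · exact mul_left_cancel₀ (sub_ne_zero.2 (Ne.symm hz)) (h z)

theorem thetaRho_neg {c : ℝ} (hc : 0 < c) (z : ℂ) : thetaRho c (-z) = thetaRho c z := by
  have hd := (differentiable_thetaRho hc).continuous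
  refine eq_of_one_sub_exp_mul_eq (f := fun z => thetaRho c (-z)) (by fun_prop) hd (fun z => ?_) z
  have h1 := one_sub_exp_mul_thetaRho hc z
  have h2 := one_sub_exp_mul_thetaRho hc (-z)
  have h3 := thetaAlt_add c (z - c)
  rw [show -z + c = -(z - c) by ring, thetaAlt_neg] at h2
  rw [show z - c + 2 * c = z + c by ring, sub_add_cancel] at h3
  have h4 : Complex.exp z * Complex.exp (-z) = 1 := by rw [← Complex.exp_add]; simp
  linear_combination -h1 - h3 - Complex.exp z * h2 - thetaRho c (-z) * h4

theorem thetaRho_duplication {c : ℝ} (hc : 0 < c) (z : ℂ) :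
    thetaFun (4*c) (2*c) * thetaRho c z = thetaRho (2*c) z * thetaAlt (2*c) z := by
  have hd := (differentiable_thetaRho hc).continuous
  have hd2 := (differentiable_thetaRho (c := 2*c) (by linarith)).continuous
  have hd3 := (differentiable_thetaAlt (c := 2*c) (by linarith)).continuous
  refine eq_of_one_sub_exp_mul_eq (f := fun z => thetaFun (4*c) (2*c) * thetaRho c z)
    (g := fun z => thetaRho (2*c) z * thetaAlt (2*c) z) (by fun_prop) (by fun_prop)
    (fun z => ?_) z
  have h1 := one_sub_exp_mul_thetaRho hc z
  have h2 := one_sub_exp_mul_thetaRho (c := 2*c) (by linarith) z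
  have h3 := thetaAlt_duplication hc z
  push_cast at h2
  linear_combination thetaFun (4*c) (2*c) * h1 - h3 - thetaAlt (2*c) z * h2

theorem exp_ne_one_of_re_ne_zero {z : ℂ} (h : z.re ≠ 0) : 1 - Complex.exp z ≠ 0 := by
  intro h'
  have : ‖Complex.exp z‖ = 1 := by rw [← sub_eq_zero.1 h', norm_one]
  rw [Complex.norm_exp, Real.exp_eq_one_iff] at this
  exact h this

theorem thetaAlt_eq_mul_thetaRho {c : ℝ} (hc : 0 < c) (z : ℂ) :
    thetaAlt c z = (1 - Complex.exp (z - c)) * thetaRho c (z - c) := by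
  rw [one_sub_exp_mul_thetaRho hc, sub_add_cancel]

theorem thetaRho_ne_zero_of_three_le {c : ℝ} (hc : 3 ≤ c) {z : ℂ} (hz : |z.re| ≤ c) :
    thetaRho c z ≠ 0 := by
  intro h0
  have hs := summable_thetaRho (by linarith : 0 < c) z
  rw [thetaRho, hs.tsum_eq_zero_add] at h0
  have hf : thetaRhoTerm c 0 z = 1 := by simp [thetaRhoTerm]
  have hr0 : 0 ≤ Real.exp (-1) := (Real.exp_pos _).le
  have hr : Real.exp (-1) < 1/2 := by
    rw [Real.exp_neg, inv_eq_one_div]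
    exact one_div_lt_one_div_of_lt (by norm_num) (by linarith [Real.exp_one_gt_d9])
  have hb : ∀ m : ℕ, ‖thetaRhoTerm c (m+1) z‖ ≤ Real.exp (-1) * Real.exp (-1) ^ m := by
    intro m
    refine (norm_thetaRhoTerm_le c (m+1) hz).trans ?_
    rw [← pow_succ', ← Real.exp_nat_mul, Real.exp_le_exp]
    push_cast
    have hm : (0:ℝ) ≤ m := m.cast_nonneg
    nlinarith [mul_nonneg (mul_nonneg hm hm) (by linarith : 0 ≤ c - 3), mul_nonneg hm (by linarith : 0 ≤ c - 3), mul_nonneg hm hm]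
  have h1 := tsum_of_norm_bounded ((hasSum_geometric_of_lt_one hr0 (by linarith)).mul_left (Real.exp (-1))) hb
  rw [hf] at h0
  have h2 : ∑' m, thetaRhoTerm c (m+1) z = -1 := by linear_combination h0
  rw [h2, norm_neg, norm_one, ← div_eq_mul_inv, le_div_iff₀ (by linarith)] at h1
  linarith

theorem exists_thetaRho_eq_zero {c : ℝ} (hc : 0 < c) (h : ∃ z : ℂ, |z.re| ≤ c ∧ thetaRho c z = 0) :
    ∃ z : ℂ, |z.re| ≤ 2*c ∧ thetaRho (2*c) z = 0 := by
  obtain ⟨z, hz, h0⟩ := h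
  wlog hp : 0 ≤ z.re generalizing z
  · exact this (-z) (by simpa using hz) (by rw [thetaRho_neg hc, h0]) (by simp; linarith)
  rw [abs_of_nonneg hp] at hz
  have h1 := thetaRho_duplication hc z
  rw [h0, mul_zero, thetaAlt_eq_mul_thetaRho (by linarith)] at h1
  rcases mul_eq_zero.1 h1.symm with h2 | h2
  · exact ⟨z, by rw [abs_of_nonneg hp]; linarith, h2⟩
  · rcases mul_eq_zero.1 h2 with h3 | h3
    · exact absurd h3 (exp_ne_one_of_re_ne_zero (by simp; linarith))
    · refine ⟨_, ?_, h3⟩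
      simp only [Complex.sub_re, Complex.ofReal_re]
      rw [abs_le]
      constructor <;> linarith

theorem thetaRho_ne_zero {c : ℝ} (hc : 0 < c) {z : ℂ} (hz : |z.re| ≤ c) : thetaRho c z ≠ 0 := by
  intro h
  have : ∀ k : ℕ, ∃ z : ℂ, |z.re| ≤ 2^k*c ∧ thetaRho (2^k*c) z = 0 := by
    intro k
    induction k with
    | zero => exact ⟨z, by simpa using hz, by simpa using h⟩
    | succ k ih =>
      rw [pow_succ', mul_assoc]
      exact exists_thetaRho_eq_zero (by positivity) ih
  obtain ⟨k, hk⟩ := pow_unbounded_of_one_lt (3 / c) (by norm_num : (1:ℝ) < 2)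
  rw [div_lt_iff₀ hc] at hk
  obtain ⟨y, hy, hy0⟩ := this k
  exact thetaRho_ne_zero_of_three_le hk.le hy hy0

theorem thetaAlt_ne_zero {c : ℝ} (hc : 0 < c) {z : ℂ} (hz : |z.re| < c) : thetaAlt c z ≠ 0 := by
  wlog hp : 0 ≤ z.re generalizing z
  · rw [← thetaAlt_neg]
    exact this (by simpa using hz) (by simp; linarith)
  rw [abs_of_nonneg hp] at hz
  rw [thetaAlt_eq_mul_thetaRho hc]
  refine mul_ne_zero (exp_ne_one_of_re_ne_zero (by simp; linarith)) (thetaRho_ne_zero hc ?_)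
  simp only [Complex.sub_re, Complex.ofReal_re]
  rw [abs_le]
  constructor <;> linarith

/-- The parametrization of the first coordinate of the kernel curve. -/
noncomputable def kernelW (ε : ℝ) (z : ℂ) : ℂ :=
  -Complex.exp (-ε - z) * (thetaAlt (4*ε) (z + 4*ε) * thetaAlt (4*ε) (z + 2*ε)) /
    (thetaAlt (4*ε) z * thetaAlt (4*ε) (z - 2*ε))

/-- The quotient of `1 - exp z` by `kernelW`. -/
noncomputable def kernelJ (ε : ℝ) (z : ℂ) : ℂ :=
  -Complex.exp (ε + z) * (thetaAlt (4*ε) z * thetaAlt (4*ε) (z - 2*ε)) /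
    (thetaAlt (4*ε) (z + 2*ε) * thetaRho (4*ε) z)

/-- The length variable of the generating function. -/
noncomputable def kernelT (ε : ℝ) : ℝ :=
  Real.exp (-ε) * ((∑' n : ℤ, Real.exp (n * (4*ε) - 8*ε * n^2)) /
    (∑' n : ℤ, Real.exp (n * 0 - 2*ε*n^2)))^2

theorem kernelT_pos {ε : ℝ} (hε : 0 < ε) : 0 < kernelT ε := by
  have h1 := thetaFun_real_pos (c := 8*ε) (by linarith) (4*ε)
  have h2 := thetaFun_real_pos (c := 2*ε) (by linarith) 0
  unfold kernelT
  have := Real.exp_pos (-ε)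
  positivity

theorem kernelT_mul {ε : ℝ} (hε : 0 < ε) :
    kernelT ε * (Complex.exp ε * thetaFun (2*ε) 0 ^ 2) = thetaFun (8*ε) (4*ε) ^ 2 := by
  have h1 := thetaFun_ofReal (8*ε) (4*ε)
  have h2 := thetaFun_ofReal (2*ε) 0
  have h3 := thetaFun_ofReal_ne_zero (c := 2*ε) (by linarith) 0
  have h4 : Complex.exp (-ε) * Complex.exp ε = 1 := by rw [← Complex.exp_add]; simp
  rw [kernelT]
  push_cast at h1 h2 h3 ⊢
  rw [← h1, ← h2]
  generalize thetaFun (8*ε) (4*ε) = M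
  generalize thetaFun (2*ε) 0 = N at *
  generalize Complex.exp ε = q at *
  field_simp
  linear_combination M ^ 2 * h4

theorem thetaAlt_shift (ε : ℝ) (z : ℂ) :
    thetaAlt (4*ε) (z + 4*ε) = -Complex.exp z * thetaAlt (4*ε) (z - 4*ε) := by
  have := thetaAlt_add (4*ε) (z - 4*ε)
  push_cast at this
  rw [sub_add_cancel, show z - 4*ε + 2*(4*ε) = z + 4*ε by ring] at this
  exact this

theorem thetaAlt_four_ne_zero {ε : ℝ} (hε : 0 < ε) {z : ℂ} (h1 : -(4*ε) < z.re)
    (h2 : z.re < 4*ε) : thetaAlt (4*ε) z ≠ 0 :=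
  thetaAlt_ne_zero (by linarith) (abs_lt.2 ⟨h1, h2⟩)

theorem thetaAlt_add_four_ne_zero {ε : ℝ} (hε : 0 < ε) {z : ℂ} (h1 : 0 < z.re)
    (h2 : z.re < 8*ε) : thetaAlt (4*ε) (z + 4*ε) ≠ 0 := by
  rw [thetaAlt_shift]
  exact mul_ne_zero (neg_ne_zero.2 (Complex.exp_ne_zero _))
    (thetaAlt_four_ne_zero hε (by simp; linarith) (by simp; linarith))

theorem kernelW_neg (ε : ℝ) (z : ℂ) : kernelW ε (-z) =
    Complex.exp (-ε) * (thetaAlt (4*ε) (z + 4*ε) * thetaAlt (4*ε) (z - 2*ε)) /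
    (thetaAlt (4*ε) (z + 2*ε) * thetaAlt (4*ε) z) := by
  rw [kernelW, show -z + 4*ε = -(z - 4*ε) by ring, show -z + 2*ε = -(z - 2*ε) by ring,
    show -z - 2*ε = -(z + 2*ε) by ring, thetaAlt_neg, thetaAlt_neg, thetaAlt_neg, thetaAlt_neg,
    thetaAlt_shift, show -ε - -z = -ε + z by ring, Complex.exp_add]
  ring_nf

theorem kernelW_equation {ε : ℝ} (hε : 0 < ε) {z : ℂ} (h1 : 0 < z.re) (h2 : z.re < 2*ε) :
    kernelT ε * (kernelW ε z + (kernelW ε z)⁻¹ + kernelW ε (-z) + (kernelW ε (-z))⁻¹) = 1 := by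
  have hA := thetaAlt_add_four_ne_zero hε (z := z) h1 (by linarith)
  have hB := thetaAlt_four_ne_zero hε (z := z + 2*ε) (by simp; linarith) (by simp; linarith)
  have hC := thetaAlt_four_ne_zero hε (z := z) (by linarith) (by linarith)
  have hD := thetaAlt_four_ne_zero hε (z := z - 2*ε) (by simp; linarith) (by simp; linarith)
  have r1 := thetaAlt_sq hε z
  have r2 := thetaAlt_sq hε (z + 2*ε)
  have r3 := thetaAlt_shift ε (z + 2*ε)
  have r4 := kernelT_mul hε
  rw [r3, show z + 2*ε + 2*ε = z + 4*ε by ring, show z + 2*ε - 4*ε = z - 2*ε by ring,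
    add_sub_cancel_right] at r2
  have hx := Complex.exp_ne_zero z
  have hq := Complex.exp_ne_zero ε
  have e1 : Complex.exp (-2*ε - z) = 1 / (Complex.exp ε ^ 2 * Complex.exp z) := by
    rw [← Complex.exp_nat_mul, ← Complex.exp_add, one_div, ← Complex.exp_neg]
    push_cast
    ring_nf
  have e2 : Complex.exp (-2*ε - (z+2*ε)) = 1 / (Complex.exp ε ^ 4 * Complex.exp z) := by
    rw [← Complex.exp_nat_mul, ← Complex.exp_add, one_div, ← Complex.exp_neg]
    push_cast
    ring_nf
  have e3 : Complex.exp (z+2*ε) = Complex.exp z * Complex.exp ε ^ 2 := by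
    rw [← Complex.exp_nat_mul, ← Complex.exp_add]
    push_cast
    ring_nf
  have e4 : Complex.exp (-ε) = 1 / Complex.exp ε := by rw [one_div, Complex.exp_neg]
  have e5 : Complex.exp (-ε - z) = 1 / (Complex.exp ε * Complex.exp z) := by
    rw [← Complex.exp_add, one_div, ← Complex.exp_neg]
    ring_nf
  have hM := thetaFun_ofReal_ne_zero (c := 8*ε) (by linarith) (4*ε)
  push_cast at hM
  rw [kernelW_neg, kernelW, e4, e5]
  rw [e1] at r1
  rw [e2, e3] at r2
  generalize thetaAlt (4*ε) (z + 4*ε) = A at *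
  generalize thetaAlt (4*ε) (z + 2*ε) = B at *
  generalize thetaAlt (4*ε) z = C at *
  generalize thetaAlt (4*ε) (z - 2*ε) = D at *
  generalize thetaFun (8*ε) (4*ε) = M at *
  generalize thetaFun (2*ε) 0 = N at *
  generalize Complex.exp z = x at *
  generalize Complex.exp ε = q at *
  generalize (kernelT ε : ℂ) = T at *
  field_simp at r1 r2 ⊢
  refine mul_left_cancel₀ (mul_ne_zero hM hM) ?_
  linear_combination T * (M * (B^2 - x * D^2)) * r1 + T * (q^2 * x * N * B * D) * r2 +
    q * x * A * B * C * D * r4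

theorem kernelW_conj (ε : ℝ) (z : ℂ) :
    kernelW ε (starRingEnd ℂ z) = starRingEnd ℂ (kernelW ε z) := by
  simp only [kernelW, map_div₀, map_mul, map_neg, ← thetaAlt_conj, ← Complex.exp_conj, map_add,
    map_sub, Complex.conj_ofReal, Complex.conj_ofNat]

theorem kernelW_zero (ε : ℝ) : kernelW ε 0 = 0 := by
  have h := thetaAlt_shift ε 0
  rw [show (0 - 4*ε : ℂ) = -(0 + 4*ε) by ring, thetaAlt_neg, Complex.exp_zero] at h
  have : thetaAlt (4*ε) (0 + 4*ε) = 0 := by linear_combination h / 2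
  rw [kernelW, this]
  simp

theorem thetaAlt_four_re_ne_zero {ε : ℝ} (hε : 0 < ε) {x : ℝ} (h1 : -(4*ε) < x)
    (h2 : x < 4*ε) : (thetaAlt (4*ε) x).re ≠ 0 := by
  intro h
  refine thetaAlt_four_ne_zero hε (z := x) (by simpa using h1) (by simpa using h2) ?_
  rw [thetaAlt_ofReal, h, Complex.ofReal_zero]

theorem kernelW_mid {ε : ℝ} : kernelW ε ε = ((Real.exp (-ε) *
    ((thetaAlt (4*ε) (3*ε : ℝ)).re / (thetaAlt (4*ε) ε).re)^2 : ℝ) : ℂ) := by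
  have h := thetaAlt_shift ε ε
  have h3 := thetaAlt_ofReal (4*ε) (3*ε)
  have h1 := thetaAlt_ofReal (4*ε) ε
  have e : Complex.exp (-ε - ε) * Complex.exp ε = Complex.exp (-ε) := by
    rw [← Complex.exp_add]
    ring_nf
  rw [show (ε - 4*ε : ℂ) = -((3*ε : ℝ) : ℂ) by push_cast; ring, thetaAlt_neg] at h
  rw [kernelW, h, show (ε - 2*ε : ℂ) = -ε by ring, thetaAlt_neg,
    show (ε + 2*ε : ℂ) = ((3*ε : ℝ) : ℂ) by push_cast; ring, Complex.ofReal_mul (Real.exp _),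
    Complex.ofReal_pow, Complex.ofReal_div, ← h1, ← h3, Complex.ofReal_exp, Complex.ofReal_neg, ← e]
  ring

theorem kernelW_mul_neg_real (ε x : ℝ) (hε : 0 < ε) (h1 : 0 < x) (h2 : x ≤ ε) :
    kernelW ε x * kernelW ε (-x) = ((-(Real.exp (-2*ε-x) *
      ((thetaAlt (4*ε) (x + 4*ε : ℝ)).re / (thetaAlt (4*ε) x).re)^2) : ℝ) : ℂ) := by
  have hB := thetaAlt_four_ne_zero hε (z := x + 2*ε) (by simp; linarith) (by simp; linarith)
  have hD := thetaAlt_four_ne_zero hε (z := x - 2*ε) (by simp; linarith) (by simp; linarith)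
  have h3 := thetaAlt_ofReal (4*ε) (x + 4*ε)
  have h1 := thetaAlt_ofReal (4*ε) x
  have e : Complex.exp (-ε - x) * Complex.exp (-ε) = Complex.exp (-2*ε-x) := by
    rw [← Complex.exp_add]
    ring_nf
  rw [kernelW_neg, kernelW, Complex.ofReal_neg, Complex.ofReal_mul, Complex.ofReal_pow,
    Complex.ofReal_div, ← h1, ← h3, Complex.ofReal_exp, Complex.ofReal_sub, Complex.ofReal_mul]
  push_cast at *
  rw [← e]
  generalize thetaAlt (4*ε) (x + 2*ε) = B at *
  generalize thetaAlt (4*ε) (x - 2*ε) = D at *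
  field_simp

theorem kernelParam {ε : ℝ} (hε : 0 < ε) (ht : kernelT ε < 1/4) :
    KernelParam ε (kernelT ε) (kernelW ε) (kernelJ ε) where
  pos := hε
  t_pos := kernelT_pos hε
  t_lt := ht
  diff z h1 h2 := by
    have hd := differentiable_thetaAlt (c := 4*ε) (by linarith)
    have hC := thetaAlt_four_ne_zero hε (z := z) (by linarith) (by linarith)
    have hD := thetaAlt_four_ne_zero hε (z := z - 2*ε) (by simp; linarith) (by simp; linarith)
    unfold kernelW
    refine DifferentiableAt.div ?_ ?_ (mul_ne_zero hC hD) <;> fun_prop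
  per z := by
    rw [kernelW, kernelW, show z + 2 * Real.pi * Complex.I + 4*ε =
      z + 4*ε + 2 * Real.pi * Complex.I by ring, show z + 2 * Real.pi * Complex.I + 2*ε =
      z + 2*ε + 2 * Real.pi * Complex.I by ring, show z + 2 * Real.pi * Complex.I - 2*ε =
      z - 2*ε + 2 * Real.pi * Complex.I by ring, thetaAlt_add_two_pi, thetaAlt_add_two_pi,
      thetaAlt_add_two_pi, thetaAlt_add_two_pi, ← Complex.exp_periodic (-ε - (z + _))]
    ring_nf
  refl z := by
    have h1 := thetaAlt_shift ε z
    have h2 := thetaAlt_shift ε (z - 2*ε)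
    rw [show z - 2*ε + 4*ε = z + 2*ε by ring] at h2
    have e : Complex.exp (-ε - (2*ε - z)) = Complex.exp (-ε - z) * (Complex.exp z *
      Complex.exp (z - 2*ε)) := by
      rw [← Complex.exp_add, ← Complex.exp_add]
      ring_nf
    rw [kernelW, kernelW, show 2*ε - z + 4*ε = -(z - 2*ε - 4*ε) by ring,
      show 2*ε - z + 2*ε = -(z - 4*ε) by ring, show (2*ε : ℂ) - z = -(z - 2*ε) by ring,
      show -(z - 2*ε) - 2*ε = -z by ring, thetaAlt_neg, thetaAlt_neg, thetaAlt_neg, thetaAlt_neg,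
      h1, h2, show -ε - -(z - 2*ε) = -ε - (2*ε - z) by ring, e]
    ring
  quasi z h1 h2 := by
    have hA := thetaAlt_four_ne_zero hε (z := z + 4*ε) (by simp; linarith) (by simp; linarith)
    have hB := thetaAlt_four_ne_zero hε (z := z + 2*ε) (by simp; linarith) (by simp; linarith)
    have hC := thetaAlt_four_ne_zero hε (z := z) (by linarith) (by linarith)
    have hD := thetaAlt_four_ne_zero hε (z := z - 2*ε) (by simp; linarith) (by simp; linarith)
    have e1 := thetaAlt_shift ε (z + 4*ε)
    have e2 := thetaAlt_shift ε (z + 2*ε)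
    rw [add_sub_cancel_right] at e1
    rw [show z + 2*ε - 4*ε = z - 2*ε by ring, show z + 2*ε + 4*ε = z + 4*ε + 2*ε by ring] at e2
    have e : Complex.exp (-ε - z) * Complex.exp (-ε - (z + 4*ε)) * (Complex.exp (z+4*ε) *
        Complex.exp (z + 2*ε)) = 1 := by
      rw [← Complex.exp_add, ← Complex.exp_add, ← Complex.exp_add]
      ring_nf
      simp
    rw [kernelW, kernelW, e1, e2, show z + 4*ε - 2*ε = z + 2*ε by ring]
    generalize thetaAlt (4*ε) (z + 4*ε) = A at *
    generalize thetaAlt (4*ε) (z + 2*ε) = B at *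
    generalize thetaAlt (4*ε) (z - 2*ε) = D at *
    field_simp
    rw [mul_comm (ε : ℂ) 4, mul_comm (ε : ℂ) 2]
    linear_combination e
  ne_zero z h1 h2 := by
    have hA := thetaAlt_add_four_ne_zero hε (z := z) h1 (by linarith)
    have hB := thetaAlt_four_ne_zero hε (z := z + 2*ε) (by simp; linarith) (by simp; linarith)
    have hC := thetaAlt_four_ne_zero hε (z := z) (by linarith) (by linarith)
    have hD := thetaAlt_four_ne_zero hε (z := z - 2*ε) (by simp; linarith) (by simp; linarith)
    rw [kernelW]
    exact div_ne_zero (mul_ne_zero (neg_ne_zero.2 (Complex.exp_ne_zero _)) (mul_ne_zero hA hB))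
      (mul_ne_zero hC hD)
  kernel z h1 h2 := kernelW_equation hε h1 h2
  conj := kernelW_conj ε
  zero := kernelW_zero ε
  pos_mid := by
    rw [kernelW_mid, Complex.ofReal_re]
    have h3 := thetaAlt_four_re_ne_zero hε (x := 3*ε) (by linarith) (by linarith)
    have h1 := thetaAlt_four_re_ne_zero hε (x := ε) (by linarith) (by linarith)
    have := Real.exp_pos (-ε)
    positivity
  sign x h1 h2 := by
    have hr : ∀ y : ℝ, kernelW ε y = ((kernelW ε y).re : ℂ) := fun y => by
      have := kernelW_conj ε y
      rw [Complex.conj_ofReal] at this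
      exact (Complex.conj_eq_iff_re.1 this.symm).symm
    have h := kernelW_mul_neg_real ε x hε h1 h2
    rw [hr x, ← Complex.ofReal_neg, hr (-x)] at h
    rw [← Complex.ofReal_neg]
    rw [← Complex.ofReal_mul, Complex.ofReal_inj] at h
    rw [h, neg_lt_zero]
    have hC := thetaAlt_four_re_ne_zero hε (x := x) (by linarith) (by linarith)
    have hA : (thetaAlt (4*ε) (x + 4*ε : ℝ)).re ≠ 0 := by
      intro h0
      refine thetaAlt_add_four_ne_zero hε (z := x) (by simpa using h1) (by simp; linarith) ?_
      have := thetaAlt_ofReal (4*ε) (x + 4*ε)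
      rw [h0] at this
      simpa using this
    have := Real.exp_pos (-2*ε-x)
    positivity
  diffJ z h1 h2 := by
    have hd := differentiable_thetaAlt (c := 4*ε) (by linarith)
    have hd' := differentiable_thetaRho (c := 4*ε) (by linarith)
    have hB := thetaAlt_four_ne_zero hε (z := z + 2*ε) (by simp; linarith) (by simp; linarith)
    have hR := thetaRho_ne_zero (c := 4*ε) (by linarith) (z := z)
      (abs_le.2 ⟨by linarith, by linarith⟩)
    unfold kernelJ
    refine DifferentiableAt.div ?_ ?_ (mul_ne_zero hB hR) <;> fun_prop
  perJ z := by
    rw [kernelJ, kernelJ, show z + 2 * Real.pi * Complex.I + 2*ε =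
      z + 2*ε + 2 * Real.pi * Complex.I by ring, show z + 2 * Real.pi * Complex.I - 2*ε =
      z - 2*ε + 2 * Real.pi * Complex.I by ring, thetaAlt_add_two_pi, thetaAlt_add_two_pi,
      thetaAlt_add_two_pi, thetaRho_add_two_pi, ← add_assoc, Complex.exp_periodic]
  mulJ z h1 h2 := by
    have hB := thetaAlt_four_ne_zero hε (z := z + 2*ε) (by simp; linarith) (by simp; linarith)
    have hC := thetaAlt_four_ne_zero hε (z := z) (by linarith) (by linarith)
    have hD := thetaAlt_four_ne_zero hε (z := z - 2*ε) (by simp; linarith) (by simp; linarith)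
    have hR := thetaRho_ne_zero (c := 4*ε) (by linarith) (z := z)
      (abs_le.2 ⟨by linarith, by linarith⟩)
    have hA := one_sub_exp_mul_thetaRho (c := 4*ε) (by linarith) z
    push_cast at hA
    have e : Complex.exp (ε + z) * Complex.exp (-ε - z) = 1 := by
      rw [← Complex.exp_add]
      simp
    rw [kernelJ, kernelW, ← hA]
    generalize thetaAlt (4*ε) (z + 2*ε) = B at *
    generalize thetaAlt (4*ε) (z - 2*ε) = D at *
    generalize Complex.exp (ε + z) = E at *
    field_simp
    rw [e, one_mul]

theorem thetaFun_modular {c : ℝ} (hc : 0 < c) (v : ℂ) :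
    thetaFun c v = 1 / (c / Real.pi : ℂ) ^ (1 / 2 : ℂ) * (Complex.exp (v^2 / (4*c)) *
      thetaFun (Real.pi^2/c) (-Complex.I * Real.pi * v / c)) := by
  have hp : (Real.pi : ℂ) ≠ 0 := by exact_mod_cast Real.pi_ne_zero
  have hc' : (c : ℂ) ≠ 0 := by exact_mod_cast hc.ne'
  have ha : 0 < (c / Real.pi : ℂ).re := by
    rw [← Complex.ofReal_div, Complex.ofReal_re]
    exact div_pos hc Real.pi_pos
  have h := Complex.tsum_exp_neg_quadratic ha (v / (2 * Real.pi))
  rw [thetaFun, thetaFun, ← tsum_mul_left]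
  have e1 : ∀ n : ℤ, Complex.exp (n * v - c * n^2) = Complex.exp (-Real.pi * (c / Real.pi) * n^2 +
      2 * Real.pi * (v / (2 * Real.pi)) * n) := fun n => by
    congr 1
    field_simp
    ring
  have e2 : ∀ n : ℤ, Complex.exp (v^2 / (4*c)) * Complex.exp (n * (-Complex.I * Real.pi * v / c) -
      ((Real.pi^2/c : ℝ) : ℂ) * n^2) =
      Complex.exp (-Real.pi / (c / Real.pi) * (n + Complex.I * (v / (2 * Real.pi)))^2) := fun n => by
    rw [← Complex.exp_add]
    congr 1
    push_cast
    field_simp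
    ring_nf
    rw [Complex.I_sq]
    ring
  rw [tsum_congr e1, tsum_congr e2, h]

/-- The theta constant `∑ exp (-x n²)`. -/
noncomputable def thetaThree (x : ℝ) : ℝ := ∑' n : ℤ, Real.exp (-x * n^2)

/-- The theta constant `∑ (-1)ⁿ exp (-x n²)`. -/
noncomputable def thetaFour (x : ℝ) : ℝ := ∑' n : ℤ, (-1)^n * Real.exp (-x * n^2)

theorem thetaFun_zero (x : ℝ) : thetaFun x 0 = thetaThree x := by
  rw [thetaFun, thetaThree, Complex.ofReal_tsum]
  congr 1
  ext n
  push_cast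
  ring_nf

theorem thetaAlt_zero (x : ℝ) : thetaAlt x 0 = thetaFour x := by
  rw [thetaAlt_eq_tsum, thetaFour, Complex.ofReal_tsum]
  congr 1
  ext n
  push_cast
  ring_nf

theorem thetaFun_neg_I_mul_pi_div_two {c : ℝ} (hc : 0 < c) :
    thetaFun c (-Complex.I * Real.pi / 2) = thetaAlt (4*c) 0 := by
  have h1 := thetaFun_add (4*c) (-Complex.I * Real.pi - 4*c)
  have h2 := thetaFun_add_two_pi (4*c) (-(4*c) - Complex.I * Real.pi)
  have h4 : thetaAlt (4*c) 0 = thetaFun (4*c) (-Complex.I * Real.pi) := by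
    rw [thetaAlt, ← thetaFun_neg]
    ring_nf
  push_cast at h1
  rw [show -Complex.I * Real.pi - 4*c + 2*(4*c) = -(-(4*c) - Complex.I * Real.pi +
    2 * Real.pi * Complex.I) by ring, thetaFun_neg, h2,
    show -Complex.I * Real.pi - 4*c + 4*c = -(Real.pi * Complex.I) by ring, Complex.exp_neg,
    Complex.exp_pi_mul_I, show -(4*c) - Complex.I * Real.pi = -Complex.I * Real.pi - 4*c by ring] at h1
  have h3 : thetaFun (4*c) (-Complex.I * Real.pi - 4*c) = 0 := by
    rw [inv_neg, inv_one] at h1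
    linear_combination h1 / 2
  rw [thetaFun_split hc, show 2 * (-Complex.I * Real.pi / 2) = -Complex.I * Real.pi by ring, h3, h4]
  ring

theorem summable_thetaThree {x : ℝ} (hx : 0 < x) :
    Summable fun n : ℤ => Real.exp (-x * n^2) := by
  refine (summable_thetaFun_real hx 0).congr fun n => ?_
  ring_nf

theorem thetaThree_pos {x : ℝ} (hx : 0 < x) : 0 < thetaThree x :=
  (summable_thetaThree hx).tsum_pos (fun _ => (Real.exp_pos _).le) 0 (Real.exp_pos _)

theorem summable_thetaFour {x : ℝ} (hx : 0 < x) :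
    Summable fun n : ℤ => (-1:ℝ)^n * Real.exp (-x * n^2) := by
  refine Summable.of_norm_bounded (summable_thetaThree hx) fun n => ?_
  rw [norm_mul, norm_zpow, norm_neg, norm_one, one_zpow, one_mul, Real.norm_eq_abs, Real.abs_exp]

theorem kernelT_eq {ε : ℝ} (hε : 0 < ε) :
    kernelT ε = (thetaFour (Real.pi^2/(2*ε)) / thetaThree (Real.pi^2/(2*ε)))^2 / 4 := by
  have hp : (Real.pi : ℂ) ≠ 0 := by exact_mod_cast Real.pi_ne_zero
  have hε' : (ε : ℂ) ≠ 0 := by exact_mod_cast hε.ne'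
  have h0 := kernelT_mul hε
  have h1 := thetaFun_modular (c := 8*ε) (by linarith) (4*ε)
  have h2 := thetaFun_modular (c := 2*ε) (by linarith) 0
  have h3 := thetaThree_pos (x := Real.pi^2/(2*ε)) (by positivity)
  push_cast at h1 h2
  rw [show -Complex.I * Real.pi * (4*ε) / (8*ε) = -Complex.I * Real.pi / 2 by field_simp; ring,
    thetaFun_neg_I_mul_pi_div_two (by positivity), thetaAlt_zero] at h1
  rw [mul_zero, zero_div, thetaFun_zero (Real.pi^2/(2*ε)), zero_pow two_ne_zero, zero_div, Complex.exp_zero,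
    one_mul] at h2
  have sq : ∀ y : ℂ, (y ^ (1/2 : ℂ))^2 = y := fun y => by
    rw [← Complex.cpow_nat_mul]
    norm_num
  have e : Complex.exp ((4*ε)^2/(4*(8*ε)))^2 = Complex.exp ε := by
    rw [← Complex.exp_nat_mul]
    congr 1
    field_simp
    push_cast
    ring
  rw [h1, h2, mul_pow, mul_pow, mul_pow, div_pow, div_pow, sq, sq, e,
    show 4 * (Real.pi^2/(8*ε)) = Real.pi^2/(2*ε) by field_simp; ring] at h0
  have h4 := Complex.exp_ne_zero ε
  generalize thetaFour (Real.pi^2/(2*ε)) = B at *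
  generalize thetaThree (Real.pi^2/(2*ε)) = A at *
  generalize Complex.exp ε = E at *
  field_simp at h0
  have h5 : kernelT ε * A^2 * 4 = B^2 := by
    have : ((kernelT ε * A^2 * 4 : ℝ) : ℂ) = ((B^2 : ℝ) : ℂ) := by
      push_cast
      linear_combination h0 / 2
    exact_mod_cast this
  field_simp
  linear_combination h5

theorem kernelT_lt {ε : ℝ} (hε : 0 < ε) : kernelT ε < 1/4 := by
  have hx : 0 < Real.pi^2/(2*ε) := by positivity
  rw [kernelT_eq hε]
  generalize Real.pi^2/(2*ε) = x at hx
  have h3 := thetaThree_pos hx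
  have s3 := summable_thetaThree hx
  have s4 := summable_thetaFour hx
  have hlt : thetaFour x < thetaThree x := by
    refine s4.tsum_lt_tsum (i := 1) (fun n => ?_) ?_ s3
    · refine mul_le_of_le_one_left (Real.exp_pos _).le ?_
      rcases Int.even_or_odd n with h | h <;> simp [h.neg_one_zpow]
    · have := Real.exp_pos (-x * 1^2)
      simp only [zpow_one, Int.cast_one]
      linarith
  have hgt : -thetaThree x < thetaFour x := by
    rw [thetaThree, ← tsum_neg]
    refine s3.neg.tsum_lt_tsum (i := 0) (fun n => ?_) ?_ s4
    · rcases Int.even_or_odd n with h | h <;> simp [h.neg_one_zpow]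
      have := Real.exp_pos (-(x * n^2))
      linarith
    · norm_num
  have : (thetaFour x / thetaThree x)^2 < 1 := by
    rw [sq_lt_one_iff_abs_lt_one, abs_lt, lt_div_iff₀ h3, div_lt_one h3]
    constructor <;> linarith
  linarith

/-- `X = X₀ + x₁ Y + o(Y)` along `l`. -/
def HasExpansion {ι : Type*} (l : Filter ι) (Y X : ι → ℝ) (X₀ x₁ : ℝ) : Prop :=
  (fun i => X i - X₀ - x₁ * Y i) =o[l] Y

namespace HasExpansion

variable {ι : Type*} {l : Filter ι} {Y X Z : ι → ℝ} {X₀ x₁ Z₀ z₁ : ℝ}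

theorem congr (h : HasExpansion l Y X X₀ x₁) (e : X =ᶠ[l] Z) : HasExpansion l Y Z X₀ x₁ :=
  Asymptotics.IsLittleO.congr' h (by filter_upwards [e] with i hi; rw [hi]) EventuallyEq.rfl

theorem add (h : HasExpansion l Y X X₀ x₁) (k : HasExpansion l Y Z Z₀ z₁) :
    HasExpansion l Y (fun i => X i + Z i) (X₀ + Z₀) (x₁ + z₁) :=
  (Asymptotics.IsLittleO.add h k).congr_left fun i => by ring

theorem const_mul (c : ℝ) (h : HasExpansion l Y X X₀ x₁) :
    HasExpansion l Y (fun i => c * X i) (c * X₀) (c * x₁) :=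
  (Asymptotics.IsLittleO.const_mul_left h c).congr_left fun i => by ring

theorem sub (h : HasExpansion l Y X X₀ x₁) (k : HasExpansion l Y Z Z₀ z₁) :
    HasExpansion l Y (fun i => X i - Z i) (X₀ - Z₀) (x₁ - z₁) :=
  (Asymptotics.IsLittleO.sub h k).congr_left fun i => by ring

theorem isBigO (h : HasExpansion l Y X X₀ x₁) : (fun i => X i - X₀) =O[l] Y :=
  ((Asymptotics.IsLittleO.isBigO h).add ((Asymptotics.isBigO_refl Y l).const_mul_left x₁)).congr_left
    fun i => by ring

theorem tendsto (h : HasExpansion l Y X X₀ x₁) (hY : Tendsto Y l (𝓝 0)) : Tendsto X l (𝓝 X₀) := by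
  have := (h.isBigO.trans_tendsto hY).add_const X₀
  simpa using this

theorem mul (h : HasExpansion l Y X X₀ x₁) (k : HasExpansion l Y Z Z₀ z₁)
    (hY : Tendsto Y l (𝓝 0)) :
    HasExpansion l Y (fun i => X i * Z i) (X₀ * Z₀) (x₁ * Z₀ + X₀ * z₁) := by
  have hZ := k.tendsto hY
  have h1 : (fun i => (X i - X₀ - x₁ * Y i) * Z i) =o[l] fun i => Y i * 1 :=
    Asymptotics.IsLittleO.mul_isBigO h (hZ.isBigO_one ℝ)
  have h2 : (fun i => Y i * (Z i - Z₀)) =o[l] fun i => Y i * 1 := by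
    refine (Asymptotics.isBigO_refl Y l).mul_isLittleO ?_
    rw [Asymptotics.isLittleO_one_iff]
    simpa using hZ.sub_const Z₀
  simp only [mul_one] at h1 h2
  exact ((h1.add (Asymptotics.IsLittleO.const_mul_left k X₀)).add
    (h2.const_mul_left x₁)).congr_left fun i => by ring

theorem comp {g : ℝ → ℝ} {g' : ℝ} (h : HasExpansion l Y X X₀ x₁) (hg : HasDerivAt g g' X₀)
    (hY : Tendsto Y l (𝓝 0)) : HasExpansion l Y (fun i => g (X i)) (g X₀) (g' * x₁) := by
  have h1 := (hg.isLittleO.comp_tendsto (h.tendsto hY)).trans_isBigO h.isBigO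
  refine (h1.add (Asymptotics.IsLittleO.const_mul_left h g')).congr_left fun i => ?_
  simp only [Function.comp, smul_eq_mul]
  ring

theorem of_tendsto (hY : ∀ i, Y i ≠ 0)
    (h : Tendsto (fun i => (X i - X₀) / Y i) l (𝓝 x₁)) : HasExpansion l Y X X₀ x₁ := by
  rw [HasExpansion, Asymptotics.isLittleO_iff_tendsto' (Eventually.of_forall fun i hi => absurd hi (hY i))]
  have := h.sub_const x₁
  rw [sub_self] at this
  refine this.congr fun i => ?_
  have := hY i
  field_simp

theorem tendsto_div (hY : ∀ i, Y i ≠ 0) (h : HasExpansion l Y X X₀ x₁) :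
    Tendsto (fun i => (X i - X₀) / Y i) l (𝓝 x₁) := by
  rw [HasExpansion, Asymptotics.isLittleO_iff_tendsto' (Eventually.of_forall fun i hi => absurd hi (hY i))] at h
  have := h.add_const x₁
  rw [zero_add] at this
  refine this.congr fun i => ?_
  have := hY i
  field_simp
  ring

end HasExpansion

theorem tendsto_exp_mul_tsum_int_sub {E : Type*} [NormedAddCommGroup E] [NormedSpace ℝ E] [CompleteSpace E]
    {h : ℝ → ℤ → E} {C : ℝ} {a b : E} (hC : ∀ x ≥ 1, ∀ k, ‖h x k‖ ≤ C * Real.exp (-(x * |(k:ℝ)|)))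
    (ha : Tendsto (fun x => Real.exp x • h x 1) atTop (𝓝 a))
    (hb : Tendsto (fun x => Real.exp x • h x (-1)) atTop (𝓝 b)) :
    Tendsto (fun x => Real.exp x • (∑' k, h x k - h x 0)) atTop (𝓝 (a + b)) := by
  have hC0 : 0 ≤ C := by
    have := (norm_nonneg _).trans (hC 1 le_rfl 0)
    simpa using this
  set g : ℝ → ℤ → E := fun x k => if k = 0 then 0 else Real.exp x • h x k with hg
  set G : ℤ → E := fun k => if k = 1 then a else if k = -1 then b else 0 with hG
  have hbound : ∀ x ≥ (1:ℝ), ∀ k, ‖g x k‖ ≤ C * Real.exp 1 * Real.exp (-(1 * |(k:ℝ)|)) := by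
    intro x hx k
    by_cases hk : k = 0
    · simp only [hg, hk, if_true, norm_zero]
      positivity
    · simp only [hg, hk, if_false, norm_smul, Real.norm_eq_abs, Real.abs_exp]
      have h1 : (1:ℝ) ≤ |(k:ℝ)| := by exact_mod_cast Int.one_le_abs hk
      calc Real.exp x * ‖h x k‖ ≤ Real.exp x * (C * Real.exp (-(x * |(k:ℝ)|))) := by
            gcongr
            exact hC x hx k
        _ = C * Real.exp (x -(x * |(k:ℝ)|)) := by
            rw [sub_eq_add_neg, Real.exp_add]
            ring
        _ ≤ C * Real.exp (1 + -(1 * |(k:ℝ)|)) := by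
            gcongr
            nlinarith
        _ = _ := by
            rw [Real.exp_add]
            ring
  have hsum : Summable fun k : ℤ => C * Real.exp 1 * Real.exp (-(1 * |(k:ℝ)|)) :=
    (summable_exp_neg_abs one_pos).mul_left _
  have hlim : ∀ k, Tendsto (fun x => g x k) atTop (𝓝 (G k)) := by
    intro k
    by_cases hk : k = 0
    · simp [hg, hG, hk]
    by_cases h1 : k = 1
    · simpa [hg, hG, h1] using ha
    by_cases h2 : k = -1
    · simpa [hg, hG, h2] using hb
    simp only [hg, hG, hk, h1, h2, if_false]
    have hk2 : (2:ℝ) ≤ |(k:ℝ)| := by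
      have : 2 ≤ |k| := by
        rcases abs_cases k with h | h <;> omega
      exact_mod_cast this
    refine squeeze_zero_norm' (a := fun x => C * Real.exp (-x)) ?_ ?_
    · filter_upwards [eventually_ge_atTop 1] with x hx
      rw [norm_smul, Real.norm_eq_abs, Real.abs_exp]
      calc Real.exp x * ‖h x k‖ ≤ Real.exp x * (C * Real.exp (-(x * |(k:ℝ)|))) := by
            gcongr
            exact hC x hx k
        _ = C * Real.exp (x -(x * |(k:ℝ)|)) := by
            rw [sub_eq_add_neg, Real.exp_add]
            ring
        _ ≤ C * Real.exp (-x) := by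
            gcongr
            nlinarith
    · simpa using Real.tendsto_exp_neg_atTop_nhds_zero.const_mul C
  have main := tendsto_tsum_of_dominated_convergence hsum hlim
    ((eventually_ge_atTop 1).mono fun x hx k => hbound x hx k)
  have hGs : ∑' k, G k = a + b := by
    rw [tsum_eq_sum (s := {1, -1}), Finset.sum_pair (by norm_num)]
    · simp [hG]
    · intro k hk
      simp only [Finset.mem_insert, Finset.mem_singleton, not_or] at hk
      simp [hG, hk.1, hk.2]
  rw [hGs] at main
  refine main.congr' ?_
  filter_upwards [eventually_ge_atTop 1] with x hx
  have hs : Summable (h x) := by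
    refine Summable.of_norm_bounded ((summable_exp_neg_abs (δ := x) (by linarith)).mul_left C) (hC x hx)
  rw [hs.tsum_eq_add_tsum_ite 0, add_sub_cancel_left]
  have e : ∀ k, g x k = Real.exp x • (if k = 0 then 0 else h x k) := fun k => by
    simp only [hg, smul_ite, smul_zero]
  rw [tsum_congr e]
  refine Summable.tsum_const_smul _ (hs.congr_cofinite ?_)
  refine (eventually_cofinite_ne 0).mono fun k hk => ?_
  simp [hk]

theorem tendsto_thetaThree :
    Tendsto (fun x => Real.exp x * (thetaThree x - 1)) atTop (𝓝 2) := by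
  have := tendsto_exp_mul_tsum_int_sub (h := fun x (n:ℤ) => Real.exp (-x * n^2)) (C := 1) (a := 1) (b := 1)
    (fun x hx k => ?_) ?_ ?_
  · simpa [thetaThree, one_add_one_eq_two] using this
  · rw [Real.norm_eq_abs, Real.abs_exp, one_mul, Real.exp_le_exp]
    have : |(k:ℝ)| ≤ (k:ℝ)^2 := by
      have : |k| ≤ k^2 := by
        rw [← sq_abs]
        exact Int.le_self_sq _
      exact_mod_cast this
    nlinarith
  · simp [← Real.exp_add]
  · simp [← Real.exp_add]

theorem tendsto_thetaFour :
    Tendsto (fun x => Real.exp x * (thetaFour x - 1)) atTop (𝓝 (-2)) := by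
  have := tendsto_exp_mul_tsum_int_sub (h := fun x (n:ℤ) => (-1)^n * Real.exp (-x * n^2)) (C := 1)
    (a := -1) (b := -1) (fun x hx k => ?_) ?_ ?_
  · norm_num [thetaFour] at this ⊢
    exact this
  · rw [norm_mul, norm_zpow, norm_neg, norm_one, one_zpow, one_mul, Real.norm_eq_abs, Real.abs_exp, one_mul,
      Real.exp_le_exp]
    have : |(k:ℝ)| ≤ (k:ℝ)^2 := by
      have : |k| ≤ k^2 := by
        rw [← sq_abs]
        exact Int.le_self_sq _
      exact_mod_cast this
    nlinarith
  · simp [← Real.exp_add]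
  · simp [← Real.exp_add]

/-- The fourth power of the quotient of theta constants. -/
noncomputable def thetaQuot (x : ℝ) : ℝ := (thetaFour x / thetaThree x)^4

theorem hasExpansion_thetaQuot :
    HasExpansion atTop (fun x => Real.exp (-x)) thetaQuot 1 (-16) := by
  have hY : Tendsto (fun x => Real.exp (-x)) atTop (𝓝 0) := Real.tendsto_exp_neg_atTop_nhds_zero
  have hne : ∀ x : ℝ, Real.exp (-x) ≠ 0 := fun x => (Real.exp_pos _).ne'
  have h3 : HasExpansion atTop (fun x => Real.exp (-x)) thetaThree 1 2 := by
    refine .of_tendsto hne (tendsto_thetaThree.congr fun x => ?_)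
    rw [Real.exp_neg, div_inv_eq_mul, mul_comm]
  have h4 : HasExpansion atTop (fun x => Real.exp (-x)) thetaFour 1 (-2) := by
    refine .of_tendsto hne (tendsto_thetaFour.congr fun x => ?_)
    rw [Real.exp_neg, div_inv_eq_mul, mul_comm]
  have h := (h4.mul (h3.comp (hasDerivAt_inv one_ne_zero) hY) hY).comp (hasDerivAt_pow 4 _) hY
  convert h using 1
  · ext x
    rw [thetaQuot, div_eq_mul_inv]
  · norm_num
  · norm_num

theorem continuousOn_thetaThree : ContinuousOn thetaThree (Set.Ioi 0) := by
  intro x hx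
  have hx : 0 < x := hx
  have h : ContinuousOn thetaThree (Set.Ioi (x/2)) := by
    refine continuousOn_tsum (fun n => by fun_prop) (summable_thetaThree (x := x/2) (by linarith)) ?_
    intro n y hy
    have hy : x / 2 < y := hy
    rw [Real.norm_eq_abs, Real.abs_exp, Real.exp_le_exp]
    nlinarith [sq_nonneg (n:ℝ)]
  exact (h.continuousAt (Ioi_mem_nhds (by linarith))).continuousWithinAt

theorem continuousOn_thetaFour : ContinuousOn thetaFour (Set.Ioi 0) := by
  intro x hx
  have hx : 0 < x := hx
  have h : ContinuousOn thetaFour (Set.Ioi (x/2)) := by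
    refine continuousOn_tsum (fun n => by fun_prop) (summable_thetaThree (x := x/2) (by linarith)) ?_
    intro n y hy
    have hy : x / 2 < y := hy
    rw [norm_mul, norm_zpow, norm_neg, norm_one, one_zpow, one_mul, Real.norm_eq_abs, Real.abs_exp,
      Real.exp_le_exp]
    nlinarith [sq_nonneg (n:ℝ)]
  exact (h.continuousAt (Ioi_mem_nhds (by linarith))).continuousWithinAt

theorem continuousOn_thetaQuot : ContinuousOn thetaQuot (Set.Ioi 0) :=
  (continuousOn_thetaFour.div continuousOn_thetaThree fun _ hx => (thetaThree_pos hx).ne').pow 4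

theorem thetaQuot_eq {ε : ℝ} (hε : 0 < ε) : thetaQuot (Real.pi^2/(2*ε)) = 16 * kernelT ε^2 := by
  rw [kernelT_eq hε, thetaQuot]
  ring

theorem nhdsWithin_one_le_map_thetaQuot : 𝓝[<] 1 ≤ map thetaQuot atTop := by
  have hlt : ∀ x > 0, thetaQuot x < 1 := by
    intro x hx
    have hε : 0 < Real.pi^2/(2*x) := by positivity
    have := thetaQuot_eq hε
    rw [show Real.pi^2/(2*(Real.pi^2/(2*x))) = x by field_simp] at this
    rw [this]
    nlinarith [kernelT_lt hε, kernelT_pos hε]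
  have hlim : Tendsto thetaQuot atTop (𝓝 1) :=
    hasExpansion_thetaQuot.tendsto Real.tendsto_exp_neg_atTop_nhds_zero
  intro U hU
  rw [mem_map, mem_atTop_sets] at hU
  obtain ⟨M, hM⟩ := hU
  set N := max M 1 with hN
  have hN0 : 0 < N := lt_of_lt_of_le one_pos (le_max_right _ _)
  rw [mem_nhdsLT_iff_exists_Ico_subset]
  refine ⟨thetaQuot N, hlt N hN0, fun r hr => ?_⟩
  obtain ⟨P, hPr, hPN⟩ := ((hlim.eventually (lt_mem_nhds hr.2)).and (eventually_ge_atTop N)).exists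
  obtain ⟨y, hy, rfl⟩ := intermediate_value_Icc hPN (continuousOn_thetaQuot.mono fun z hz => lt_of_lt_of_le hN0 hz.1)
    ⟨hr.1, hPr.le⟩
  exact hM y ((le_max_left _ _).trans hy.1)

theorem betaIntegral_eq_integral_sigmoid (u v : ℂ) :
    Complex.betaIntegral u v = ∫ w : ℝ, (Real.sigmoid w : ℂ)^u * (Real.sigmoid (-w) : ℂ)^v := by
  rw [Complex.betaIntegral, intervalIntegral.integral_of_le zero_le_one,
    MeasureTheory.integral_Ioc_eq_integral_Ioo, ← Real.range_sigmoid, ← Set.image_univ,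
    MeasureTheory.integral_image_eq_integral_abs_deriv_smul MeasurableSet.univ
      (fun x _ => (Real.hasDerivAt_sigmoid x).hasDerivWithinAt) Real.sigmoid_injective.injOn,
    MeasureTheory.setIntegral_univ]
  congr 1
  ext w
  have h1 := Real.sigmoid_pos w
  have h2 := Real.sigmoid_pos (-w)
  have h1' : (Real.sigmoid w : ℂ) ≠ 0 := by exact_mod_cast h1.ne'
  have h2' : (Real.sigmoid (-w) : ℂ) ≠ 0 := by exact_mod_cast h2.ne'
  rw [← Real.sigmoid_neg, abs_of_pos (mul_pos h1 h2), ← Complex.ofReal_one, ← Complex.ofReal_sub,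
    ← Real.sigmoid_neg, Complex.ofReal_one, Complex.cpow_sub _ _ h1', Complex.cpow_sub _ _ h2', Complex.cpow_one,
    Complex.cpow_one, Complex.real_smul]
  push_cast
  field_simp

theorem sigmoid_cpow_mul (a b τ w : ℝ) :
    (Real.sigmoid w : ℂ)^(a - Complex.I * τ) * (Real.sigmoid (-w) : ℂ)^(b + Complex.I * τ) =
      Complex.exp (-Complex.I * τ * w) * ((Real.sigmoid w ^ a * Real.sigmoid (-w) ^ b : ℝ) : ℂ) := by
  have h1 := Real.sigmoid_pos w
  have h2 := Real.sigmoid_pos (-w)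
  have h1' : (Real.sigmoid w : ℂ) ≠ 0 := by exact_mod_cast h1.ne'
  have h2' : (Real.sigmoid (-w) : ℂ) ≠ 0 := by exact_mod_cast h2.ne'
  have hl : Real.log (Real.sigmoid (-w)) = Real.log (Real.sigmoid w) - w := by
    rw [← Real.sigmoid_mul_rexp_neg, Real.log_mul h1.ne' (Real.exp_pos _).ne', Real.log_exp]
    ring
  rw [Complex.cpow_def_of_ne_zero h1', Complex.cpow_def_of_ne_zero h2', ← Complex.ofReal_log h1.le,
    ← Complex.ofReal_log h2.le, Real.rpow_def_of_pos h1, Real.rpow_def_of_pos h2, hl]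
  push_cast
  rw [← Complex.exp_add, ← Complex.exp_add, ← Complex.exp_add]
  congr 1
  ring

theorem integral_sigmoid_rpow {a b : ℝ} (ha : 0 < a) (hb : 0 < b) (τ : ℝ) :
    ∫ w : ℝ, Complex.exp (-Complex.I * τ * w) * ((Real.sigmoid w ^ a * Real.sigmoid (-w) ^ b : ℝ) : ℂ) =
      Complex.Gamma (a - Complex.I * τ) * Complex.Gamma (b + Complex.I * τ) / Complex.Gamma (a + b) := by
  have h := Complex.betaIntegral_eq_Gamma_mul_div (a - Complex.I * τ) (b + Complex.I * τ) (by simpa) (by simpa)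
  rw [betaIntegral_eq_integral_sigmoid] at h
  simp_rw [sigmoid_cpow_mul] at h
  rw [h]
  ring_nf

theorem sigmoid_rpow_mul_le {a b c : ℝ} (hc : 0 ≤ c) (hca : c ≤ a) (hcb : c ≤ b) (w : ℝ) :
    Real.sigmoid w ^ a * Real.sigmoid (-w) ^ b ≤ Real.exp (-(c * |w|)) := by
  have key : ∀ {a b : ℝ}, c ≤ a → c ≤ b → ∀ w ≥ 0, Real.sigmoid w ^ a * Real.sigmoid (-w) ^ b ≤ Real.exp (-(c * |w|)) := by
    intro a b hca hcb w hw
    have h1 := Real.sigmoid_pos w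
    have h2 := Real.sigmoid_pos (-w)
    calc Real.sigmoid w ^ a * Real.sigmoid (-w) ^ b ≤ 1 * Real.sigmoid (-w) ^ c := by
          exact mul_le_mul (Real.rpow_le_one h1.le (Real.sigmoid_le_one w) (hc.trans hca))
            (Real.rpow_le_rpow_of_exponent_ge h2 (Real.sigmoid_le_one _) hcb) (by positivity) zero_le_one
      _ ≤ Real.exp (-w) ^ c := by
          rw [one_mul, ← Real.sigmoid_mul_rexp_neg]
          gcongr
          exact mul_le_of_le_one_left (Real.exp_pos _).le (Real.sigmoid_le_one w)
      _ = _ := by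
          rw [← Real.exp_mul, abs_of_nonneg hw]
          ring_nf
  rcases le_total 0 w with hw | hw
  · exact key hca hcb w hw
  · have := key hcb hca (-w) (by linarith)
    rw [neg_neg, abs_neg] at this
    linarith

/-- The lattice sum of powers of the logistic function. -/
noncomputable def logisticSum (a b β : ℝ) : ℝ :=
  ∑' n : ℤ, Real.sigmoid (β * n) ^ a * Real.sigmoid (-(β * n)) ^ b

theorem logisticSum_eq {a b β : ℝ} (ha : 0 < a) (hb : 0 < b) (hβ : 0 < β)
    (hs : Summable fun k : ℤ => Complex.Gamma (a - Complex.I * (2 * Real.pi * k / β : ℝ)) *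
      Complex.Gamma (b + Complex.I * (2 * Real.pi * k / β : ℝ)) / Complex.Gamma (a + b)) :
    ((β * logisticSum a b β : ℝ) : ℂ) = ∑' k : ℤ, Complex.Gamma (a - Complex.I * (2 * Real.pi * k / β : ℝ)) *
      Complex.Gamma (b + Complex.I * (2 * Real.pi * k / β : ℝ)) / Complex.Gamma (a + b) := by
  set f : ℝ → ℂ := fun x => ((Real.sigmoid (β * x) ^ a * Real.sigmoid (-(β * x)) ^ b : ℝ) : ℂ) with hf
  have hc : Continuous f := by
    refine Complex.continuous_ofReal.comp ?_
    refine Continuous.mul ?_ ?_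
    · exact (continuous_sigmoid.comp (by fun_prop)).rpow_const fun x => Or.inl (Real.sigmoid_pos _).ne'
    · exact (continuous_sigmoid.comp (by fun_prop)).rpow_const fun x => Or.inl (Real.sigmoid_pos _).ne'
  have hO : f =O[cocompact ℝ] fun x : ℝ => |x| ^ (-2 : ℝ) := by
    have h1 : f =O[cocompact ℝ] fun x : ℝ => Real.exp (-(min a b * β) * |x|) := by
      refine Asymptotics.isBigO_of_le _ fun x => ?_
      rw [Complex.norm_real, Real.norm_of_nonneg (by have := Real.sigmoid_pos (β*x); have := Real.sigmoid_pos (-(β*x)); positivity),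
        Real.norm_of_nonneg (Real.exp_pos _).le]
      refine (sigmoid_rpow_mul_le (lt_min ha hb).le (min_le_left _ _) (min_le_right _ _) _).trans_eq ?_
      rw [abs_mul, abs_of_pos hβ]
      ring_nf
    have h2 := (isLittleO_exp_neg_mul_rpow_atTop (a := min a b * β) (mul_pos (lt_min ha hb) hβ) (-2)).isBigO
    exact h1.trans (h2.comp_tendsto (tendsto_norm_cocompact_atTop (E := ℝ)))
  have hF : ∀ k : ℤ, FourierTransform.fourier f (k:ℝ) = (β : ℂ)⁻¹ * (Complex.Gamma (a - Complex.I * (2 * Real.pi * k / β : ℝ)) *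
      Complex.Gamma (b + Complex.I * (2 * Real.pi * k / β : ℝ)) / Complex.Gamma (a + b)) := by
    intro k
    rw [← integral_sigmoid_rpow ha hb, Real.fourier_real_eq_integral_exp_smul]
    have := MeasureTheory.Measure.integral_comp_mul_left (fun w : ℝ => Complex.exp (-Complex.I * (2 * Real.pi * k / β : ℝ) * w) *
      ((Real.sigmoid w ^ a * Real.sigmoid (-w) ^ b : ℝ) : ℂ)) β
    rw [abs_of_pos (inv_pos.2 hβ), Complex.real_smul, Complex.ofReal_inv] at this
    rw [← this]
    congr 1
    ext x
    rw [smul_eq_mul]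
    congr 2
    have : (β:ℂ) ≠ 0 := by exact_mod_cast hβ.ne'
    push_cast
    field_simp
  have hP := Real.tsum_eq_tsum_fourier_of_rpow_decay_of_summable hc one_lt_two hO
    ((hs.mul_left (β:ℂ)⁻¹).congr fun k => (hF k).symm) 0
  have e : ∀ k : ℤ, FourierTransform.fourier f (k:ℝ) * fourier k ((0:ℝ) : UnitAddCircle) = (β : ℂ)⁻¹ * (Complex.Gamma (a - Complex.I * (2 * Real.pi * k / β : ℝ)) *
      Complex.Gamma (b + Complex.I * (2 * Real.pi * k / β : ℝ)) / Complex.Gamma (a + b)) := by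
    intro k
    rw [hF]
    simp
  rw [tsum_congr e, tsum_mul_left] at hP
  have hβ' : (β:ℂ) ≠ 0 := by exact_mod_cast hβ.ne'
  rw [Complex.ofReal_mul, logisticSum, Complex.ofReal_tsum, eq_comm, ← inv_mul_eq_iff_eq_mul₀ hβ', ← hP]
  exact tsum_congr fun n => by rw [zero_add]

theorem sin_mul_cosh_le_norm_sin {θ : ℝ} (y : ℝ) :
    Real.sin θ * Real.cosh y ≤ ‖Complex.sin (θ - Complex.I * y)‖ := by
  have : (Complex.sin (θ - Complex.I * y)).re = Real.sin θ * Real.cosh y := by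
    rw [Complex.sin_sub, mul_comm Complex.I, Complex.cos_mul_I, Complex.sin_mul_I, ← Complex.ofReal_sin,
      ← Complex.ofReal_cos, ← Complex.ofReal_cosh, ← Complex.ofReal_sinh]
    simp only [Complex.sub_re, Complex.mul_re, Complex.mul_im, Complex.ofReal_re, Complex.ofReal_im, Complex.I_re,
      Complex.I_im]
    ring
  rw [← this]
  exact Complex.re_le_norm _

theorem norm_inv_sin_le {θ : ℝ} (h : 0 < Real.sin θ) (y : ℝ) :
    ‖(Complex.sin (θ - Complex.I * y))⁻¹‖ ≤ 2 / Real.sin θ * Real.exp (-|y|) := by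
  have h1 := sin_mul_cosh_le_norm_sin (θ := θ) y
  have h2 := Real.exp_abs_le_two_mul_cosh y
  have h3 := Real.exp_pos |y|
  rw [norm_inv, Real.exp_neg, inv_le_iff_one_le_mul₀ (lt_of_lt_of_le (by have := Real.cosh_pos y; positivity) h1)]
  calc (1:ℝ) = 2 / Real.sin θ * (Real.exp |y|)⁻¹ * (Real.sin θ * (Real.exp |y| / 2)) := by field_simp
    _ ≤ _ := by
      gcongr
      exact (mul_le_mul_of_nonneg_left (by linarith) h.le).trans h1

theorem tendsto_exp_smul_inv_sin (θ : ℝ) :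
    Tendsto (fun x : ℝ => Real.exp x • (Complex.sin (θ - Complex.I * x))⁻¹) atTop
      (𝓝 (2 * Complex.I * Complex.exp (-(θ * Complex.I)))) := by
  have h0 : Tendsto (fun x : ℝ => (Real.exp (-(2*x)) : ℂ)) atTop (𝓝 0) := by
    rw [← Complex.ofReal_zero]
    refine (Complex.continuous_ofReal.tendsto _).comp (Real.tendsto_exp_neg_atTop_nhds_zero.comp ?_)
    exact tendsto_id.const_mul_atTop two_pos
  have h1 : Tendsto (fun x : ℝ => (Complex.exp (-(θ * Complex.I)) * (Real.exp (-(2*x)) : ℂ) - Complex.exp (θ * Complex.I)) *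
      Complex.I / 2) atTop (𝓝 ((Complex.exp (-(θ * Complex.I)) * 0 - Complex.exp (θ * Complex.I)) * Complex.I / 2)) :=
    (((h0.const_mul _).sub_const _).mul_const _).div_const _
  have h2 := h1.inv₀ (by simp [Complex.exp_ne_zero])
  convert h2 using 1
  · ext x
    rw [Complex.real_smul, Complex.sin, ← inv_inv ((Real.exp x : ℝ) : ℂ), ← mul_inv, ← Complex.ofReal_inv,
      ← Real.exp_neg]
    congr 1
    rw [← mul_div_assoc, ← mul_assoc, mul_sub]
    congr 3
    · push_cast
      rw [← Complex.exp_add, ← Complex.exp_add]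
      congr 1
      ring_nf
      rw [Complex.I_sq]
      ring
    · push_cast
      rw [← Complex.exp_add]
      congr 1
      ring_nf
      rw [Complex.I_sq]
      ring
  · congr 1
    rw [Complex.exp_neg]
    have := Complex.exp_ne_zero (θ * Complex.I)
    field_simp
    ring_nf
    rw [Complex.I_sq]
    ring

theorem tendsto_tsum_inv_sin {θ : ℝ} (h : 0 < Real.sin θ) :
    Tendsto (fun x : ℝ => Real.exp x • (∑' k : ℤ, (Complex.sin (θ - Complex.I * (k * x : ℝ)))⁻¹ -
      ((Real.sin θ)⁻¹ : ℝ))) atTop (𝓝 ((4 * Real.sin θ : ℝ) : ℂ)) := by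
  have := tendsto_exp_mul_tsum_int_sub (h := fun x (k : ℤ) => (Complex.sin (θ - Complex.I * (k * x : ℝ)))⁻¹)
    (C := 2 / Real.sin θ) (a := 2 * Complex.I * Complex.exp (-(θ * Complex.I)))
    (b := -(2 * Complex.I * Complex.exp (θ * Complex.I))) (fun x hx k => ?_) ?_ ?_
  · convert this using 3
    · simp
    · push_cast
      rw [Complex.sin]
      ring_nf
  · refine (norm_inv_sin_le h _).trans_eq ?_
    rw [abs_mul, abs_of_pos (by linarith : 0 < x), mul_comm x]
  · simpa using tendsto_exp_smul_inv_sin θ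
  · have := (tendsto_exp_smul_inv_sin (-θ)).neg
    convert this using 2
    · rw [← smul_neg, ← inv_neg, ← Complex.sin_neg]
      push_cast
      ring_nf
    · push_cast
      ring_nf

theorem logisticSum_one_sub_eq {a x : ℝ} (ha : 0 < a) (ha1 : a < 1) (hx : 0 < x) :
    (((2 * Real.pi^2 / x) * logisticSum a (1 - a) (2 * Real.pi^2 / x) : ℝ) : ℂ) =
      Real.pi * ∑' k : ℤ, (Complex.sin ((Real.pi * a : ℝ) - Complex.I * (k * x : ℝ)))⁻¹ := by
  have hβ : 0 < 2 * Real.pi^2 / x := by positivity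
  have hs : 0 < Real.sin (Real.pi * a) :=
    Real.sin_pos_of_pos_of_lt_pi (by positivity) (by nlinarith [Real.pi_pos])
  have e : ∀ k : ℤ, Complex.Gamma (a - Complex.I * (2 * Real.pi * k / (2 * Real.pi^2 / x) : ℝ)) *
      Complex.Gamma ((1 - a : ℝ) + Complex.I * (2 * Real.pi * k / (2 * Real.pi^2 / x) : ℝ)) / Complex.Gamma (a + (1 - a : ℝ)) =
      Real.pi * (Complex.sin ((Real.pi * a : ℝ) - Complex.I * (k * x : ℝ)))⁻¹ := fun k => by
    have := Complex.Gamma_mul_Gamma_one_sub (a - Complex.I * (2 * Real.pi * k / (2 * Real.pi^2 / x) : ℝ))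
    rw [← div_eq_mul_inv, show ((1 - a : ℝ):ℂ) + Complex.I * (2 * Real.pi * k / (2 * Real.pi^2 / x) : ℝ) =
      1 - (a - Complex.I * (2 * Real.pi * k / (2 * Real.pi^2 / x) : ℝ)) by push_cast; ring, this,
      show (a + (1 - a : ℝ) : ℂ) = 1 by push_cast; ring, Complex.Gamma_one, div_one]
    congr 2
    have : (Real.pi : ℂ) ≠ 0 := by exact_mod_cast Real.pi_ne_zero
    push_cast
    field_simp
  have hsum : Summable fun k : ℤ => (Real.pi : ℂ) * (Complex.sin ((Real.pi * a : ℝ) - Complex.I * (k * x : ℝ)))⁻¹ := by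
    refine Summable.mul_left _ (Summable.of_norm_bounded ((summable_exp_neg_abs hx).mul_left (2 / Real.sin (Real.pi * a)))
      fun k => (norm_inv_sin_le hs _).trans_eq ?_)
    rw [abs_mul, abs_of_pos hx, mul_comm x]
  rw [logisticSum_eq ha (by linarith) hβ (hsum.congr fun k => (e k).symm), tsum_congr e, tsum_mul_left]

theorem tendsto_logisticSum_one_sub {a : ℝ} (ha : 0 < a) (ha1 : a < 1) :
    Tendsto (fun x => Real.exp x * ((2 * Real.pi^2 / x) * logisticSum a (1 - a) (2 * Real.pi^2 / x) -
      Real.pi / Real.sin (Real.pi * a))) atTop (𝓝 (4 * Real.pi * Real.sin (Real.pi * a))) := by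
  have hs : 0 < Real.sin (Real.pi * a) :=
    Real.sin_pos_of_pos_of_lt_pi (by positivity) (by nlinarith [Real.pi_pos])
  have h := (tendsto_tsum_inv_sin hs).const_mul (Real.pi : ℂ)
  have h2 := (Complex.continuous_re.tendsto _).comp h
  rw [show ((Real.pi : ℂ) * ((4 * Real.sin (Real.pi * a) : ℝ) : ℂ)).re = 4 * Real.pi * Real.sin (Real.pi * a) by
    rw [← Complex.ofReal_mul, Complex.ofReal_re]; ring] at h2
  refine h2.congr' ?_
  filter_upwards [eventually_gt_atTop 0] with x hx
  have h3 := logisticSum_one_sub_eq ha ha1 hx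
  simp only [Function.comp]
  rw [Complex.real_smul, mul_left_comm, mul_sub, ← h3, ← Complex.ofReal_mul, ← Complex.ofReal_sub, ← Complex.ofReal_mul,
    Complex.ofReal_re, div_eq_mul_inv Real.pi]

theorem div_sinh_le (y : ℝ) : |y / Real.sinh y| ≤ 2 * Real.exp (-(|y| / 2)) := by
  rw [abs_div]
  have key : ∀ y > 0, y / Real.sinh y ≤ 2 * Real.exp (-(y / 2)) := fun y hy => by
    have h1 : y / 2 ≤ Real.sinh (y / 2) := Real.self_le_sinh_iff.2 (by linarith)
    have h2 := Real.exp_abs_le_two_mul_cosh (y / 2)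
    rw [abs_of_pos (by linarith)] at h2
    have h3 : Real.sinh y = 2 * Real.sinh (y/2) * Real.cosh (y/2) := by
      rw [← Real.sinh_two_mul]
      ring_nf
    rw [div_le_iff₀ (Real.sinh_pos_iff.2 hy), h3, Real.exp_neg]
    have h4 := Real.exp_pos (y/2)
    generalize Real.exp (y/2) = E at *
    field_simp
    nlinarith
  rcases lt_trichotomy y 0 with hy | rfl | hy
  · have := key (-y) (by linarith)
    rw [Real.sinh_neg] at this
    rwa [abs_of_neg hy, abs_of_neg (Real.sinh_neg_iff.2 hy)]
  · simp
  · rw [abs_of_pos hy, abs_of_pos (Real.sinh_pos_iff.2 hy)]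
    exact key y hy

theorem tendsto_exp_mul_div_sinh : Tendsto (fun x => Real.exp x * (2 * x / Real.sinh (2 * x))) atTop (𝓝 0) := by
  have h := (Real.tendsto_pow_mul_exp_neg_atTop_nhds_zero 1).const_mul 8
  rw [mul_zero] at h
  refine squeeze_zero' ?_ ?_ h
  · filter_upwards [eventually_gt_atTop 0] with x hx
    have := Real.sinh_pos_iff.2 (by linarith : 0 < 2 * x)
    positivity
  · filter_upwards [eventually_ge_atTop 1] with x hx
    have h0 := Real.sinh_pos_iff.2 (by linarith : 0 < 2 * x)
    have h1 : Real.sinh (2*x) = (Real.exp x^2 - (Real.exp x)⁻¹^2)/2 := by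
      rw [Real.sinh_eq, ← Real.exp_neg, ← Real.exp_nat_mul, ← Real.exp_nat_mul]
      push_cast
      ring_nf
    have h2 : 2 ≤ Real.exp x := by linarith [Real.add_one_le_exp x]
    have h3 : (Real.exp x)⁻¹ ≤ 1 := inv_le_one_of_one_le₀ (by linarith)
    have h5 : 0 < (Real.exp x)⁻¹ := by positivity
    have h4 : Real.exp x^2 / 4 ≤ Real.sinh (2*x) := by
      rw [h1]
      nlinarith
    rw [Real.exp_neg, pow_one]
    calc Real.exp x * (2 * x / Real.sinh (2 * x)) ≤ Real.exp x * (2 * x / (Real.exp x^2 / 4)) := by gcongr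
      _ = _ := by
        generalize Real.exp x = E at *
        have : E ≠ 0 := by linarith
        field_simp
        norm_num

theorem tendsto_logisticSum_one_one :
    Tendsto (fun x => Real.exp x * ((Real.pi^2 / x) * logisticSum 1 1 (Real.pi^2 / x) - 1)) atTop (𝓝 0) := by
  set h : ℝ → ℤ → ℂ := fun x k => if k = 0 then 1 else ((2 * (k * x) / Real.sinh (2 * (k * x)) : ℝ) : ℂ) with hh
  have hC : ∀ x ≥ 0, ∀ k, ‖h x k‖ ≤ 2 * Real.exp (-(x * |(k:ℝ)|)) := fun x hx k => by
    by_cases hk : k = 0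
    · simp [hh, hk]
    · simp only [hh, hk, if_false, Complex.norm_real, Real.norm_eq_abs]
      refine (div_sinh_le _).trans_eq ?_
      rw [abs_mul, abs_mul, abs_two, abs_of_nonneg hx]
      ring_nf
  have hG : ∀ x > 0, ∀ k : ℤ, Complex.Gamma ((1:ℝ) - Complex.I * (2 * Real.pi * k / (Real.pi^2 / x) : ℝ)) *
      Complex.Gamma ((1 : ℝ) + Complex.I * (2 * Real.pi * k / (Real.pi^2 / x) : ℝ)) / Complex.Gamma ((1:ℝ) + (1 : ℝ)) =
      h x k := fun x hx k => by
    rw [Complex.ofReal_one, one_add_one_eq_two, Complex.Gamma_ofNat_eq_factorial]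
    by_cases hk : k = 0
    · simp [hh, hk]
    · have hk' : (k:ℂ) ≠ 0 := by exact_mod_cast hk
      have hp : (Real.pi:ℂ) ≠ 0 := by exact_mod_cast Real.pi_ne_zero
      have hx' : (x:ℂ) ≠ 0 := by exact_mod_cast hx.ne'
      simp only [hh, hk, if_false]
      have hz : Complex.I * (2 * Real.pi * k / (Real.pi^2 / x) : ℝ) ≠ 0 := by
        push_cast
        simp [hk', hp, hx', Complex.I_ne_zero]
      rw [add_comm (1:ℂ), Complex.Gamma_add_one _ hz, mul_comm, mul_assoc, Complex.Gamma_mul_Gamma_one_sub]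
      have e : (Real.pi:ℂ) * (Complex.I * (2 * Real.pi * k / (Real.pi^2 / x) : ℝ)) = ((2 * (k * x) : ℝ) : ℂ) * Complex.I := by
        push_cast
        field_simp
      have hsh : ((Real.sinh (2 * (k * x)) : ℝ) : ℂ) ≠ 0 := by
        rw [Complex.ofReal_ne_zero, Ne, Real.sinh_eq_zero]
        have : (k:ℝ) ≠ 0 := by exact_mod_cast hk
        positivity
      rw [e, Complex.sin_mul_I, ← Complex.ofReal_sinh, Complex.ofReal_div]
      generalize Real.sinh (2 * (k * x)) = S at *
      push_cast
      field_simp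
      try norm_num
  have hmain := tendsto_exp_mul_tsum_int_sub (h := h) (C := 2) (a := 0) (b := 0) (fun x hx k => hC x (by linarith) k) ?_ ?_
  · have h2 := (Complex.continuous_re.tendsto _).comp hmain
    simp only [add_zero, Complex.zero_re] at h2
    refine h2.congr' ?_
    filter_upwards [eventually_gt_atTop 0] with x hx
    have hs : Summable (h x) := Summable.of_norm_bounded ((summable_exp_neg_abs hx).mul_left 2) (hC x hx.le)
    have h3 := logisticSum_eq one_pos one_pos (β := Real.pi^2 / x) (by positivity) (hs.congr fun k => (hG x hx k).symm)
    rw [tsum_congr (hG x hx)] at h3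
    simp only [Function.comp]
    rw [← h3, Complex.real_smul, show h x 0 = (1:ℝ) by simp [hh], ← Complex.ofReal_sub, ← Complex.ofReal_mul, Complex.ofReal_re]
  · have := (Complex.continuous_ofReal.tendsto _).comp tendsto_exp_mul_div_sinh
    refine (this.congr fun x => ?_).trans_eq ?_
    · simp [hh]
    · simp
  · have := (Complex.continuous_ofReal.tendsto _).comp tendsto_exp_mul_div_sinh
    refine (this.congr fun x => ?_).trans_eq ?_
    · simp [hh]
    · simp

theorem sigmoid_two_mul (u : ℝ) : Real.sigmoid (2 * u) = Real.exp u / (2 * Real.cosh u) := by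
  have := Real.exp_pos u
  rw [Real.sigmoid_def, Real.cosh_eq, neg_mul_eq_mul_neg, two_mul (-u), Real.exp_add, Real.exp_neg]
  generalize Real.exp u = E at *
  field_simp

theorem sigmoid_rpow_mul_sigmoid_rpow (a b u : ℝ) :
    Real.sigmoid (2 * u) ^ a * Real.sigmoid (-(2 * u)) ^ b =
      Real.exp ((a - b) * u) / (2 * Real.cosh u) ^ (a + b) := by
  have h0 : 0 < 2 * Real.cosh u := by have := Real.cosh_pos u; positivity
  rw [neg_mul_eq_mul_neg, sigmoid_two_mul, sigmoid_two_mul, Real.cosh_neg, Real.div_rpow (Real.exp_pos _).le h0.le,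
    Real.div_rpow (Real.exp_pos _).le h0.le, ← Real.exp_mul, ← Real.exp_mul, div_mul_div_comm, ← Real.exp_add,
    ← Real.rpow_add h0]
  ring_nf

theorem hasSum_logisticSum {a b β : ℝ} (ha : 0 < a) (hb : 0 < b) (hβ : 0 < β) :
    HasSum (fun n : ℤ => Real.sigmoid (β * n) ^ a * Real.sigmoid (-(β * n)) ^ b) (logisticSum a b β) := by
  have hc := lt_min ha hb
  refine Summable.hasSum (Summable.of_norm_bounded (summable_exp_neg_abs (mul_pos hc hβ)) fun n => ?_)
  have h1 := Real.sigmoid_pos (β * n)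
  have h2 := Real.sigmoid_pos (-(β * n))
  rw [Real.norm_of_nonneg (by positivity)]
  refine (sigmoid_rpow_mul_le hc.le (min_le_left _ _) (min_le_right _ _) _).trans_eq ?_
  rw [abs_mul, abs_of_pos hβ, mul_assoc]

theorem hasSum_cosh_div_cosh {a b : ℝ} (ha : 0 < a) (ha1 : a < 1) (hb : 0 < b) :
    HasSum (fun n : ℤ => Real.cosh ((2 * a - 1) * (n * b)) / Real.cosh (n * b)) (2 * logisticSum a (1 - a) (2 * b)) := by
  have h := hasSum_logisticSum ha (by linarith : 0 < 1 - a) (by linarith : 0 < 2 * b)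
  have h' := h.add ((Equiv.neg ℤ).hasSum_iff.2 h)
  rw [← two_mul] at h'
  refine h'.congr_fun fun n => ?_
  have h0 := Real.cosh_pos (n * b)
  simp only [Function.comp, Equiv.neg_apply]
  rw [mul_assoc 2 b, mul_assoc 2 b, sigmoid_rpow_mul_sigmoid_rpow, sigmoid_rpow_mul_sigmoid_rpow, add_sub_cancel,
    Real.rpow_one, Real.rpow_one, Int.cast_neg, mul_neg, Real.cosh_neg, mul_comm b, Real.cosh_eq]
  field_simp
  ring_nf

theorem hasSum_inv_cosh {b : ℝ} (hb : 0 < b) :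
    HasSum (fun n : ℤ => (Real.cosh (n * b))⁻¹) (2 * logisticSum (1/2) (1 - 1/2) (2 * b)) := by
  refine (hasSum_cosh_div_cosh (a := 1/2) (by norm_num) (by norm_num) hb).congr_fun fun n => ?_
  norm_num

theorem hasSum_inv_cosh_sq {b : ℝ} (hb : 0 < b) :
    HasSum (fun n : ℤ => (Real.cosh (n * b) ^ 2)⁻¹) (4 * logisticSum 1 1 (2 * b)) := by
  refine ((hasSum_logisticSum one_pos one_pos (by linarith : 0 < 2 * b)).mul_left 4).congr_fun fun n => ?_
  have h0 := Real.cosh_pos (n * b)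
  rw [mul_assoc 2 b, sigmoid_rpow_mul_sigmoid_rpow, one_add_one_eq_two, Real.rpow_two, mul_comm b]
  simp
  field_simp
  norm_num

theorem tsum_inv_cosh_mul_two {b : ℝ} (hb : 0 < b) :
    ∑' n : ℤ, (Real.cosh (n * b))⁻¹ * (Real.cosh (n * (2 * b)))⁻¹ =
      4 * logisticSum (3/4) (1 - 3/4) (2 * (2 * b)) - 2 * logisticSum (1/2) (1 - 1/2) (2 * b) := by
  have h1 := (hasSum_cosh_div_cosh (a := 3/4) (by norm_num) (by norm_num) (by linarith : 0 < 2 * b)).mul_left 2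
  have h2 := h1.sub (hasSum_inv_cosh hb)
  rw [← mul_assoc, show (2:ℝ) * 2 = 4 by norm_num] at h2
  refine HasSum.tsum_eq (h2.congr_fun fun n => ?_)
  have h3 : Real.cosh (n * (2 * b)) = 2 * Real.cosh (n * b)^2 - 1 := by
    rw [show (n:ℝ) * (2 * b) = 2 * (n * b) by ring, Real.cosh_two_mul, Real.sinh_sq]
    ring
  have h4 := Real.cosh_pos (n * (2 * b))
  have h5 := Real.cosh_pos (n * b)
  rw [show (2 * (3/4) - 1) * ((n:ℝ) * (2 * b)) = n * b by ring]
  generalize Real.cosh (n * (2 * b)) = D at *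
  generalize Real.cosh (n * b) = E at *
  field_simp
  linear_combination h3

theorem tsum_inv_cosh_mul_three {b : ℝ} (hb : 0 < b) :
    ∑' n : ℤ, (Real.cosh (n * b))⁻¹ * (Real.cosh (n * (3 * b)))⁻¹ =
      1 / 3 * (8 * logisticSum (2/3) (1 - 2/3) (2 * (3 * b)) - 4 * logisticSum 1 1 (2 * b)) := by
  have h1 := (hasSum_cosh_div_cosh (a := 2/3) (by norm_num) (by norm_num) (by linarith : 0 < 3 * b)).mul_left 4
  have h2 := (h1.sub (hasSum_inv_cosh_sq hb)).mul_left (1/3)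
  rw [← mul_assoc 4, show (4:ℝ) * 2 = 8 by norm_num] at h2
  refine HasSum.tsum_eq (h2.congr_fun fun n => ?_)
  have h3 : Real.cosh (n * (3 * b)) = 4 * Real.cosh (n * b)^3 - 3 * Real.cosh (n * b) := by
    rw [show (n:ℝ) * (3 * b) = 3 * (n * b) by ring, Real.cosh_three_mul]
  have h4 := Real.cosh_pos (n * (3 * b))
  have h5 := Real.cosh_pos (n * b)
  rw [show (2 * (2/3) - 1) * ((n:ℝ) * (3 * b)) = n * b by ring]
  generalize Real.cosh (n * (3 * b)) = D at *
  generalize Real.cosh (n * b) = E at *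
  field_simp
  linear_combination h3

theorem HasExpansion.of_tendsto_exp {X : ℝ → ℝ} {X₀ c ℓ : ℝ} (hc : 2 / 3 < c)
    (h : Tendsto (fun x => Real.exp (c * x) * (X x - X₀)) atTop (𝓝 ℓ)) :
    HasExpansion atTop (fun x => Real.exp (-(2 / 3 * x))) X X₀ 0 := by
  refine .of_tendsto (fun x => (Real.exp_pos _).ne') ?_
  have h1 : Tendsto (fun x => Real.exp (-((c - 2/3) * x))) atTop (𝓝 0) :=
    Real.tendsto_exp_neg_atTop_nhds_zero.comp (tendsto_id.const_mul_atTop (by linarith))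
  have h2 := h1.mul h
  rw [zero_mul] at h2
  refine h2.congr fun x => ?_
  rw [← mul_assoc, ← Real.exp_add, Real.exp_neg (2 / 3 * x), div_inv_eq_mul, mul_comm]
  ring_nf

theorem hasExpansion_logisticSum {a c : ℝ} (ha : 0 < a) (ha1 : a < 1) (hc : 2 / 3 < c) :
    HasExpansion atTop (fun x => Real.exp (-(2 / 3 * x)))
      (fun x => (2 * Real.pi^2 / (c * x)) * logisticSum a (1 - a) (2 * Real.pi^2 / (c * x)))
      (Real.pi / Real.sin (Real.pi * a)) 0 :=
  .of_tendsto_exp hc ((tendsto_logisticSum_one_sub ha ha1).comp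
    (tendsto_id.const_mul_atTop (by linarith : 0 < c)))

theorem hasExpansion_logisticSum_two_thirds :
    HasExpansion atTop (fun x => Real.exp (-(2 / 3 * x)))
      (fun x => (2 * Real.pi^2 / (2 / 3 * x)) * logisticSum (2/3) (1 - 2/3) (2 * Real.pi^2 / (2 / 3 * x)))
      (Real.pi / Real.sin (Real.pi * (2/3))) (4 * Real.pi * Real.sin (Real.pi * (2/3))) := by
  have h := (tendsto_logisticSum_one_sub (a := 2/3) (by norm_num) (by norm_num)).comp
    (tendsto_id.const_mul_atTop (by norm_num : (0:ℝ) < 2 / 3))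
  refine .of_tendsto (fun x => (Real.exp_pos _).ne') (h.congr fun x => ?_)
  simp only [Function.comp, id]
  rw [Real.exp_neg, div_inv_eq_mul, mul_comm]

theorem hasExpansion_logisticSum_one_one :
    HasExpansion atTop (fun x => Real.exp (-(2 / 3 * x)))
      (fun x => (Real.pi^2 / x) * logisticSum 1 1 (Real.pi^2 / x)) 1 0 := by
  refine .of_tendsto_exp (c := 1) (by norm_num) (by simpa using tendsto_logisticSum_one_one)

theorem hasExpansion_den :
    HasExpansion atTop (fun x => Real.exp (-(2 / 3 * x)))
      (fun x => Real.pi^2/(2*x) * (∑' n:ℤ, (Real.cosh (n*(2*(Real.pi^2/(2*x)))))⁻¹ -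
        ∑' n:ℤ, (Real.cosh (n*(Real.pi^2/(2*x))))⁻¹*(Real.cosh (n*(2*(Real.pi^2/(2*x)))))⁻¹))
      (Real.pi / 2 * (3 - 2 * √2)) 0 := by
  have h1 := (hasExpansion_logisticSum (a := 1/2) (c := 1) (by norm_num) (by norm_num) (by norm_num)).const_mul (1/2)
  have h2 := (hasExpansion_logisticSum (a := 3/4) (c := 1) (by norm_num) (by norm_num) (by norm_num))
  have h3 := (hasExpansion_logisticSum (a := 1/2) (c := 2) (by norm_num) (by norm_num) (by norm_num))
  have h := ((h1.sub h2).add h3).congr (Z := fun x => Real.pi^2/(2*x) * (∑' n:ℤ, (Real.cosh (n*(2*(Real.pi^2/(2*x)))))⁻¹ -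
        ∑' n:ℤ, (Real.cosh (n*(Real.pi^2/(2*x))))⁻¹*(Real.cosh (n*(2*(Real.pi^2/(2*x)))))⁻¹)) ?_
  · convert h using 1
    · have s1 : Real.sin (Real.pi * (3/4)) = √2/2 := by
        rw [show Real.pi * (3/4) = Real.pi - Real.pi / 4 by ring, Real.sin_pi_sub, Real.sin_pi_div_four]
      have s2 : Real.sin (Real.pi * (1/2)) = 1 := by
        rw [mul_one_div, Real.sin_pi_div_two]
      have h5 : √2 * √2 = 2 := Real.mul_self_sqrt (by norm_num)
      have h6 : 0 < √2 := by positivity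
      rw [s1, s2]
      field_simp
      linear_combination (-2:ℝ) * h5
    · ring
  · filter_upwards [eventually_gt_atTop 0] with x hx
    have hε : 0 < Real.pi^2/(2*x) := by positivity
    rw [(hasSum_inv_cosh (by linarith : 0 < 2 * (Real.pi^2/(2*x)))).tsum_eq, tsum_inv_cosh_mul_two hε,
      show 2 * Real.pi^2 / (1 * x) = 2 * (2 * (Real.pi^2/(2*x))) by field_simp,
      show 2 * Real.pi^2 / (2 * x) = 2 * (Real.pi^2/(2*x)) by ring]
    ring

theorem hasExpansion_num :
    ∃ B₀, HasExpansion atTop (fun x => Real.exp (-(2 / 3 * x)))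
      (fun x => Real.pi^2/(2*x) * (∑' n:ℤ, (Real.cosh (n*(2*(Real.pi^2/(2*x)))))⁻¹ -
        ∑' n:ℤ, (Real.cosh (n*(Real.pi^2/(2*x))))⁻¹*(Real.cosh (n*(3*(Real.pi^2/(2*x)))))⁻¹))
      B₀ (-(8 * Real.pi * √3 / 9)) := by
  have h1 := (hasExpansion_logisticSum (a := 1/2) (c := 1) (by norm_num) (by norm_num) (by norm_num)).const_mul (1/2)
  have h2 := hasExpansion_logisticSum_two_thirds.const_mul (-(4/9))
  have h3 := hasExpansion_logisticSum_one_one.const_mul (2/3)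
  have h := ((h1.add h2).add h3).congr (Z := fun x => Real.pi^2/(2*x) * (∑' n:ℤ, (Real.cosh (n*(2*(Real.pi^2/(2*x)))))⁻¹ -
        ∑' n:ℤ, (Real.cosh (n*(Real.pi^2/(2*x))))⁻¹*(Real.cosh (n*(3*(Real.pi^2/(2*x)))))⁻¹)) ?_
  · have s1 : Real.sin (Real.pi * (2/3)) = √3/2 := by
      rw [show Real.pi * (2/3) = Real.pi - Real.pi / 3 by ring, Real.sin_pi_sub, Real.sin_pi_div_three]
    have e : -(8 * Real.pi * √3 / 9) = 1 / 2 * 0 + -(4 / 9) * (4 * Real.pi * Real.sin (Real.pi * (2 / 3))) +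
        2 / 3 * 0 := by
      rw [s1]
      ring
    rw [e]
    exact ⟨_, h⟩
  · filter_upwards [eventually_gt_atTop 0] with x hx
    have hε : 0 < Real.pi^2/(2*x) := by positivity
    rw [(hasSum_inv_cosh (by linarith : 0 < 2 * (Real.pi^2/(2*x)))).tsum_eq, tsum_inv_cosh_mul_three hε,
      show 2 * Real.pi^2 / (1 * x) = 2 * (2 * (Real.pi^2/(2*x))) by field_simp,
      show 2 * Real.pi^2 / (2 / 3 * x) = 2 * (3 * (Real.pi^2/(2*x))) by field_simp,
      show Real.pi^2 / x = 2 * (Real.pi^2/(2*x)) by field_simp]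
    ring

/-- The normalised number of excursions of length `2n`. -/
noncomputable def excursionProb (n : ℕ) : ℝ := coneWalks (2 * n) 1 0 / 16^n

theorem KernelParam.hasSum_excursionProb {ε t : ℝ} {w J : ℂ → ℂ} (h : KernelParam ε t w J) (ht : 0 < t) :
    HasSum (fun n => excursionProb n * (16 * t^2)^n) (lineSum (innerWeight ε) w ε / t) := by
  have h1 := h.hasSum_lineSum.div_const t
  have h2 : HasSum (fun n => t^n * coneWalks n 1 0) (lineSum (innerWeight ε) w ε / t) :=
    h1.congr_fun fun n => by
      field_simp
      ring
  have h3 : Function.Injective fun n : ℕ => 2 * n := mul_right_injective₀ two_ne_zero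
  have h4 := (h3.hasSum_iff (f := fun n => t^n * coneWalks n 1 0) fun n hn => ?_).2 h2
  · refine h4.congr_fun fun n => ?_
    simp only [Function.comp, excursionProb]
    rw [mul_pow, ← pow_mul]
    field_simp
  · have : n % 2 = 1 := by
      by_contra h5
      exact hn ⟨n / 2, by simp only; omega⟩
    rw [coneWalks_parity, mul_zero]
    omega

theorem tsum_excursionProb_hasExpansion : ∃ G₀,
    HasExpansion atTop (fun x => Real.exp (-(2 / 3 * x))) (fun x => ∑' n, excursionProb n * thetaQuot x^n) G₀
      (-(64 * √3 / 9)) := by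
  have hY : Tendsto (fun x => Real.exp (-(2 / 3 * x))) atTop (𝓝 0) :=
    Real.tendsto_exp_neg_atTop_nhds_zero.comp (tendsto_id.const_mul_atTop (by norm_num))
  obtain ⟨B₀, hB⟩ := hasExpansion_num
  have hs2 : √2 < 3 / 2 := by
    rw [Real.sqrt_lt' (by norm_num)]
    norm_num
  have hA0 : Real.pi / 2 * (3 - 2 * √2) ≠ 0 := by
    have := Real.pi_pos
    have : 0 < 3 - 2 * √2 := by linarith
    positivity
  have hA := hasExpansion_den
  have hAi := hA.comp (hasDerivAt_inv hA0) hY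
  have hQ : HasExpansion atTop (fun x => Real.exp (-(2 / 3 * x))) thetaQuot 1 0 := by
    refine .of_tendsto_exp (c := 1) (by norm_num) (ℓ := -16) ?_
    refine (hasExpansion_thetaQuot.tendsto_div fun x => (Real.exp_pos _).ne').congr fun x => ?_
    rw [Real.exp_neg, div_inv_eq_mul, mul_comm, one_mul]
  have ht := (hQ.comp (Real.hasDerivAt_sqrt one_ne_zero) hY).const_mul (1/4)
  rw [Real.sqrt_one] at ht
  have hti := ht.comp (hasDerivAt_inv (by norm_num)) hY
  have hφ : DifferentiableAt ℝ (fun y : ℝ => ((y + 2) - √((y + 2)^2 - 4)) / 2) (1/4 * 1)⁻¹ := by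
    refine ((DifferentiableAt.sub (by fun_prop) (DifferentiableAt.sqrt (by fun_prop) ?_)).div_const 2)
    norm_num
  have hv := hti.comp hφ.hasDerivAt hY
  have hL := (((hv.mul hB hY).mul hAi hY).mul hti hY)
  have hs8 : √((((1/4 * 1 : ℝ))⁻¹ + 2)^2 - 4) = 4 * √2 := by
    rw [show (((1/4 * 1 : ℝ))⁻¹ + 2)^2 - 4 = 4^2 * 2 by norm_num, Real.sqrt_mul (by norm_num), Real.sqrt_sq (by norm_num)]
  simp only [hs8, mul_zero] at hL
  have hfin := hL.congr (Z := fun x => ∑' n, excursionProb n * thetaQuot x^n) ?_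
  · have h32 : 3 - 2 * √2 ≠ 0 := by linarith
    have e : -(64 * √3 / 9) = (((0 * B₀ + ((1 / 4 * 1)⁻¹ + 2 - 4 * √2) / 2 * -(8 * Real.pi * √3 / 9)) *
        (Real.pi / 2 * (3 - 2 * √2))⁻¹ + 0) * (1 / 4 * 1)⁻¹ + 0) := by
      rw [show ((1 / 4 * 1 : ℝ)⁻¹ + 2 - 4 * √2) / 2 = 3 - 2 * √2 by norm_num; ring]
      generalize 3 - 2 * √2 = r at *
      field_simp
      ring
    rw [e]
    exact ⟨_, hfin⟩
  · filter_upwards [eventually_gt_atTop 0, (hA.tendsto hY).eventually_ne hA0] with x hx hAx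
    have hε : 0 < Real.pi^2/(2*x) := by positivity
    have hK := kernelParam hε (kernelT_lt hε)
    have htp := kernelT_pos hε
    have hq := thetaQuot_eq hε
    rw [show Real.pi^2/(2*(Real.pi^2/(2*x))) = x by field_simp] at hq
    have hsq : √(thetaQuot x) = 4 * kernelT (Real.pi^2/(2*x)) := by
      rw [hq, show 16 * kernelT (Real.pi^2/(2*x))^2 = (4 * kernelT (Real.pi^2/(2*x)))^2 by ring,
        Real.sqrt_sq (by positivity)]
    rw [hq, (hK.hasSum_excursionProb htp).tsum_eq, ← hq, hsq]
    have hm := hK.mid_kernel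
    have hm1 := hK.mid_lt_one
    have hm0 := hK.pos_mid
    have hL' := hK.lineSum_mul_eq
    generalize kernelT (Real.pi^2/(2*x)) = t at *
    generalize Real.pi^2/(2*x) = ε at *
    rw [show 1 / 4 * (4 * t) = t by ring]
    generalize (kernelW ε ε).re = v at *
    have hφv : (t⁻¹ + 2 - √((t⁻¹ + 2)^2 - 4)) / 2 = v := by
      have hv1 : 1 ≤ v⁻¹ := (one_le_inv₀ hm0).2 hm1.le
      rw [← one_div, ← hm, show (v + v⁻¹)^2 - 4 = (v⁻¹ - v)^2 by field_simp; ring, Real.sqrt_sq (by linarith)]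
      ring
    rw [hφv, mul_left_comm, ← hL', ← mul_assoc]
    generalize (∑' n : ℤ, (Real.cosh (n * (2*ε)))⁻¹ - ∑' n : ℤ, (Real.cosh (n * ε))⁻¹ * (Real.cosh (n * (2*ε)))⁻¹) = A at *
    have hA' := right_ne_zero_of_mul hAx
    field_simp

theorem tendsto_tsum_excursionProb : ∃ G₀,
    Tendsto (fun s : ℝ => (G₀ - ∑' n, excursionProb n * s^n) / (1 - s)^(2/3 : ℝ)) (𝓝[<] 1)
      (𝓝 (64 * √3 / 9 / 16^(2/3 : ℝ))) := by
  obtain ⟨G₀, hG⟩ := tsum_excursionProb_hasExpansion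
  refine ⟨G₀, Tendsto.mono_left ?_ nhdsWithin_one_le_map_thetaQuot⟩
  rw [tendsto_map'_iff]
  have h1 := (hG.tendsto_div fun x => (Real.exp_pos _).ne').neg
  have h2 := (hasExpansion_thetaQuot.tendsto_div fun x => (Real.exp_pos _).ne').neg
  rw [neg_neg] at h1 h2
  have h3 := h2.rpow_const (p := (2/3 : ℝ)) (Or.inl (by norm_num))
  refine (h1.div h3 (by positivity)).congr' ?_
  filter_upwards [h2.eventually (lt_mem_nhds (show (0:ℝ) < 16 by norm_num))] with x hx
  have hE := Real.exp_pos (-x)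
  have h4 : 0 ≤ 1 - thetaQuot x := by
    rw [← neg_div, neg_sub] at hx
    exact ((div_pos_iff_of_pos_right hE).1 hx).le
  simp only [Function.comp, Pi.div_apply]
  rw [← neg_div, ← neg_div, neg_sub, neg_sub, Real.div_rpow h4 hE.le, ← Real.exp_mul,
    show -x * (2/3) = -(2/3 * x) by ring, div_div_div_cancel_right₀ (Real.exp_pos _).ne']

theorem tendsto_tsum_mul_of_tendsto_moments {w y : ℕ → ℕ → ℝ} {ρ : ℝ → ℝ}
    (hw : ∀ n k, 0 ≤ w n k) (hy : ∀ n k, y n k ∈ Set.Icc (0:ℝ) 1) (hs : ∀ᶠ n in atTop, Summable (w n))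
    (hρ0 : ∀ x ∈ Set.Ioi (0:ℝ), 0 ≤ ρ x) (hρ : MeasureTheory.IntegrableOn ρ (Set.Ioi 0))
    (hm : ∀ j : ℕ, Tendsto (fun n => ∑' k, w n k * y n k ^ j) atTop
      (𝓝 (∫ x in Set.Ioi 0, ρ x * Real.exp (-x)^j)))
    {g : ℝ → ℝ} (hg : Continuous g) :
    Tendsto (fun n => ∑' k, w n k * g (y n k)) atTop (𝓝 (∫ x in Set.Ioi 0, ρ x * g (Real.exp (-x)))) := by
  have hmem : ∀ x ∈ Set.Ioi (0:ℝ), Real.exp (-x) ∈ Set.Icc (0:ℝ) 1 := fun x hx =>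
    ⟨(Real.exp_pos _).le, Real.exp_le_one_iff.2 (by simpa using (Set.mem_Ioi.1 hx).le)⟩
  have hbd : ∀ f : ℝ → ℝ, Continuous f → ∃ C, ∀ u ∈ Set.Icc (0:ℝ) 1, |f u| ≤ C := fun f hf =>
    (isCompact_Icc.exists_bound_of_continuousOn hf.continuousOn)
  have hsum : ∀ f : ℝ → ℝ, Continuous f → ∀ᶠ n in atTop, Summable fun k => w n k * f (y n k) := by
    intro f hf
    obtain ⟨C, hC⟩ := hbd f hf
    filter_upwards [hs] with n hn
    refine Summable.of_norm_bounded (hn.mul_right C) fun k => ?_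
    rw [norm_mul, Real.norm_of_nonneg (hw n k)]
    exact mul_le_mul_of_nonneg_left (hC _ (hy n k)) (hw n k)
  have hint : ∀ f : ℝ → ℝ, Continuous f →
      MeasureTheory.IntegrableOn (fun x => ρ x * f (Real.exp (-x))) (Set.Ioi 0) := by
    intro f hf
    obtain ⟨C, hC⟩ := hbd f hf
    refine MeasureTheory.Integrable.mul_bdd (c := C) hρ (by fun_prop) ?_
    filter_upwards [MeasureTheory.ae_restrict_mem measurableSet_Ioi] with x hx
    exact hC _ (hmem x hx)
  have hpoly : ∀ p : Polynomial ℝ, Tendsto (fun n => ∑' k, w n k * p.eval (y n k)) atTop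
      (𝓝 (∫ x in Set.Ioi 0, ρ x * p.eval (Real.exp (-x)))) := by
    intro p
    induction p using Polynomial.induction_on' with
    | add p q hp hq =>
      simp only [Polynomial.eval_add, mul_add]
      rw [MeasureTheory.integral_add (hint _ p.continuous) (hint _ q.continuous)]
      refine (hp.add hq).congr' ?_
      filter_upwards [hsum _ p.continuous, hsum _ q.continuous] with n h1 h2
      exact (h1.tsum_add h2).symm
    | monomial j c =>
      simp only [Polynomial.eval_monomial, mul_left_comm _ c, tsum_mul_left, MeasureTheory.integral_const_mul]
      exact (hm j).const_mul c
  have h1 : Tendsto (fun n => ∑' k, w n k) atTop (𝓝 (∫ x in Set.Ioi 0, ρ x)) := by simpa using hm 0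
  set I := ∫ x in Set.Ioi 0, ρ x
  have hI0 : 0 ≤ I := MeasureTheory.setIntegral_nonneg measurableSet_Ioi hρ0
  rw [Metric.tendsto_nhds]
  intro ε hε
  set δ := ε / (3 * (I + 1)) with hδ
  have hδ0 : 0 < δ := by positivity
  obtain ⟨p, hp⟩ := exists_polynomial_near_of_continuousOn 0 1 g hg.continuousOn δ hδ0
  have hIδ : ‖(∫ x in Set.Ioi 0, ρ x * p.eval (Real.exp (-x))) - ∫ x in Set.Ioi 0, ρ x * g (Real.exp (-x))‖
      ≤ δ * I := by
    rw [← MeasureTheory.integral_sub (hint _ p.continuous) (hint _ hg), ← MeasureTheory.integral_const_mul]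
    refine MeasureTheory.norm_integral_le_of_norm_le (hρ.const_mul δ) ?_
    filter_upwards [MeasureTheory.ae_restrict_mem measurableSet_Ioi] with x hx
    rw [← mul_sub, norm_mul, Real.norm_of_nonneg (hρ0 x hx), mul_comm]
    exact mul_le_mul_of_nonneg_right (hp _ (hmem x hx)).le (hρ0 x hx)
  filter_upwards [hs, hsum g hg, hsum _ p.continuous, h1.eventually (gt_mem_nhds (lt_add_one I)),
    Metric.tendsto_nhds.1 (hpoly p) (ε/3) (by positivity)] with n hn hgn hpn hIn hpε
  have hnδ : ‖∑' k, w n k * g (y n k) - ∑' k, w n k * p.eval (y n k)‖ ≤ δ * ∑' k, w n k := by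
    rw [← hgn.tsum_sub hpn, ← tsum_mul_left]
    refine tsum_of_norm_bounded (hn.mul_left δ).hasSum fun k => ?_
    rw [← mul_sub, norm_mul, Real.norm_of_nonneg (hw n k), mul_comm]
    refine mul_le_mul_of_nonneg_right ?_ (hw n k)
    rw [norm_sub_rev]
    exact (hp _ (hy n k)).le
  have e1 : δ * (I + 1) = ε / 3 := by rw [hδ]; field_simp
  have e2 : δ * ∑' k, w n k ≤ δ * (I + 1) := mul_le_mul_of_nonneg_left hIn.le hδ0.le
  have e3 : δ * I ≤ δ * (I + 1) := by nlinarith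
  rw [Real.dist_eq] at hpε ⊢
  rw [Real.norm_eq_abs] at hnδ hIδ
  have t1 := abs_sub_le (∑' k, w n k * g (y n k)) (∑' k, w n k * p.eval (y n k))
    (∫ x in Set.Ioi 0, ρ x * g (Real.exp (-x)))
  have t2 := abs_sub_le (∑' k, w n k * p.eval (y n k)) (∫ x in Set.Ioi 0, ρ x * p.eval (Real.exp (-x)))
    (∫ x in Set.Ioi 0, ρ x * g (Real.exp (-x)))
  linarith

theorem exp_neg_sub_exp_neg_le {b c x : ℝ} : Real.exp (-(b*x)) - Real.exp (-(c*x)) ≤ (c - b) * x * Real.exp (-(b*x)) := by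
  have h : Real.exp (-(c*x)) = Real.exp (-(b*x)) * Real.exp (-((c-b)*x)) := by
    rw [← Real.exp_add]; ring_nf
  have h2 := Real.add_one_le_exp (-((c-b)*x))
  nlinarith [Real.exp_pos (-(b*x))]

theorem integrableOn_rpow_mul_exp_neg_mul {p b : ℝ} (hp : -1 < p) (hb : 0 < b) :
    MeasureTheory.IntegrableOn (fun x : ℝ => x^p * Real.exp (-(b*x))) (Set.Ioi 0) := by
  simpa using integrableOn_rpow_mul_exp_neg_mul_rpow hp one_pos hb

theorem integrableOn_rpow_mul_exp_sub {α b c : ℝ} (hα1 : α < 1) (hb : 0 < b) (hbc : b < c) :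
    MeasureTheory.IntegrableOn (fun x : ℝ => x^(-α-1) * (Real.exp (-(b*x)) - Real.exp (-(c*x)))) (Set.Ioi 0) := by
  refine MeasureTheory.Integrable.mono' ((integrableOn_rpow_mul_exp_neg_mul (p := -α) (by linarith) hb).const_mul (c-b))
    (by fun_prop) ?_
  filter_upwards [MeasureTheory.ae_restrict_mem measurableSet_Ioi] with x hx
  have hx : 0 < x := hx
  have h1 : Real.exp (-(c*x)) ≤ Real.exp (-(b*x)) := Real.exp_le_exp.2 (by nlinarith)
  have h2 := exp_neg_sub_exp_neg_le (b := b) (c := c) (x := x)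
  have h3 : 0 < x^(-α-1) := Real.rpow_pos_of_pos hx _
  rw [Real.norm_of_nonneg (mul_nonneg h3.le (by linarith))]
  have h4 : x^(-α) = x^(-α-1) * x := by
    rw [← Real.rpow_add_one hx.ne']; ring_nf
  rw [h4]
  nlinarith [mul_le_mul_of_nonneg_left h2 h3.le]

theorem integral_rpow_mul_exp_sub {α b c : ℝ} (hα0 : 0 < α) (hα1 : α < 1) (hb : 0 < b) (hbc : b < c) :
    ∫ x in Set.Ioi (0:ℝ), x^(-α-1) * (Real.exp (-(b*x)) - Real.exp (-(c*x))) =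
      Real.Gamma (1 - α) / α * (c^α - b^α) := by
  have hc := hb.trans hbc
  have hib := integrableOn_rpow_mul_exp_neg_mul (p := -α) (by linarith) hb
  have hic := integrableOn_rpow_mul_exp_neg_mul (p := -α) (by linarith) hc
  have hi := integrableOn_rpow_mul_exp_sub hα1 hb hbc
  have hg : ∀ r : ℝ, 0 < r → r * ∫ x in Set.Ioi (0:ℝ), x^(-α) * Real.exp (-(r*x)) = r^α * Real.Gamma (1-α) := by
    intro r hr
    have h := Real.integral_rpow_mul_exp_neg_mul_Ioi (a := 1 - α) (r := r) (by linarith) hr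
    rw [show 1 - α - 1 = -α by ring] at h
    rw [h, ← mul_assoc, one_div, Real.inv_rpow hr.le, ← Real.rpow_neg hr.le]
    congr 1
    nth_rw 1 [← Real.rpow_one r]
    rw [← Real.rpow_add hr]; ring_nf
  have hbound : ∀ x : ℝ, 0 < x → ‖x^(-α) * (Real.exp (-(b*x)) - Real.exp (-(c*x)))‖
      ≤ (c-b) * (x^(1-α) * Real.exp (-(b*x))) := by
    intro x hx
    have h1 : Real.exp (-(c*x)) ≤ Real.exp (-(b*x)) := Real.exp_le_exp.2 (by nlinarith)
    have h2 := exp_neg_sub_exp_neg_le (b := b) (c := c) (x := x)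
    have h3 : 0 < x^(-α) := Real.rpow_pos_of_pos hx _
    rw [Real.norm_of_nonneg (mul_nonneg h3.le (by linarith))]
    have h4 : x^(1-α) = x^(-α) * x := by
      rw [← Real.rpow_add_one hx.ne']; ring_nf
    rw [h4]
    nlinarith [mul_le_mul_of_nonneg_left h2 h3.le]
  have key := MeasureTheory.integral_Ioi_of_hasDerivAt_of_tendsto (a := 0) (m := 0)
    (f := fun x => x^(-α) * (Real.exp (-(b*x)) - Real.exp (-(c*x))))
    (f' := fun x => (-α) * (x^(-α-1) * (Real.exp (-(b*x)) - Real.exp (-(c*x)))) +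
      (c * (x^(-α) * Real.exp (-(c*x))) - b * (x^(-α) * Real.exp (-(b*x))))) ?_ ?_ ?_ ?_
  · have hd : MeasureTheory.IntegrableOn
        (fun x => c * (x^(-α) * Real.exp (-(c*x))) - b * (x^(-α) * Real.exp (-(b*x)))) (Set.Ioi 0) :=
      (hic.const_mul c).sub (hib.const_mul b)
    rw [MeasureTheory.integral_add (hi.const_mul _) hd,
      MeasureTheory.integral_sub (hic.const_mul c) (hib.const_mul b)] at key
    simp only [MeasureTheory.integral_const_mul] at key
    rw [hg b hb, hg c hc] at key
    simp only [mul_zero, sub_self] at key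
    generalize (∫ x in Set.Ioi (0:ℝ), x^(-α-1) * (Real.exp (-(b*x)) - Real.exp (-(c*x)))) = I at *
    field_simp
    linarith
  · rw [ContinuousWithinAt, mul_zero, mul_zero, sub_self, mul_zero]
    refine squeeze_zero_norm' (a := fun x => (c-b) * (x^(1-α) * Real.exp (-(b*x)))) ?_ ?_
    · filter_upwards [self_mem_nhdsWithin] with x hx
      rcases (Set.mem_Ici.1 hx).eq_or_lt with rfl | hx
      · simp [Real.zero_rpow (show 1 - α ≠ 0 by linarith)]
      · exact hbound x hx
    · have : ContinuousAt (fun x : ℝ => (c-b) * (x^(1-α) * Real.exp (-(b*x)))) 0 := by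
        refine continuousAt_const.mul ((Real.continuousAt_rpow_const _ _ (Or.inr (by linarith))).mul (by fun_prop))
      simpa [ContinuousAt, Real.zero_rpow (show 1 - α ≠ 0 by linarith)] using this.tendsto.mono_left nhdsWithin_le_nhds
  · intro x hx
    have hx : 0 < x := hx
    have h1 := Real.hasDerivAt_rpow_const (x := x) (p := -α) (Or.inl hx.ne')
    have h2 : ∀ r : ℝ, HasDerivAt (fun x => Real.exp (-(r*x))) (Real.exp (-(r*x)) * (-(r*1))) x := fun r =>
      (((hasDerivAt_id x).const_mul r).neg).exp
    refine (h1.mul ((h2 b).sub (h2 c))).congr_deriv ?_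
    simp only [Pi.sub_apply]
    ring
  · exact (hi.const_mul _).add ((hic.const_mul c).sub (hib.const_mul b))
  · refine squeeze_zero_norm' (a := fun x => (c-b) * (x^(1-α) * Real.exp (-b*x))) ?_ ?_
    · filter_upwards [eventually_gt_atTop 0] with x hx
      simpa using hbound x hx
    · simpa using (tendsto_rpow_mul_exp_neg_mul_atTop_nhds_zero (1-α) b hb).const_mul (c-b)

theorem tendsto_mul_one_sub_exp_neg_div (r : ℝ) :
    Tendsto (fun n : ℕ => (n:ℝ) * (1 - Real.exp (-(r/n)))) atTop (𝓝 r) := by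
  have h : HasDerivAt (fun x : ℝ => -Real.exp (-(r*x))) r 0 := by
    refine (((hasDerivAt_id (0:ℝ)).const_mul r).fun_neg).exp.fun_neg.congr_deriv ?_
    simp
  rw [hasDerivAt_iff_tendsto_slope_zero] at h
  have h2 : Tendsto (fun n : ℕ => ((n:ℝ))⁻¹) atTop (𝓝[≠] 0) :=
    tendsto_nhdsWithin_iff.2 ⟨tendsto_inv_atTop_nhds_zero_nat, by
      filter_upwards [eventually_gt_atTop 0] with n hn
      simp [hn.ne']⟩
  refine (h.comp h2).congr fun n => ?_
  simp only [Function.comp, inv_inv, smul_eq_mul, zero_add, mul_zero, neg_zero, Real.exp_zero, div_eq_mul_inv]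
  ring

theorem tendsto_exp_neg_div {r : ℝ} (hr : 0 < r) :
    Tendsto (fun n : ℕ => Real.exp (-(r/n))) atTop (𝓝[<] 1) := by
  refine tendsto_nhdsWithin_iff.2 ⟨?_, ?_⟩
  · simpa using ((tendsto_const_div_atTop_nhds_zero_nat r).neg).rexp
  · filter_upwards [eventually_gt_atTop 0] with n hn
    have : 0 < r / n := by positivity
    simpa using this

theorem tendsto_rpow_mul_of_tendsto_div {F : ℝ → ℝ} {α κ : ℝ}
    (h : Tendsto (fun s => F s / (1 - s)^α) (𝓝[<] 1) (𝓝 κ)) {r : ℝ} (hr : 0 < r) :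
    Tendsto (fun n : ℕ => (n:ℝ)^α * F (Real.exp (-(r/n)))) atTop (𝓝 (κ * r^α)) := by
  refine ((h.comp (tendsto_exp_neg_div hr)).mul
    ((tendsto_mul_one_sub_exp_neg_div r).rpow_const (p := α) (Or.inl hr.ne'))).congr' ?_
  filter_upwards [eventually_gt_atTop 0] with n hn
  have h1 : 0 < r / n := by positivity
  have h2 : 0 < 1 - Real.exp (-(r/n)) := by simpa using h1
  have h3 := Real.rpow_pos_of_pos h2 α
  simp only [Function.comp]
  rw [Real.mul_rpow (by positivity) h2.le]
  field_simp

theorem exp_neg_div_mem (n k : ℕ) : Real.exp (-((k:ℝ)/n)) ∈ Set.Icc (0:ℝ) 1 := by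
  have : (0:ℝ) ≤ k / n := by positivity
  exact ⟨(Real.exp_pos _).le, by simpa using this⟩

theorem tendsto_riemann_exp {g : ℝ → ℝ} (hg : Continuous g) :
    Tendsto (fun n : ℕ => ∑' k : ℕ, (n:ℝ)⁻¹ * Real.exp (-((k:ℝ)/n)) * g (Real.exp (-((k:ℝ)/n)))) atTop
      (𝓝 (∫ x in Set.Ioi 0, Real.exp (-x) * g (Real.exp (-x)))) := by
  refine tendsto_tsum_mul_of_tendsto_moments (w := fun n k => (n:ℝ)⁻¹ * Real.exp (-((k:ℝ)/n)))
    (y := fun n k => Real.exp (-((k:ℝ)/n))) (ρ := fun x => Real.exp (-x))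
    (fun n k => by positivity) (fun n k => exp_neg_div_mem n k) ?_ (fun x _ => (Real.exp_pos _).le)
    (integrableOn_exp_neg_Ioi 0) (fun j => ?_) hg
  · filter_upwards [eventually_gt_atTop 0] with n hn
    have h1 : (0:ℝ) < 1 / n := by positivity
    refine Summable.mul_left _ ((summable_geometric_of_lt_one (Real.exp_pos (-(1/(n:ℝ)))).le (by simpa using h1)).congr fun k => ?_)
    rw [← Real.exp_nat_mul]; ring_nf
  · have hj : (0:ℝ) < j + 1 := by positivity
    have h1 : ∫ x in Set.Ioi (0:ℝ), Real.exp (-x) * Real.exp (-x)^j = 1/(j+1) := by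
      have h := Real.integral_rpow_mul_exp_neg_mul_Ioi (a := 1) (r := j + 1) one_pos hj
      simp only [sub_self, Real.rpow_zero, one_mul, Real.rpow_one, Real.Gamma_one, mul_one] at h
      rw [← h]
      congr 1; ext x
      rw [← pow_succ', ← Real.exp_nat_mul]; push_cast; ring_nf
    rw [h1, one_div]
    refine ((tendsto_mul_one_sub_exp_neg_div ((j:ℝ)+1)).inv₀ hj.ne').congr' ?_
    filter_upwards [eventually_gt_atTop 0] with n hn
    have h2 : (0:ℝ) < (j + 1) / n := by positivity
    rw [mul_inv, ← tsum_geometric_of_lt_one (Real.exp_pos (-(((j:ℝ)+1)/n))).le (by simpa using h2), ← tsum_mul_left]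
    congr 1; ext k
    rw [mul_assoc, ← pow_succ', ← Real.exp_nat_mul, ← Real.exp_nat_mul]; push_cast; ring_nf

theorem tendsto_tsum_mul_of_tendsto_one_sub_rpow {a : ℕ → ℝ} (ha0 : ∀ n, 0 ≤ a n) (ha : Antitone a) {α κ G₀ : ℝ}
    (hα0 : 0 < α) (hα1 : α < 1) (hκ : 0 ≤ κ)
    (h : Tendsto (fun s : ℝ => (G₀ - ∑' n, a n * s^n) / (1 - s)^α) (𝓝[<] 1) (𝓝 κ))
    {g : ℝ → ℝ} (hg : Continuous g) :
    Tendsto (fun n : ℕ => ∑' k : ℕ, (n:ℝ)^α * (a k * (Real.exp (-((k:ℝ)/n)) * (1 - Real.exp (-((k:ℝ)/n)))))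
        * g (Real.exp (-((k:ℝ)/n)))) atTop
      (𝓝 (∫ x in Set.Ioi 0, α * κ / Real.Gamma (1 - α) * (x^(-α-1) * (Real.exp (-(1*x)) - Real.exp (-(2*x)))) * g (Real.exp (-x)))) := by
  have hΓ := Real.Gamma_pos_of_pos (show 0 < 1 - α by linarith)
  have hsum : ∀ s : ℝ, 0 ≤ s → s < 1 → Summable fun n => a n * s^n := fun s h0 h1 =>
    ((summable_geometric_of_lt_one h0 h1).mul_left (a 0)).of_nonneg_of_le (fun n => mul_nonneg (ha0 n) (by positivity))
      fun n => mul_le_mul_of_nonneg_right (ha (Nat.zero_le n)) (by positivity)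
  have hpow : ∀ (n k j : ℕ), Real.exp (-((k:ℝ)/n)) ^ j = Real.exp (-((j:ℝ)/n))^k := fun n k j => by
    rw [← Real.exp_nat_mul, ← Real.exp_nat_mul]; ring_nf
  have hlt : ∀ n : ℕ, 0 < n → ∀ j : ℕ, 0 < j → Real.exp (-((j:ℝ)/n)) < 1 := fun n hn j hj => by
    have : (0:ℝ) < j / n := by positivity
    simpa using this
  have hterm : ∀ n k j : ℕ, (n:ℝ)^α * (a k * (Real.exp (-((k:ℝ)/n)) * (1 - Real.exp (-((k:ℝ)/n))))) * Real.exp (-((k:ℝ)/n))^j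
      = (n:ℝ)^α * (a k * Real.exp (-(((j+1:ℕ):ℝ)/n))^k - a k * Real.exp (-(((j+2:ℕ):ℝ)/n))^k) := fun n k j => by
    rw [← hpow n k (j+1), ← hpow n k (j+2)]; ring
  have hS : ∀ n : ℕ, 0 < n → ∀ j : ℕ, HasSum (fun k => (n:ℝ)^α * (a k * (Real.exp (-((k:ℝ)/n)) * (1 - Real.exp (-((k:ℝ)/n))))) * Real.exp (-((k:ℝ)/n))^j)
      ((n:ℝ)^α * ((∑' k, a k * Real.exp (-(((j+1:ℕ):ℝ)/n))^k) - ∑' k, a k * Real.exp (-(((j+2:ℕ):ℝ)/n))^k)) := fun n hn j => by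
    simp only [hterm]
    exact ((hsum _ (Real.exp_pos _).le (hlt n hn _ (by omega))).hasSum.sub
      (hsum _ (Real.exp_pos _).le (hlt n hn _ (by omega))).hasSum).mul_left _
  refine tendsto_tsum_mul_of_tendsto_moments
    (w := fun n k => (n:ℝ)^α * (a k * (Real.exp (-((k:ℝ)/n)) * (1 - Real.exp (-((k:ℝ)/n))))))
    (y := fun n k => Real.exp (-((k:ℝ)/n)))
    (ρ := fun x => α * κ / Real.Gamma (1 - α) * (x^(-α-1) * (Real.exp (-(1*x)) - Real.exp (-(2*x)))))
    (fun n k => ?_) exp_neg_div_mem ?_ (fun x hx => ?_)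
    ((integrableOn_rpow_mul_exp_sub hα1 one_pos one_lt_two).const_mul _) (fun j => ?_) hg
  · have := (exp_neg_div_mem n k).2
    exact mul_nonneg (by positivity) (mul_nonneg (ha0 k) (mul_nonneg (Real.exp_pos _).le (by linarith)))
  · filter_upwards [eventually_gt_atTop 0] with n hn
    simpa using (hS n hn 0).summable
  · have hx : 0 < x := hx
    have : Real.exp (-(2*x)) ≤ Real.exp (-(1*x)) := Real.exp_le_exp.2 (by linarith)
    exact mul_nonneg (by positivity) (mul_nonneg (by positivity) (by linarith))
  · have h1 := tendsto_rpow_mul_of_tendsto_div h (r := ((j+1:ℕ):ℝ)) (by positivity)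
    have h2 := tendsto_rpow_mul_of_tendsto_div h (r := ((j+2:ℕ):ℝ)) (by positivity)
    have hI : ∫ x in Set.Ioi (0:ℝ), α * κ / Real.Gamma (1 - α) * (x^(-α-1) * (Real.exp (-(1*x)) - Real.exp (-(2*x)))) * Real.exp (-x)^j
        = κ * ((j+2:ℕ):ℝ)^α - κ * ((j+1:ℕ):ℝ)^α := by
      have h3 := integral_rpow_mul_exp_sub hα0 hα1 (b := ((j+1:ℕ):ℝ)) (c := ((j+2:ℕ):ℝ)) (by positivity)
        (by push_cast; linarith)
      have h4 : ∀ x : ℝ, α * κ / Real.Gamma (1 - α) * (x^(-α-1) * (Real.exp (-(1*x)) - Real.exp (-(2*x)))) * Real.exp (-x)^j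
          = α * κ / Real.Gamma (1 - α) * (x^(-α-1) * (Real.exp (-(((j+1:ℕ):ℝ)*x)) - Real.exp (-(((j+2:ℕ):ℝ)*x)))) := by
        intro x
        rw [mul_assoc, mul_assoc, sub_mul, ← Real.exp_nat_mul, ← Real.exp_add, ← Real.exp_add]
        push_cast; ring_nf
      simp only [h4]
      rw [MeasureTheory.integral_const_mul, h3]
      field_simp
    rw [hI]
    refine (h2.sub h1).congr' ?_
    filter_upwards [eventually_gt_atTop 0] with n hn
    rw [(hS n hn j).tsum_eq]
    ring

theorem exists_exp_bump {p q : ℝ} (hp : 0 < p) (hpq : p < q) : ∃ φ : ℝ → ℝ, Continuous φ ∧ (∀ y, 0 ≤ φ y) ∧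
    (∀ x, φ (Real.exp (-x)) ≠ 0 → p < x ∧ x < q) ∧
    MeasureTheory.Integrable (fun x => Real.exp (-x) * ((1 - Real.exp (-x)) * φ (Real.exp (-x)))) ∧
    0 < ∫ x in Set.Ioi (0:ℝ), Real.exp (-x) * ((1 - Real.exp (-x)) * φ (Real.exp (-x))) := by
  have hpos : ∀ x, 0 < (Real.exp (-x) - Real.exp (-q)) * (Real.exp (-p) - Real.exp (-x)) ↔ p < x ∧ x < q := by
    intro x
    have hE : Real.exp (-q) < Real.exp (-p) := Real.exp_lt_exp.2 (by linarith)
    constructor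
    · intro h
      rcases mul_pos_iff.1 h with ⟨h1, h2⟩ | ⟨h1, h2⟩
      · rw [sub_pos, Real.exp_lt_exp] at h1 h2
        exact ⟨by linarith, by linarith⟩
      · linarith
    · rintro ⟨h1, h2⟩
      exact mul_pos (sub_pos.2 (Real.exp_lt_exp.2 (by linarith))) (sub_pos.2 (Real.exp_lt_exp.2 (by linarith)))
  have hc : Continuous fun y => max 0 ((y - Real.exp (-q)) * (Real.exp (-p) - y)) := by fun_prop
  refine ⟨fun y => max 0 ((y - Real.exp (-q)) * (Real.exp (-p) - y)), hc, fun y => le_max_left _ _,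
    fun x hx => (hpos x).1 ?_, ?_⟩
  · by_contra h
    exact hx (max_eq_left (not_lt.1 h))
  · have hz : ∀ x, x ∉ Set.Icc p q →
        Real.exp (-x) * ((1 - Real.exp (-x)) * max 0 ((Real.exp (-x) - Real.exp (-q)) * (Real.exp (-p) - Real.exp (-x)))) = 0 := by
      intro x hx
      rw [max_eq_left (not_lt.1 fun h => hx ⟨((hpos x).1 h).1.le, ((hpos x).1 h).2.le⟩), mul_zero, mul_zero]
    have hcont : Continuous fun x => Real.exp (-x) * ((1 - Real.exp (-x)) *
        max 0 ((Real.exp (-x) - Real.exp (-q)) * (Real.exp (-p) - Real.exp (-x)))) := by fun_prop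
    have hsupp := HasCompactSupport.intro isCompact_Icc hz
    refine ⟨hcont.integrable_of_hasCompactSupport hsupp, ?_⟩
    have hz0 : ∀ x, x ∉ Set.Ioi (0:ℝ) → Real.exp (-x) * ((1 - Real.exp (-x)) *
        max 0 ((Real.exp (-x) - Real.exp (-q)) * (Real.exp (-p) - Real.exp (-x)))) = 0 :=
      fun x hx => hz x fun h => hx (hp.trans_le h.1)
    beta_reduce
    rw [MeasureTheory.setIntegral_eq_integral_of_forall_compl_eq_zero hz0]
    refine hcont.integral_pos_of_hasCompactSupport_nonneg_nonzero hsupp (x := (p+q)/2) (fun x => ?_) ?_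
    · by_cases hx : x ∈ Set.Icc p q
      · have : Real.exp (-x) ≤ 1 := Real.exp_le_one_iff.2 (by linarith [hx.1])
        exact mul_nonneg (Real.exp_pos _).le (mul_nonneg (by linarith) (le_max_left _ _))
      · exact (hz x hx).ge
    · have h1 := (hpos ((p+q)/2)).2 ⟨by linarith, by linarith⟩
      have h2 : Real.exp (-((p+q)/2)) < 1 := Real.exp_lt_one_iff.2 (by linarith)
      rw [max_eq_right h1.le]
      exact ne_of_gt (mul_pos (Real.exp_pos _) (mul_pos (by linarith) h1))

/-- A Tauberian theorem: the singular behaviour `κ (1 - s)^α` of a power series with antitone nonnegative coefficients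
determines the asymptotics of the coefficients. -/
theorem tendsto_rpow_mul_of_antitone {a : ℕ → ℝ} (ha0 : ∀ n, 0 ≤ a n) (ha : Antitone a) {α κ G₀ : ℝ}
    (hα0 : 0 < α) (hα1 : α < 1) (hκ : 0 ≤ κ)
    (h : Tendsto (fun s : ℝ => (G₀ - ∑' n, a n * s^n) / (1 - s)^α) (𝓝[<] 1) (𝓝 κ)) :
    Tendsto (fun n : ℕ => (n:ℝ)^(α + 1) * a n) atTop (𝓝 (α * κ / Real.Gamma (1 - α))) := by
  have hΓ := Real.Gamma_pos_of_pos (show 0 < 1 - α by linarith)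
  set C := α * κ / Real.Gamma (1 - α) with hC
  have hC0 : 0 ≤ C := by positivity
  have hcontC : Tendsto (fun p : ℝ => C * p^(-α-1)) (𝓝 1) (𝓝 C) := by
    have : ContinuousAt (fun p : ℝ => C * p^(-α-1)) 1 :=
      continuousAt_const.mul (Real.continuousAt_rpow_const _ _ (Or.inl one_ne_zero))
    simpa [ContinuousAt] using this
  have key : ∀ p q : ℝ, 0 < p → p < q → ∃ R S : ℕ → ℝ, ∃ L, Tendsto (fun n => S n / R n) atTop (𝓝 L) ∧
      L ∈ Set.Icc (C * q^(-α-1)) (C * p^(-α-1)) ∧ ∀ᶠ n : ℕ in atTop, 0 < R n ∧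
        (q ≤ 1 → (n:ℝ)^(α+1) * a n * R n ≤ S n) ∧ (1 ≤ p → S n ≤ (n:ℝ)^(α+1) * a n * R n) := by
    intro p q hp hpq
    obtain ⟨φ, hφ, hφ0, hφs, hRi, hR⟩ := exists_exp_bump hp hpq
    have hRn := tendsto_riemann_exp (g := fun y => (1 - y) * φ y) (by fun_prop)
    have hSn := tendsto_tsum_mul_of_tendsto_one_sub_rpow ha0 ha hα0 hα1 hκ h hφ
    rw [← hC] at hSn
    have hfin : ∀ n : ℕ, 0 < n → ∀ k ∉ Finset.range (⌈q * n⌉₊), φ (Real.exp (-((k:ℝ)/n))) = 0 := by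
      intro n hn k hk
      by_contra hne
      have h1 := (hφs _ hne).2
      rw [div_lt_iff₀ (by positivity)] at h1
      rw [Finset.mem_range, not_lt] at hk
      exact absurd (Nat.ceil_le.1 hk) (not_le.2 h1)
    refine ⟨_, _, _, hSn.div hRn hR.ne', ?_, ?_⟩
    · have hlow : ∀ x ∈ Set.Ioi (0:ℝ), C * q^(-α-1) * (Real.exp (-x) * ((1 - Real.exp (-x)) * φ (Real.exp (-x)))) ≤
          C * (x^(-α-1) * (Real.exp (-(1*x)) - Real.exp (-(2*x)))) * φ (Real.exp (-x)) ∧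
          C * (x^(-α-1) * (Real.exp (-(1*x)) - Real.exp (-(2*x)))) * φ (Real.exp (-x)) ≤
          C * p^(-α-1) * (Real.exp (-x) * ((1 - Real.exp (-x)) * φ (Real.exp (-x)))) := by
        intro x hx
        have hx : 0 < x := hx
        have h2 : Real.exp (-(2*x)) = Real.exp (-x) * Real.exp (-x) := by rw [← Real.exp_add]; ring_nf
        have h3 : 0 ≤ C * (Real.exp (-x) * ((1 - Real.exp (-x)) * φ (Real.exp (-x)))) :=
          mul_nonneg hC0 (mul_nonneg (Real.exp_pos _).le
            (mul_nonneg (sub_nonneg.2 (Real.exp_le_one_iff.2 (by linarith))) (hφ0 _)))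
        have h4 : C * (x^(-α-1) * (Real.exp (-(1*x)) - Real.exp (-(2*x)))) * φ (Real.exp (-x)) =
            x^(-α-1) * (C * (Real.exp (-x) * ((1 - Real.exp (-x)) * φ (Real.exp (-x))))) := by
          rw [h2, one_mul]; ring
        rw [h4, mul_right_comm, mul_comm _ (q^(-α-1)), mul_right_comm C, mul_comm _ (p^(-α-1))]
        by_cases hφx : φ (Real.exp (-x)) = 0
        · simp [hφx]
        · exact ⟨mul_le_mul_of_nonneg_right (Real.rpow_le_rpow_of_nonpos hx (hφs x hφx).2.le (by linarith)) h3,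
            mul_le_mul_of_nonneg_right (Real.rpow_le_rpow_of_nonpos hp (hφs x hφx).1.le (by linarith)) h3⟩
      have hRi' := hRi.integrableOn (s := Set.Ioi 0)
      have hSi : MeasureTheory.IntegrableOn
          (fun x => C * (x^(-α-1) * (Real.exp (-(1*x)) - Real.exp (-(2*x)))) * φ (Real.exp (-x))) (Set.Ioi 0) := by
        refine MeasureTheory.Integrable.mono' (hRi'.const_mul (C * p^(-α-1))) (by fun_prop) ?_
        filter_upwards [MeasureTheory.ae_restrict_mem measurableSet_Ioi] with x hx
        have hx' : 0 < x := hx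
        have : Real.exp (-(2*x)) ≤ Real.exp (-(1*x)) := Real.exp_le_exp.2 (by linarith)
        rw [Real.norm_of_nonneg (mul_nonneg (mul_nonneg hC0 (mul_nonneg (by positivity) (by linarith))) (hφ0 _))]
        exact (hlow x hx).2
      rw [Set.mem_Icc, le_div_iff₀ hR, div_le_iff₀ hR, ← MeasureTheory.integral_const_mul,
        ← MeasureTheory.integral_const_mul]
      exact ⟨MeasureTheory.setIntegral_mono_on (hRi'.const_mul _) hSi measurableSet_Ioi fun x hx => (hlow x hx).1,
        MeasureTheory.setIntegral_mono_on hSi (hRi'.const_mul _) measurableSet_Ioi fun x hx => (hlow x hx).2⟩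
    · filter_upwards [hRn.eventually (lt_mem_nhds hR), eventually_gt_atTop 0] with n hn hn0
      have hn0' : (0:ℝ) < n := by positivity
      have hs1 : Summable fun k : ℕ => (n:ℝ)⁻¹ * Real.exp (-((k:ℝ)/n)) * ((1 - Real.exp (-((k:ℝ)/n))) * φ (Real.exp (-((k:ℝ)/n)))) :=
        summable_of_ne_finset_zero fun k hk => by rw [hfin n hn0 k hk]; ring
      have hs2 : Summable fun k : ℕ => (n:ℝ)^α * (a k * (Real.exp (-((k:ℝ)/n)) * (1 - Real.exp (-((k:ℝ)/n)))))
          * φ (Real.exp (-((k:ℝ)/n))) :=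
        summable_of_ne_finset_zero fun k hk => by rw [hfin n hn0 k hk]; ring
      have he : ∀ k : ℕ, (n:ℝ)^(α+1) * a n * ((n:ℝ)⁻¹ * Real.exp (-((k:ℝ)/n)) * ((1 - Real.exp (-((k:ℝ)/n))) * φ (Real.exp (-((k:ℝ)/n)))))
          = (n:ℝ)^α * (a n * (Real.exp (-((k:ℝ)/n)) * (1 - Real.exp (-((k:ℝ)/n))))) * φ (Real.exp (-((k:ℝ)/n))) := by
        intro k
        rw [Real.rpow_add_one hn0'.ne']
        field_simp
      have hle : ∀ k m l : ℕ, a m ≤ a l →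
          (n:ℝ)^α * (a m * (Real.exp (-((k:ℝ)/n)) * (1 - Real.exp (-((k:ℝ)/n))))) * φ (Real.exp (-((k:ℝ)/n))) ≤
          (n:ℝ)^α * (a l * (Real.exp (-((k:ℝ)/n)) * (1 - Real.exp (-((k:ℝ)/n))))) * φ (Real.exp (-((k:ℝ)/n))) := by
        intro k m l hml
        have h1 := exp_neg_div_mem n k
        exact mul_le_mul_of_nonneg_right (mul_le_mul_of_nonneg_left
          (mul_le_mul_of_nonneg_right hml (mul_nonneg h1.1 (sub_nonneg.2 h1.2))) (by positivity)) (hφ0 _)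
      refine ⟨hn, fun hq => ?_, fun hp1 => ?_⟩
      · rw [← tsum_mul_left]
        refine (hs1.mul_left _).tsum_le_tsum (fun k => ?_) hs2
        rw [he]
        by_cases hk : φ (Real.exp (-((k:ℝ)/n))) = 0
        · rw [hk, mul_zero, mul_zero]
        · refine hle k n k (ha ?_)
          have h1 := (hφs _ hk).2.trans_le hq
          rw [div_lt_one hn0'] at h1
          exact_mod_cast h1.le
      · rw [← tsum_mul_left]
        refine hs2.tsum_le_tsum (fun k => ?_) (hs1.mul_left _)
        rw [he]
        by_cases hk : φ (Real.exp (-((k:ℝ)/n))) = 0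
        · rw [hk, mul_zero, mul_zero]
        · refine hle k k n (ha ?_)
          have h1 := hp1.trans_lt (hφs _ hk).1
          rw [one_lt_div hn0'] at h1
          exact_mod_cast h1.le
  refine tendsto_order.2 ⟨fun b hb => ?_, fun b hb => ?_⟩
  · obtain ⟨q, hqb, hq1⟩ := ((hcontC.mono_left nhdsWithin_le_nhds).eventually (lt_mem_nhds hb) |>.and
      (self_mem_nhdsWithin (s := Set.Ioi (1:ℝ)))).exists
    obtain ⟨R, S, L, hL, hLm, hev⟩ := key 1 q one_pos hq1
    filter_upwards [hL.eventually (lt_mem_nhds (hqb.trans_le hLm.1)), hev] with n hn ⟨h1, _, h2⟩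
    exact hn.trans_le ((div_le_iff₀ h1).2 (h2 le_rfl))
  · obtain ⟨p, ⟨hpb, hp0⟩, hp1⟩ := (((hcontC.eventually (gt_mem_nhds hb)).and
      (lt_mem_nhds (zero_lt_one' ℝ))).filter_mono nhdsWithin_le_nhds |>.and
      (self_mem_nhdsWithin (s := Set.Iio (1:ℝ)))).exists
    obtain ⟨R, S, L, hL, hLm, hev⟩ := key p 1 hp0 hp1
    filter_upwards [hL.eventually (gt_mem_nhds (hLm.2.trans_lt hpb)), hev] with n hn ⟨h1, h2, _⟩
    exact ((le_div_iff₀ h1).2 (h2 le_rfl)).trans_lt hn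

theorem excursionProb_nonneg (n : ℕ) : 0 ≤ excursionProb n :=
  div_nonneg (coneWalks_nonneg _ _ _) (by positivity)

theorem antitone_excursionProb : Antitone excursionProb := by
  refine antitone_nat_of_succ_le fun n => ?_
  have := coneWalks_le n
  rw [excursionProb, excursionProb, pow_succ, div_le_div_iff₀ (by positivity) (by positivity)]
  nlinarith [show (0:ℝ) < 16^n by positivity]

theorem tendsto_excursionProb : Tendsto (fun n : ℕ => (n:ℝ)^(5/3 : ℝ) * excursionProb n) atTop
    (𝓝 (32 / 9 * (Real.Gamma (2/3) / Real.pi) / 2^(5/3 : ℝ))) := by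
  obtain ⟨G₀, hG⟩ := tendsto_tsum_excursionProb
  have h := tendsto_rpow_mul_of_antitone excursionProb_nonneg
    antitone_excursionProb (by norm_num) (by norm_num) (by positivity) hG
  have hΓ := Real.Gamma_mul_Gamma_one_sub (1/3)
  rw [mul_one_div, Real.sin_pi_div_three, show (1:ℝ) - 1/3 = 2/3 by norm_num] at hΓ
  have h1 : 0 < Real.Gamma (1/3) := Real.Gamma_pos_of_pos (by norm_num)
  have h2 : (16:ℝ)^(2/3 : ℝ) = 2 * 2^(5/3 : ℝ) := by
    rw [show (16:ℝ) = 2^(4:ℝ) by norm_num, ← Real.rpow_mul (by norm_num), mul_comm 2,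
      ← Real.rpow_add_one two_ne_zero]
    norm_num
  have h3 : Real.Gamma (2/3) = 2 * Real.pi / (√3 * Real.Gamma (1/3)) := by
    have : √3 ≠ 0 := by positivity
    field_simp at hΓ ⊢
    linarith
  have h4 : √3 * √3 = (3:ℝ) := Real.mul_self_sqrt (by norm_num)
  rw [show (2/3 : ℝ) + 1 = 5/3 by norm_num, show (1:ℝ) - 2/3 = 1/3 by norm_num, h2] at h
  convert h using 2
  rw [h3]
  have h5 := Real.pi_pos
  have h6 : (0:ℝ) < 2^(5/3 : ℝ) := by positivity
  have h7 : √3 ≠ 0 := by positivity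
  generalize (2:ℝ)^(5/3 : ℝ) = z at *
  generalize Real.Gamma (1/3) = G at *
  generalize √3 = r at *
  field_simp
  linear_combination (-64) * h4

theorem diag_threeQuadrant_excursion_asymptotics :
    Asymptotics.IsEquivalent Filter.atTop
      (fun n : ℕ => (walkCount diagSteps coneC (0, 0) (0, 0) (2*n) : ℝ))
      (fun n : ℕ =>
        2^5 / 3^2 * (Real.Gamma (2/3) / Real.pi) * 4^(2*n) /
          ((2 * n : ℕ) : ℝ)^((5 : ℝ)/3)) := by
  have h0 : 0 < Real.Gamma (2/3) := Real.Gamma_pos_of_pos (by norm_num)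
  have hK : 32 / 9 * (Real.Gamma (2/3) / Real.pi) / 2^(5/3 : ℝ) ≠ 0 := by positivity
  have hw : ∀ n : ℕ, (walkCount diagSteps coneC (0, 0) (0, 0) (2*n) : ℝ) = excursionProb n * 16^n := fun n => by
    have h := walkCount_eq_coneWalks (2*n) 1 0
    norm_num at h
    rw [h, excursionProb, div_mul_cancel₀ _ (by positivity)]
  refine (Asymptotics.isEquivalent_iff_tendsto_one ?_).2 ?_
  · filter_upwards [eventually_gt_atTop 0] with n hn
    positivity
  · have h := tendsto_excursionProb.div_const (32 / 9 * (Real.Gamma (2/3) / Real.pi) / 2^(5/3 : ℝ))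
    rw [div_self hK] at h
    refine h.congr' ?_
    filter_upwards [eventually_gt_atTop 0] with n hn
    have h1 : (0:ℝ) < (n:ℝ)^(5/3 : ℝ) := by positivity
    have h2 : (0:ℝ) < 2^(5/3 : ℝ) := by positivity
    have h5 := Real.pi_pos
    rw [Pi.div_apply, hw, pow_mul, Nat.cast_mul, Nat.cast_ofNat, Real.mul_rpow (by norm_num) (by positivity)]
    generalize (2:ℝ)^(5/3 : ℝ) = z at *
    generalize (n:ℝ)^(5/3 : ℝ) = y at *
    generalize Real.Gamma (2/3) = G at *
    norm_num
    field_simp
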